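/- Let d ≥ 2. Suppose Ω : ℝ^d \ {0} → ℝ is homogeneous of degree zero, odd (Ω(−θ) = −Ω(θ) for θ ∈ S^{d−1}), and ‖Ω‖_{L log⁺L(S^{d−1})} < ∞. Let A : ℝ^d → ℝ be Lipschitz with Lipschitz constant ‖∇A‖_∞, and let F : ℝ → ℝ be even (F(t) = F(−t)) and real analytic on {t : |t| ≤ ‖∇A‖_∞}. Let the general Calderón commutator be given for f ∈ C_c^∞(ℝ^d) by T_{Ω,F,A} f(x) = p.v. ∫_{ℝ^d} (Ω(x−y)/|x−y|^d) F((A(x)−A(y))/|x−y|) f(y) dy, assumed to exist a.e. for such f. Then there is a constant C, depending on d, F and A but not on f or λ, such that for all λ > 0 and f ∈ C_c^∞(ℝ^d), m({x ∈ ℝ^d : |T_{Ω,F,A} f(x)| > λ}) ≤ C λ^{−1} 𝒞_Ω ‖f‖_{L¹}. -/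

import Mathlib

open MeasureTheory Metric Filter Topology ENNReal

noncomputable section

/-- The surface measure on the unit sphere `S^{d-1}` of `ℝ^d`. -/
def sphereMeasure (d : ℕ) :
    Measure (sphere (0 : EuclideanSpace ℝ (Fin d)) 1) :=
  (volume : Measure (EuclideanSpace ℝ (Fin d))).toSphere

/-- `‖Ω‖_{L¹(S^{d-1})}`. -/
def sphL1 (d : ℕ) (Ω : EuclideanSpace ℝ (Fin d) → ℝ) : ℝ :=
  ∫ θ : sphere (0 : EuclideanSpace ℝ (Fin d)) 1, |Ω θ| ∂(sphereMeasure d)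

/-- `‖Ω‖_{L log⁺ L(S^{d-1})} = ∫ |Ω| log(2+|Ω|)`. -/
def sphLlogL (d : ℕ) (Ω : EuclideanSpace ℝ (Fin d) → ℝ) : ℝ :=
  ∫ θ : sphere (0 : EuclideanSpace ℝ (Fin d)) 1,
    |Ω θ| * Real.log (2 + |Ω θ|) ∂(sphereMeasure d)

/-- The constant `𝒞_Ω`. -/
def COmega (d : ℕ) (Ω : EuclideanSpace ℝ (Fin d) → ℝ) : ℝ :=
  sphLlogL d Ω +
    ∫ θ : sphere (0 : EuclideanSpace ℝ (Fin d)) 1,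
      |Ω θ| * (1 + max (Real.log (|Ω θ| / sphL1 d Ω)) 0) ∂(sphereMeasure d)

set_option linter.unusedSectionVars false

section Polar

variable {E : Type*} [NormedAddCommGroup E] [InnerProductSpace ℝ E] [FiniteDimensional ℝ E]
  [MeasurableSpace E] [BorelSpace E]


theorem lintegral_polar [Nontrivial E] {f : E → ℝ≥0∞} (hf : Measurable f) :
    ∫⁻ x, f x = ∫⁻ θ : sphere (0 : E) 1, (∫⁻ r in Set.Ioi (0 : ℝ),
      ENNReal.ofReal (r ^ (Module.finrank ℝ E - 1)) * f (r • (θ : E))) ∂(volume : Measure E).toSphere := by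
  have hmp := (volume : Measure E).measurePreserving_homeomorphUnitSphereProd
  have h1 : ∫⁻ x, f x = ∫⁻ x : ({0}ᶜ : Set E), f x ∂(Measure.comap Subtype.val volume) := by
    rw [lintegral_subtype_comap (measurableSet_singleton _).compl f, restrict_compl_singleton]
  have h2 : ∀ x : ({0}ᶜ : Set E), f x =
      (fun p : sphere (0 : E) 1 × Set.Ioi (0 : ℝ) => f ((p.2 : ℝ) • (p.1 : E)))
        (homeomorphUnitSphereProd E x) := by
    intro x
    have hx : ‖(x : E)‖ ≠ 0 := norm_ne_zero_iff.2 x.2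
    simp [smul_smul, hx]
  have h3 : Measurable (fun p : sphere (0 : E) 1 × Set.Ioi (0 : ℝ) => f ((p.2 : ℝ) • (p.1 : E))) := by
    fun_prop
  have h4 := hmp.lintegral_comp h3
  rw [h1, lintegral_congr h2]
  refine h4.trans ?_
  rw [lintegral_prod]
  · refine lintegral_congr fun θ => ?_
    rw [Measure.volumeIoiPow, lintegral_withDensity_eq_lintegral_mul _ (by fun_prop)]
    · simp only [Pi.mul_apply]
      rw [lintegral_subtype_comap measurableSet_Ioi
        (fun r : ℝ => ENNReal.ofReal (r ^ (Module.finrank ℝ E - 1)) * f (r • (θ : E)))]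
    · fun_prop
  · exact h3.aemeasurable

theorem integral_polar [Nontrivial E] {f : E → ℂ} (hf : Integrable f) :
    ∫ x, f x = ∫ θ : sphere (0 : E) 1, (∫ r in Set.Ioi (0 : ℝ),
      (r ^ (Module.finrank ℝ E - 1)) • f (r • (θ : E))) ∂(volume : Measure E).toSphere := by
  have hmp := (volume : Measure E).measurePreserving_homeomorphUnitSphereProd
  have h1 : ∫ x, f x = ∫ x : ({0}ᶜ : Set E), f x ∂(Measure.comap Subtype.val volume) := by
    rw [integral_subtype_comap (measurableSet_singleton _).compl f, restrict_compl_singleton]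
  have h2 : ∀ x : ({0}ᶜ : Set E), f x =
      (fun p : sphere (0 : E) 1 × Set.Ioi (0 : ℝ) => f ((p.2 : ℝ) • (p.1 : E)))
        (homeomorphUnitSphereProd E x) := by
    intro x
    have hx : ‖(x : E)‖ ≠ 0 := norm_ne_zero_iff.2 x.2
    simp [smul_smul, hx]
  have h_integrable : Integrable (fun x : ({0}ᶜ : Set E) => f x) (Measure.comap Subtype.val volume) := by
    have := (integrableOn_iff_comap_subtypeVal (μ := (volume : Measure E)) (f := f)
      (measurableSet_singleton (0 : E)).compl).1 hf.integrableOn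
    exact this
  have h4 := hmp.integral_comp (Homeomorph.measurableEmbedding _)
    (fun p : sphere (0 : E) 1 × Set.Ioi (0 : ℝ) => f ((p.2 : ℝ) • (p.1 : E)))
  rw [h1, integral_congr_ae (Eventually.of_forall h2)]
  refine h4.trans ?_
  rw [integral_prod]
  · refine integral_congr_ae (Eventually.of_forall fun θ => ?_)
    simp only
    rw [Measure.volumeIoiPow]
    have : (fun r : Set.Ioi (0 : ℝ) => ENNReal.ofReal ((r : ℝ) ^ (Module.finrank ℝ E - 1))) =
      fun r : Set.Ioi (0 : ℝ) => ((Real.toNNReal ((r : ℝ) ^ (Module.finrank ℝ E - 1)) : NNReal) : ℝ≥0∞) := rfl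
    rw [this, integral_withDensity_eq_integral_smul (by fun_prop)]
    rw [← integral_subtype_comap measurableSet_Ioi
        (fun r : ℝ => (r ^ (Module.finrank ℝ E - 1)) • f (r • (θ : E)))]
    refine integral_congr_ae (Eventually.of_forall fun r => ?_)
    have hr : (0 : ℝ) < r := r.2
    simp only [NNReal.smul_def]
    rw [Real.coe_toNNReal _ (by positivity)]
  · rw [← hmp.integrable_comp_emb (Homeomorph.measurableEmbedding _)]
    exact h_integrable.congr (Eventually.of_forall h2)

/-- The dyadic shell `2^j ≤ ‖w‖ < 2^(j+1)`. -/
def shell (E : Type*) [NormedAddCommGroup E] (j : ℤ) : Set E :=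
  {w : E | (2 : ℝ) ^ j ≤ ‖w‖ ∧ ‖w‖ < (2 : ℝ) ^ (j + 1)}

omit [InnerProductSpace ℝ E] [FiniteDimensional ℝ E] in
theorem measurableSet_shell (j : ℤ) : MeasurableSet (shell E j) :=
  (measurableSet_le measurable_const measurable_norm).inter
    (measurableSet_lt measurable_norm measurable_const)

theorem lintegral_shell_le [Nontrivial E] {f : E → ℝ≥0∞} (hf : Measurable f)
    (hom : ∀ r : ℝ, 0 < r → ∀ x : E, x ≠ 0 → f (r • x) = f x) (j : ℤ) :
    ∫⁻ w, (shell E j).indicator (fun w => f w * ENNReal.ofReal ((‖w‖ ^ Module.finrank ℝ E)⁻¹)) w ≤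
      ∫⁻ θ : sphere (0 : E) 1, f θ ∂(volume : Measure E).toSphere := by
  rw [lintegral_polar ((by fun_prop : Measurable _).indicator (measurableSet_shell j))]
  refine lintegral_mono fun θ => ?_
  have hθ : ‖(θ : E)‖ = 1 := by simp
  have hθ0 : (θ : E) ≠ 0 := by intro h; simp [h] at hθ
  have hd : 0 < Module.finrank ℝ E := Module.finrank_pos
  calc ∫⁻ r in Set.Ioi (0 : ℝ), ENNReal.ofReal (r ^ (Module.finrank ℝ E - 1)) *
        (shell E j).indicator (fun w => f w * ENNReal.ofReal ((‖w‖ ^ Module.finrank ℝ E)⁻¹)) (r • (θ : E))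
      ≤ ∫⁻ r : ℝ, (Set.Ico ((2 : ℝ) ^ j) ((2 : ℝ) ^ (j + 1))).indicator
          (fun _ => f θ * ENNReal.ofReal (((2 : ℝ) ^ j)⁻¹)) r := by
        refine (setLIntegral_mono' measurableSet_Ioi fun r hr => ?_).trans
          (setLIntegral_le_lintegral _ _)
        have hr : 0 < r := hr
        have hn : ‖r • (θ : E)‖ = r := by rw [norm_smul, hθ, mul_one, Real.norm_of_nonneg hr.le]
        by_cases hs : r • (θ : E) ∈ shell E j
        · have hs' : r ∈ Set.Ico ((2 : ℝ) ^ j) ((2 : ℝ) ^ (j + 1)) := by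
            simpa [shell, hn] using hs
          rw [Set.indicator_of_mem hs, Set.indicator_of_mem hs', hn, hom r hr _ hθ0,
            mul_left_comm, ← ENNReal.ofReal_mul (by positivity)]
          gcongr
          have : r ^ Module.finrank ℝ E = r ^ (Module.finrank ℝ E - 1) * r := by
            rw [← pow_succ]; congr 1; omega
          rw [this, mul_inv, ← mul_assoc, mul_inv_cancel₀ (by positivity), one_mul]
          have h2 : (0 : ℝ) < 2 ^ j := by positivity
          exact inv_anti₀ h2 hs'.1
        · rw [Set.indicator_of_notMem hs]; simp
    _ = f θ := by
        rw [lintegral_indicator measurableSet_Ico, setLIntegral_const, Real.volume_Ico,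
          mul_assoc, ← ENNReal.ofReal_mul (by positivity), zpow_add_one₀ two_ne_zero]
        have h2 : (0 : ℝ) < 2 ^ j := by positivity
        have : ((2 : ℝ) ^ j)⁻¹ * (2 ^ j * 2 - 2 ^ j) = 1 := by field_simp; norm_num
        rw [this]; simp

end Polar

section Multipliers
open scoped FourierTransform SchwartzMap

variable {E : Type*} [NormedAddCommGroup E] [InnerProductSpace ℝ E] [FiniteDimensional ℝ E]
  [MeasurableSpace E] [BorelSpace E]

/-- The `L¹` modulus of continuity of a `C¹` function is controlled by its gradient. -/
theorem lintegral_translate_sub_le {b : E → ℂ} (hb : ContDiff ℝ 1 b) (v : E) :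
    ∫⁻ x, ‖b (x - v) - b x‖ₑ ≤ ‖v‖ₑ * ∫⁻ x, ‖fderiv ℝ b x‖ₑ := by
  have hc : Continuous (fderiv ℝ b) := hb.continuous_fderiv one_ne_zero
  have key : ∀ x, ‖b (x - v) - b x‖ₑ ≤
      ∫⁻ s in Set.Ioc (0 : ℝ) 1, ‖fderiv ℝ b (x - s • v)‖ₑ * ‖v‖ₑ := by
    intro x
    have hd : ∀ s : ℝ, HasDerivAt (fun s : ℝ => b (x - s • v)) (fderiv ℝ b (x - s • v) (-v)) s := by
      intro s
      have h1 : HasDerivAt (fun s : ℝ => x - s • v) (-v) s := by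
        simpa using ((hasDerivAt_id s).smul_const v).const_sub x
      exact ((hb.differentiable one_ne_zero _).hasFDerivAt).comp_hasDerivAt s h1
    have hc' : Continuous fun s : ℝ => fderiv ℝ b (x - s • v) (-v) := by fun_prop
    have := intervalIntegral.integral_eq_sub_of_hasDerivAt (a := 0) (b := 1)
      (fun s _ => hd s) (hc'.intervalIntegrable _ _)
    simp only [one_smul, zero_smul, sub_zero] at this
    rw [← this, intervalIntegral.integral_of_le zero_le_one]
    refine (enorm_integral_le_lintegral_enorm _).trans (lintegral_mono fun s => ?_)
    simpa using (fderiv ℝ b (x - s • v)).le_opENorm (-v)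
  calc ∫⁻ x, ‖b (x - v) - b x‖ₑ
      ≤ ∫⁻ x, ∫⁻ s in Set.Ioc (0 : ℝ) 1, ‖fderiv ℝ b (x - s • v)‖ₑ * ‖v‖ₑ := lintegral_mono key
    _ = ∫⁻ s in Set.Ioc (0 : ℝ) 1, ∫⁻ x, ‖fderiv ℝ b (x - s • v)‖ₑ * ‖v‖ₑ := by
        apply lintegral_lintegral_swap
        apply Measurable.aemeasurable
        have : Measurable (fun p : E × ℝ => ‖fderiv ℝ b (p.1 - p.2 • v)‖ₑ) :=
          Continuous.measurable (by fun_prop)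
        exact this.mul_const _
    _ = ∫⁻ s in Set.Ioc (0 : ℝ) 1, ‖v‖ₑ * ∫⁻ x, ‖fderiv ℝ b x‖ₑ := by
        refine lintegral_congr fun s => ?_
        rw [lintegral_mul_const _ (by fun_prop), mul_comm,
          lintegral_sub_right_eq_self (fun x => ‖fderiv ℝ b x‖ₑ)]
    _ = _ := by simp

/-- The average of the translates of `K` along the line `ℝ v` with density `ψ`. -/
def lineAvg (ψ : ℝ → ℂ) (K : E → ℂ) (v : E) (x : E) : ℂ := ∫ u : ℝ, ψ u * K (x - u • v)

theorem lineAvg_integrable_prod {ψ : ℝ → ℂ} {K : E → ℂ} (hψ : Integrable ψ) (hK : Integrable K)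
    (v : E) : Integrable (fun p : ℝ × E => ψ p.1 * K (p.2 - p.1 • v)) (volume.prod volume) := by
  have h := hψ.mul_prod hK
  have hmp : MeasurePreserving (fun p : ℝ × E => (p.1, p.2 - p.1 • v))
      ((volume : Measure ℝ).prod (volume : Measure E)) (volume.prod volume) := by
    have : MeasurePreserving (fun p : ℝ × E => (id p.1, (fun u x => x - u • v) p.1 p.2))
      ((volume : Measure ℝ).prod (volume : Measure E)) (volume.prod volume) :=
      (MeasurePreserving.id _).skew_product (by fun_prop)
        (Eventually.of_forall fun u => (measurePreserving_sub_right volume (u • v)).map_eq)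
    exact this
  exact hmp.integrable_comp_of_integrable h

theorem lineAvg_integrable {ψ : ℝ → ℂ} {K : E → ℂ} (hψ : Integrable ψ) (hK : Integrable K)
    (v : E) : Integrable (lineAvg ψ K v) :=
  (lineAvg_integrable_prod hψ hK v).integral_prod_right

theorem lintegral_lineAvg_le {ψ : ℝ → ℂ} {K : E → ℂ} (hψ : Measurable ψ) (hK : Measurable K)
    (v : E) : ∫⁻ x, ‖lineAvg ψ K v x‖ₑ ≤ (∫⁻ u, ‖ψ u‖ₑ) * ∫⁻ x, ‖K x‖ₑ := by
  calc ∫⁻ x, ‖lineAvg ψ K v x‖ₑ ≤ ∫⁻ x, ∫⁻ u : ℝ, ‖ψ u‖ₑ * ‖K (x - u • v)‖ₑ := by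
        refine lintegral_mono fun x => (enorm_integral_le_lintegral_enorm _).trans ?_
        simp [enorm_mul]
    _ = ∫⁻ u : ℝ, ∫⁻ x, ‖ψ u‖ₑ * ‖K (x - u • v)‖ₑ := by
        apply lintegral_lintegral_swap
        apply Measurable.aemeasurable
        fun_prop
    _ = _ := by
        rw [← lintegral_mul_const _ (by fun_prop)]
        refine lintegral_congr fun u => ?_
        rw [lintegral_const_mul _ (by fun_prop),
          lintegral_sub_right_eq_self (fun x => ‖K x‖ₑ)]

theorem lineAvg_fourier {ψ : ℝ → ℂ} {K : E → ℂ} (hψ : Integrable ψ) (hK : Integrable K)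
    (v ξ : E) : 𝓕 (lineAvg ψ K v) ξ = 𝓕 ψ (inner ℝ v ξ) * 𝓕 K ξ := by
  simp only [Real.fourier_eq, lineAvg]
  have h1 : ∀ x : E, (Real.fourierChar (-inner ℝ x ξ)) • ∫ u : ℝ, ψ u * K (x - u • v) =
      ∫ u : ℝ, (Real.fourierChar (-inner ℝ x ξ)) • (ψ u * K (x - u • v)) := by
    intro x; simp only [Circle.smul_def]; rw [integral_smul]
  simp_rw [h1]
  rw [integral_integral_swap]
  · have h2 : ∀ u : ℝ, ∫ x, (Real.fourierChar (-inner ℝ x ξ)) • (ψ u * K (x - u • v)) =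
      (Real.fourierChar (-inner ℝ u (inner ℝ v ξ)) • ψ u) *
        ∫ x, (Real.fourierChar (-inner ℝ x ξ)) • K x := by
      intro u
      rw [← integral_sub_right_eq_self _ (-(u • v)), ← integral_const_mul]
      congr 1; ext x
      simp only [sub_neg_eq_add, add_sub_cancel_right, Circle.smul_def, inner_add_left, neg_add,
        AddChar.map_add_eq_mul, inner_smul_left, smul_eq_mul, Circle.coe_mul]
      simp
      ring_nf
    simp_rw [h2]
    rw [integral_mul_const]
  · have h3 := (lineAvg_integrable_prod hψ hK v).swap
    have h4 : Continuous fun p : E × ℝ => (Real.fourierChar (-inner ℝ p.1 ξ) : ℂ) := by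
      fun_prop
    refine h3.congr' (h4.aestronglyMeasurable.mul h3.aestronglyMeasurable)
      (Eventually.of_forall fun p => ?_)
    change ‖ψ p.2 * K (p.1 - p.2 • v)‖ =
      ‖Real.fourierChar (-inner ℝ p.1 ξ) • (ψ p.2 * K (p.1 - p.2 • v))‖
    rw [Circle.norm_smul]

/-- The line average commutes with translations. -/
theorem lineAvg_translate (ψ : ℝ → ℂ) (K : E → ℂ) (v w x : E) :
    lineAvg ψ K v (x - w) = lineAvg ψ (fun z => K (z - w)) v x := by
  simp only [lineAvg, sub_right_comm]

theorem lineAvg_sub {ψ : ℝ → ℂ} {K K' : E → ℂ} (hψ : Integrable ψ) (hK : Continuous K)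
    (hK' : Continuous K') {C C' : ℝ} (hC : ∀ x, ‖K x‖ ≤ C) (hC' : ∀ x, ‖K' x‖ ≤ C') (v x : E) :
    lineAvg ψ (fun z => K z - K' z) v x = lineAvg ψ K v x - lineAvg ψ K' v x := by
  simp only [lineAvg, mul_sub]
  apply integral_sub
  · exact hψ.mul_bdd (c := C) (by fun_prop) (Eventually.of_forall fun u => hC _)
  · exact hψ.mul_bdd (c := C') (by fun_prop) (Eventually.of_forall fun u => hC' _)

theorem continuous_lineAvg {ψ : ℝ → ℂ} {K : E → ℂ} (hψ : Integrable ψ) (hK : Continuous K)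
    {C : ℝ} (hC : ∀ x, ‖K x‖ ≤ C) (v : E) : Continuous (lineAvg ψ K v) := by
  refine continuous_of_dominated (bound := fun u => ‖ψ u‖ * C) (fun x => ?_) (fun x => ?_)
    (hψ.norm.mul_const C) ?_
  · exact hψ.aestronglyMeasurable.mul (by fun_prop)
  · refine Eventually.of_forall fun u => ?_
    rw [norm_mul]
    gcongr
    exact hC _
  · exact Eventually.of_forall fun u => by fun_prop

theorem norm_lineAvg_le {ψ : ℝ → ℂ} {K : E → ℂ} (hψ : Integrable ψ) 
    {C : ℝ} (hC : ∀ x, ‖K x‖ ≤ C) (v x : E) : ‖lineAvg ψ K v x‖ ≤ (∫ u, ‖ψ u‖) * C := by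
  rw [← integral_mul_const]
  refine norm_integral_le_of_norm_le (hψ.norm.mul_const C) (Eventually.of_forall fun u => ?_)
  rw [norm_mul]
  gcongr
  exact hC _

/-- A continuous integrable function with vanishing Fourier transform vanishes. -/
theorem eq_zero_of_fourier_eq_zero {K : E → ℂ} (hK : Integrable K) (hc : Continuous K)
    (h : 𝓕 K = 0) (x : E) : K x = 0 := by
  have := hc.fourierInv_fourier_eq hK (by rw [h]; exact integrable_zero _ _ _)
  rw [← this, h]
  simp [Real.fourierInv_eq]

/-- A smooth cutoff, equal to `1` on the unit ball and supported in the ball of radius `√2`. -/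
def cutoff (V : Type*) [NormedAddCommGroup V] (ξ : V) : ℝ := Real.smoothTransition (2 - ‖ξ‖ ^ 2)

section cutoff
variable {V : Type*} [NormedAddCommGroup V] 

theorem cutoff_nonneg (ξ : V) : 0 ≤ cutoff V ξ := Real.smoothTransition.nonneg _
theorem cutoff_le_one (ξ : V) : cutoff V ξ ≤ 1 := Real.smoothTransition.le_one _
theorem cutoff_eq_one {ξ : V} (h : ‖ξ‖ ≤ 1) : cutoff V ξ = 1 := by
  apply Real.smoothTransition.one_of_one_le
  nlinarith [norm_nonneg ξ]
theorem cutoff_eq_zero {ξ : V} (h : 2 ≤ ‖ξ‖ ^ 2) : cutoff V ξ = 0 := by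
  apply Real.smoothTransition.zero_of_nonpos
  linarith
theorem cutoff_anti {ξ η : V} (h : ‖ξ‖ ≤ ‖η‖) : cutoff V η ≤ cutoff V ξ := by
  apply Real.smoothTransition.monotone
  gcongr

variable [InnerProductSpace ℝ V]

theorem contDiff_cutoff {n : WithTop ℕ∞} (hn : n ≤ (⊤ : ℕ∞)) : ContDiff ℝ n (cutoff V) := by
  have : ContDiff ℝ (⊤ : ℕ∞) (cutoff V) :=
    Real.smoothTransition.contDiff.comp (contDiff_const.sub (contDiff_norm_sq ℝ))
  exact this.of_le hn

variable [FiniteDimensional ℝ V]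

theorem hasCompactSupport_cutoff : HasCompactSupport (cutoff V) := by
  refine HasCompactSupport.of_support_subset_isCompact (isCompact_closedBall (0 : V) 2) ?_
  intro ξ hξ
  by_contra h
  apply hξ
  apply cutoff_eq_zero
  simp only [mem_closedBall, dist_zero_right, not_le] at h
  nlinarith

/-- The cutoff as a Schwartz function. -/
def cutoffS (V : Type*) [NormedAddCommGroup V] [InnerProductSpace ℝ V] [FiniteDimensional ℝ V] :
    𝓢(V, ℂ) :=
  HasCompactSupport.toSchwartzMap (f := fun ξ : V => (cutoff V ξ : ℂ))
    (hasCompactSupport_cutoff.comp_left Complex.ofReal_zero)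
    (Complex.ofRealCLM.contDiff.comp (contDiff_cutoff le_rfl))

theorem cutoffS_apply (ξ : V) : cutoffS V ξ = cutoff V ξ := rfl
end cutoff

end Multipliers

section Kernels
open scoped FourierTransform SchwartzMap

variable {E : Type*} [NormedAddCommGroup E] [InnerProductSpace ℝ E] [FiniteDimensional ℝ E]
  [MeasurableSpace E] [BorelSpace E]

theorem lintegral_comp_smul_of_pos (f : E → ℝ≥0∞) {c : ℝ} (hc : 0 < c) :
    ∫⁻ x, f (c • x) = ENNReal.ofReal ((c ^ Module.finrank ℝ E)⁻¹) * ∫⁻ x, f x := by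
  have h := Measure.map_addHaar_smul (volume : Measure E) hc.ne'
  have h2 := (Homeomorph.smulOfNeZero c hc.ne').measurableEmbedding.lintegral_map
    (μ := (volume : Measure E)) f
  have h3 : (⇑(Homeomorph.smulOfNeZero c hc.ne') : E → E) = fun x => c • x := rfl
  rw [h3] at h2
  rw [← h2, h, lintegral_smul_measure, abs_of_pos (by positivity), smul_eq_mul]

/-- The inverse Fourier transform of the smooth cutoff. -/
def phi0 (E : Type*) [NormedAddCommGroup E] [InnerProductSpace ℝ E] [FiniteDimensional ℝ E]
  [MeasurableSpace E] [BorelSpace E] : 𝓢(E, ℂ) := 𝓕⁻ (cutoffS E)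

theorem fourier_phi0 (ξ : E) : 𝓕 (phi0 E : E → ℂ) ξ = cutoff E ξ := by
  rw [← SchwartzMap.fourier_coe, phi0, FourierTransform.fourier_fourierInv_eq, cutoffS_apply]

/-- The kernel of the smooth Fourier cutoff at frequency `c`. -/
def Phi (c : ℝ) (x : E) : ℂ := ((c ^ Module.finrank ℝ E : ℝ) : ℂ) * phi0 E (c • x)

theorem contDiff_Phi (c : ℝ) : ContDiff ℝ 1 (Phi c : E → ℂ) := by
  unfold Phi
  have := (phi0 E).smooth 1
  fun_prop

theorem continuous_Phi (c : ℝ) : Continuous (Phi c : E → ℂ) := (contDiff_Phi c).continuous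

theorem integrable_Phi {c : ℝ} (hc : 0 < c) : Integrable (Phi c : E → ℂ) :=
  ((phi0 E).integrable.comp_smul hc.ne').const_mul _

theorem bounded_Phi (c : ℝ) : ∃ C, ∀ x : E, ‖Phi c x‖ ≤ C := by
  obtain ⟨C, hC⟩ := (phi0 E).decay 0 0
  refine ⟨‖((c ^ Module.finrank ℝ E : ℝ) : ℂ)‖ * C, fun x => ?_⟩
  rw [Phi, norm_mul]
  gcongr
  simpa using hC.2 (c • x)

theorem lintegral_Phi {c : ℝ} (hc : 0 < c) :
    ∫⁻ x : E, ‖Phi c x‖ₑ = ∫⁻ x, ‖phi0 E x‖ₑ := by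
  simp only [Phi, enorm_mul]
  have hcont : Continuous (fun x => phi0 E x) := (phi0 E).continuous
  have hm : Measurable fun x : E => ‖phi0 E (c • x)‖ₑ :=
    (Continuous.measurable (by fun_prop : Continuous fun x => phi0 E (c • x))).enorm
  rw [lintegral_const_mul _ hm,
    lintegral_comp_smul_of_pos (fun x => ‖phi0 E x‖ₑ) hc, ← mul_assoc]
  have : ‖((c ^ Module.finrank ℝ E : ℝ) : ℂ)‖ₑ = ENNReal.ofReal (c ^ Module.finrank ℝ E) := by
    rw [← ofReal_norm, Complex.norm_real, Real.norm_of_nonneg (by positivity)]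
  rw [this, ← ENNReal.ofReal_mul (by positivity), mul_inv_cancel₀ (by positivity)]
  simp

theorem lintegral_Phi_translate {c : ℝ} (hc : 0 < c) (v : E) :
    ∫⁻ x : E, ‖Phi c (x - v) - Phi c x‖ₑ ≤
      ENNReal.ofReal c * ‖v‖ₑ * ∫⁻ x, ‖fderiv ℝ (phi0 E) x‖ₑ := by
  have h : ∀ x : E, ‖Phi c (x - v) - Phi c x‖ₑ = ENNReal.ofReal (c ^ Module.finrank ℝ E) *
      (fun y => ‖phi0 E (y - c • v) - phi0 E y‖ₑ) (c • x) := by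
    intro x
    have : ‖((c ^ Module.finrank ℝ E : ℝ) : ℂ)‖ₑ = ENNReal.ofReal (c ^ Module.finrank ℝ E) := by
      rw [← ofReal_norm, Complex.norm_real, Real.norm_of_nonneg (by positivity)]
    simp only [Phi, ← mul_sub, enorm_mul, this, smul_sub]
  rw [lintegral_congr h]
  have hcont := (phi0 E).continuous
  rw [lintegral_const_mul _ (Continuous.measurable (by fun_prop)),
    lintegral_comp_smul_of_pos (fun y => ‖phi0 E (y - c • v) - phi0 E y‖ₑ) hc, ← mul_assoc,
    ← ENNReal.ofReal_mul (by positivity), mul_inv_cancel₀ (by positivity), ENNReal.ofReal_one,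
    one_mul]
  refine (lintegral_translate_sub_le ((phi0 E).smooth 1) (c • v)).trans ?_
  rw [enorm_smul, Real.enorm_of_nonneg hc.le]

theorem fourier_Phi {c : ℝ} (hc : 0 < c) (ξ : E) : 𝓕 (Phi c : E → ℂ) ξ = cutoff E (c⁻¹ • ξ) := by
  rw [← fourier_phi0]
  simp only [Real.fourier_eq, Phi]
  have : ∀ v : E, Real.fourierChar (-inner ℝ v ξ) •
      (((c ^ Module.finrank ℝ E : ℝ) : ℂ) * phi0 E (c • v)) = ((c ^ Module.finrank ℝ E : ℝ) : ℂ) *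
        (fun w => Real.fourierChar (-inner ℝ w (c⁻¹ • ξ)) • phi0 E w) (c • v) := by
    intro v
    simp only [inner_smul_left, inner_smul_right, Circle.smul_def, smul_eq_mul]
    simp only [conj_trivial]
    rw [inv_mul_cancel_left₀ hc.ne']
    ring
  rw [integral_congr_ae (Eventually.of_forall this), integral_const_mul,
    Measure.integral_comp_smul volume (fun w => Real.fourierChar (-inner ℝ w (c⁻¹ • ξ)) • phi0 E w),
    abs_of_pos (by positivity)]
  rw [Complex.real_smul, ← mul_assoc, ← Complex.ofReal_mul, mul_inv_cancel₀ (by positivity)]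
  simp

/-- Convolution of complex functions. -/
def cv (f g : E → ℂ) : E → ℂ := convolution f g (ContinuousLinearMap.mul ℂ ℂ) volume

theorem cv_apply (f g : E → ℂ) (x : E) : cv f g x = ∫ t, f t * g (x - t) := rfl

theorem cv_comm (f g : E → ℂ) : cv f g = cv g f := by
  ext x
  rw [cv, convolution_mul_swap, cv_apply]
  simp only [mul_comm]

theorem integrable_cv {f g : E → ℂ} (hf : Integrable f) (hg : Integrable g) :
    Integrable (cv f g) := hf.integrable_convolution _ hg

theorem lintegral_cv_le {f g : E → ℂ} (hf : AEStronglyMeasurable f) (hg : AEStronglyMeasurable g) :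
    ∫⁻ x, ‖cv f g x‖ₑ ≤ (∫⁻ x, ‖f x‖ₑ) * ∫⁻ x, ‖g x‖ₑ := by
  calc ∫⁻ x, ‖cv f g x‖ₑ ≤ ∫⁻ x, ∫⁻ t, ‖f t‖ₑ * ‖g (x - t)‖ₑ := by
        refine lintegral_mono fun x => (enorm_integral_le_lintegral_enorm _).trans ?_
        simp [enorm_mul]
    _ = ∫⁻ t, ∫⁻ x, ‖f t‖ₑ * ‖g (x - t)‖ₑ := by
        apply lintegral_lintegral_swap
        have := hf.convolution_integrand (ContinuousLinearMap.mul ℂ ℂ) hg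
        simpa [Function.uncurry_def] using this.enorm
    _ = _ := by
        rw [← lintegral_mul_const'' _ hf.enorm]
        refine lintegral_congr fun t => ?_
        rw [lintegral_const_mul'' _ (by
          exact (hg.comp_measurePreserving (measurePreserving_sub_right volume t)).enorm), 
          lintegral_sub_right_eq_self (fun x => ‖g x‖ₑ)]

theorem fourier_cv {f g : E → ℂ} (hf : Integrable f) (hg : Integrable g) (ξ : E) :
    𝓕 (cv f g) ξ = 𝓕 f ξ * 𝓕 g ξ := by
  exact Real.fourier_mul_convolution_eq hf hg ξ

/-- If `b` has mean zero and is supported in a ball, then convolving it with `K` gains the modulus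
of continuity of `K`. -/
theorem lintegral_cv_cancel_le {K b : E → ℂ} (hK : Continuous K) (hKb : ∃ C, ∀ x, ‖K x‖ ≤ C)
    (hb : Integrable b) (hbc : Measurable b) {c : E} {R : ℝ} (hsupp : ∀ x, R < ‖x - c‖ → b x = 0)
    (h0 : ∫ x, b x = 0) {D : ℝ≥0∞}
    (hD : ∀ v : E, ‖v‖ ≤ R → ∫⁻ x, ‖K (x - v) - K x‖ₑ ≤ D) :
    ∫⁻ x, ‖cv K b x‖ₑ ≤ D * ∫⁻ x, ‖b x‖ₑ := by
  obtain ⟨C, hC⟩ := hKb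
  have h1 : ∀ x, cv K b x = ∫ y, b y * (K (x - y) - K (x - c)) := by
    intro x
    rw [cv_comm, cv_apply]
    simp only [mul_sub]
    rw [integral_sub, integral_mul_const, h0, zero_mul, sub_zero]
    · exact hb.mul_bdd (c := C) (by fun_prop) (Eventually.of_forall fun u => hC _)
    · exact hb.mul_const _
  calc ∫⁻ x, ‖cv K b x‖ₑ ≤ ∫⁻ x, ∫⁻ y, ‖b y‖ₑ * ‖K (x - y) - K (x - c)‖ₑ := by
        refine lintegral_mono fun x => ?_
        rw [h1]
        refine (enorm_integral_le_lintegral_enorm _).trans ?_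
        simp [enorm_mul]
    _ = ∫⁻ y, ∫⁻ x, ‖b y‖ₑ * ‖K (x - y) - K (x - c)‖ₑ := by
        apply lintegral_lintegral_swap
        apply Measurable.aemeasurable
        have := hK.measurable
        fun_prop
    _ ≤ ∫⁻ y, D * ‖b y‖ₑ := by
        refine lintegral_mono fun y => ?_
        have := hK.measurable
        rw [lintegral_const_mul _ (by fun_prop)]
        by_cases hy : R < ‖y - c‖
        · simp [hsupp y hy]
        · rw [mul_comm]
          gcongr
          rw [← lintegral_add_right_eq_self _ c]
          simp only [add_sub_cancel_right]
          refine le_trans (le_of_eq ?_) (hD (y - c) (not_lt.1 hy))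
          refine lintegral_congr fun x => ?_
          congr 3; abel
    _ = _ := lintegral_const_mul _ hbc.enorm

end Kernels

section LPKernels
open scoped FourierTransform SchwartzMap

variable {E : Type*} [NormedAddCommGroup E] [InnerProductSpace ℝ E] [FiniteDimensional ℝ E]
  [MeasurableSpace E] [BorelSpace E]

theorem SchwartzMap.lintegral_enorm_lt_top (f : 𝓢(E, ℂ)) : ∫⁻ x, ‖f x‖ₑ < ∞ :=
  f.integrable.hasFiniteIntegral

theorem lintegral_fderiv_schwartz_lt_top (f : 𝓢(E, ℂ)) : ∫⁻ x, ‖fderiv ℝ f x‖ₑ < ∞ := by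
  have := (SchwartzMap.fderivCLM ℝ E ℂ f).integrable (μ := volume)
  exact this.hasFiniteIntegral

theorem lintegral_norm_mul_Phi_lt_top {c : ℝ} (hc : 0 < c) :
    ∫⁻ x : E, ‖x‖ₑ * ‖Phi c x‖ₑ < ∞ := by
  have h := ((phi0 E).integrable_pow_mul volume 1).comp_smul hc.ne'
  have h2 : ∫⁻ x : E, ‖‖c • x‖ ^ 1 * ‖phi0 E (c • x)‖‖ₑ < ∞ := h.hasFiniteIntegral
  have h3 : ∀ x : E, ‖x‖ₑ * ‖Phi c x‖ₑ =
      (‖((c ^ Module.finrank ℝ E : ℝ) : ℂ)‖ₑ * ENNReal.ofReal c⁻¹) *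
        ‖‖c • x‖ ^ 1 * ‖phi0 E (c • x)‖‖ₑ := by
    intro x
    have h4 : ‖c‖ₑ = ENNReal.ofReal c := Real.enorm_of_nonneg hc.le
    have h5 : ENNReal.ofReal c⁻¹ * ENNReal.ofReal c = 1 := by
      rw [← ENNReal.ofReal_mul (by positivity), inv_mul_cancel₀ hc.ne', ENNReal.ofReal_one]
    simp only [pow_one, enorm_mul, enorm_norm, enorm_smul, h4, Phi]
    calc _ = ‖((c ^ Module.finrank ℝ E : ℝ) : ℂ)‖ₑ * ‖x‖ₑ * ‖phi0 E (c • x)‖ₑ * 1 := by ring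
      _ = _ := by rw [← h5]; ring
  simp_rw [h3]
  rw [lintegral_const_mul' _ _ (by finiteness)]
  exact ENNReal.mul_lt_top (by finiteness) h2

/-- A density on the line with Fourier transform supported in a small interval. -/
def psi2 : ℝ → ℂ := Phi (1 / 4 : ℝ)

theorem integrable_psi2 : Integrable psi2 := integrable_Phi (by norm_num)

theorem continuous_psi2 : Continuous psi2 := continuous_Phi _

theorem fourier_psi2 (τ : ℝ) : 𝓕 psi2 τ = cutoff ℝ (4 * τ) := by
  rw [psi2, fourier_Phi (by norm_num)]
  norm_num

theorem integral_psi2 : ∫ u, psi2 u = 1 := by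
  have := fourier_psi2 0
  rw [Real.fourier_eq] at this
  simp only [inner_zero_right, neg_zero, AddChar.map_zero_eq_one, one_smul, mul_zero] at this
  rw [this, cutoff_eq_one (by simp)]
  simp

theorem lintegral_norm_mul_psi2 : ∫⁻ u : ℝ, ‖u‖ₑ * ‖psi2 u‖ₑ < ∞ :=
  lintegral_norm_mul_Phi_lt_top (by norm_num)

/-- The Littlewood–Paley kernel at frequency `2 ^ k`. -/
def lam (k : ℤ) (x : E) : ℂ := Phi ((2 : ℝ) ^ k) x - Phi ((2 : ℝ) ^ (k - 1)) x

/-- The part of the Littlewood–Paley kernel with frequencies almost orthogonal to `v`. -/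
def pker (k : ℤ) (v : E) : E → ℂ := lineAvg (phi0 ℝ) (lam k) v

/-- The part of the Littlewood–Paley kernel with frequencies away from the hyperplane `v ^ ⊥`. -/
def nker (k : ℤ) (v : E) (x : E) : ℂ := lam k x - pker k v x

theorem two_zpow_pos (k : ℤ) : (0 : ℝ) < 2 ^ k := by positivity

theorem continuous_lam (k : ℤ) : Continuous (lam k : E → ℂ) :=
  (continuous_Phi _).sub (continuous_Phi _)

theorem integrable_lam (k : ℤ) : Integrable (lam k : E → ℂ) :=
  (integrable_Phi (two_zpow_pos _)).sub (integrable_Phi (two_zpow_pos _))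

theorem bounded_lam (k : ℤ) : ∃ C, ∀ x : E, ‖lam k x‖ ≤ C := by
  obtain ⟨C, hC⟩ := bounded_Phi (E := E) ((2 : ℝ) ^ k)
  obtain ⟨C', hC'⟩ := bounded_Phi (E := E) ((2 : ℝ) ^ (k - 1))
  exact ⟨C + C', fun x => (norm_sub_le _ _).trans (add_le_add (hC x) (hC' x))⟩

theorem continuous_pker (k : ℤ) (v : E) : Continuous (pker k v) := by
  obtain ⟨C, hC⟩ := bounded_lam (E := E) k
  exact continuous_lineAvg (phi0 ℝ).integrable (continuous_lam k) hC v

theorem integrable_pker (k : ℤ) (v : E) : Integrable (pker k v) :=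
  lineAvg_integrable (phi0 ℝ).integrable (integrable_lam k) v

theorem bounded_pker (k : ℤ) (v : E) : ∃ C, ∀ x : E, ‖pker k v x‖ ≤ C := by
  obtain ⟨C, hC⟩ := bounded_lam (E := E) k
  exact ⟨_, norm_lineAvg_le (phi0 ℝ).integrable hC v⟩

theorem continuous_nker (k : ℤ) (v : E) : Continuous (nker k v) :=
  (continuous_lam k).sub (continuous_pker k v)

theorem integrable_nker (k : ℤ) (v : E) : Integrable (nker k v) :=
  (integrable_lam k).sub (integrable_pker k v)

theorem bounded_nker (k : ℤ) (v : E) : ∃ C, ∀ x : E, ‖nker k v x‖ ≤ C := by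
  obtain ⟨C, hC⟩ := bounded_lam (E := E) k
  obtain ⟨C', hC'⟩ := bounded_pker (E := E) k v
  exact ⟨C + C', fun x => (norm_sub_le _ _).trans (add_le_add (hC x) (hC' x))⟩

theorem fourier_lam (k : ℤ) (ξ : E) : 𝓕 (lam k : E → ℂ) ξ =
    ((cutoff E (((2 : ℝ) ^ k)⁻¹ • ξ) - cutoff E (((2 : ℝ) ^ (k - 1))⁻¹ • ξ) : ℝ) : ℂ) := by
  have : 𝓕 (lam k : E → ℂ) ξ = 𝓕 (Phi ((2 : ℝ) ^ k) : E → ℂ) ξ -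
      𝓕 (Phi ((2 : ℝ) ^ (k - 1)) : E → ℂ) ξ := by
    simp only [Real.fourier_eq, lam, smul_sub]
    rw [integral_sub]
    · exact (Real.fourierIntegral_convergent_iff ξ).2 (integrable_Phi (two_zpow_pos _))
    · exact (Real.fourierIntegral_convergent_iff ξ).2 (integrable_Phi (two_zpow_pos _))
  rw [this, fourier_Phi (two_zpow_pos _), fourier_Phi (two_zpow_pos _), Complex.ofReal_sub]

theorem fourier_pker (k : ℤ) (v ξ : E) : 𝓕 (pker k v) ξ =
    ((cutoff ℝ (inner ℝ v ξ) *
      (cutoff E (((2 : ℝ) ^ k)⁻¹ • ξ) - cutoff E (((2 : ℝ) ^ (k - 1))⁻¹ • ξ)) : ℝ) : ℂ) := by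
  rw [pker, lineAvg_fourier (phi0 ℝ).integrable (integrable_lam k), fourier_lam, fourier_phi0,
    Complex.ofReal_mul]

theorem fourier_nker (k : ℤ) (v ξ : E) : 𝓕 (nker k v) ξ =
    (((1 - cutoff ℝ (inner ℝ v ξ)) *
      (cutoff E (((2 : ℝ) ^ k)⁻¹ • ξ) - cutoff E (((2 : ℝ) ^ (k - 1))⁻¹ • ξ)) : ℝ) : ℂ) := by
  have : 𝓕 (nker k v) ξ = 𝓕 (lam k : E → ℂ) ξ - 𝓕 (pker k v) ξ := by
    simp only [Real.fourier_eq, nker, smul_sub]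
    rw [integral_sub]
    · exact (Real.fourierIntegral_convergent_iff ξ).2 (integrable_lam k)
    · exact (Real.fourierIntegral_convergent_iff ξ).2 (integrable_pker k v)
  rw [this, fourier_lam, fourier_pker, ← Complex.ofReal_sub]
  congr 1
  ring

/-- A common bound for the `L¹` norms of the kernels. -/
def kerC (E : Type*) [NormedAddCommGroup E] [InnerProductSpace ℝ E] [FiniteDimensional ℝ E]
    [MeasurableSpace E] [BorelSpace E] : ℝ≥0∞ :=
  (1 + ∫⁻ u, ‖phi0 ℝ u‖ₑ) * (2 * ((∫⁻ x, ‖phi0 E x‖ₑ) + ∫⁻ x, ‖fderiv ℝ (phi0 E) x‖ₑ))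

theorem kerC_lt_top : kerC E < ∞ := by
  have h1 := SchwartzMap.lintegral_enorm_lt_top (phi0 ℝ)
  have h2 := SchwartzMap.lintegral_enorm_lt_top (phi0 E)
  have h3 := lintegral_fderiv_schwartz_lt_top (phi0 E)
  unfold kerC
  exact ENNReal.mul_lt_top (ENNReal.add_lt_top.2 ⟨by simp, h1⟩)
    (ENNReal.mul_lt_top (by simp) (ENNReal.add_lt_top.2 ⟨h2, h3⟩))

theorem lintegral_Phi_translate_le {c : ℝ} (hc : 0 < c) (v : E) :
    ∫⁻ x : E, ‖Phi c (x - v) - Phi c x‖ₑ ≤ ENNReal.ofReal c * ‖v‖ₑ * kerC E := by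
  refine (lintegral_Phi_translate hc v).trans ?_
  gcongr
  rw [kerC]
  calc _ ≤ 1 * (1 * ((∫⁻ x, ‖phi0 E x‖ₑ) + ∫⁻ x, ‖fderiv ℝ (phi0 E) x‖ₑ)) := by
        simp
    _ ≤ _ := by gcongr <;> simp

theorem lintegral_nker_le_aux {K : E → ℂ} (hK : Continuous K) (v : E) {D : ℝ≥0∞}
    (hD : ∫⁻ x, ‖K x‖ₑ ≤ D) :
    ∫⁻ x, ‖K x - lineAvg (phi0 ℝ) K v x‖ₑ ≤ (1 + ∫⁻ u, ‖phi0 ℝ u‖ₑ) * D := by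
  calc ∫⁻ x, ‖K x - lineAvg (phi0 ℝ) K v x‖ₑ
      ≤ ∫⁻ x, ‖K x‖ₑ + ‖lineAvg (phi0 ℝ) K v x‖ₑ := lintegral_mono fun x => enorm_sub_le
    _ = (∫⁻ x, ‖K x‖ₑ) + ∫⁻ x, ‖lineAvg (phi0 ℝ) K v x‖ₑ :=
        lintegral_add_left hK.measurable.enorm _
    _ ≤ D + (∫⁻ u, ‖phi0 ℝ u‖ₑ) * D := by
        gcongr
        refine (lintegral_lineAvg_le (phi0 ℝ).continuous.measurable hK.measurable v).trans ?_
        gcongr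
    _ = _ := by ring

theorem lintegral_nker_le (k : ℤ) (v : E) : ∫⁻ x, ‖nker k v x‖ₑ ≤ kerC E := by
  refine lintegral_nker_le_aux (continuous_lam k) v ?_
  calc ∫⁻ x : E, ‖lam k x‖ₑ
      ≤ ∫⁻ x : E, ‖Phi ((2 : ℝ) ^ k) x‖ₑ + ‖Phi ((2 : ℝ) ^ (k - 1)) x‖ₑ :=
        lintegral_mono fun x => enorm_sub_le
    _ = (∫⁻ x, ‖phi0 E x‖ₑ) + ∫⁻ x, ‖phi0 E x‖ₑ := by
        rw [lintegral_add_left (continuous_Phi _).measurable.enorm, lintegral_Phi (two_zpow_pos _),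
          lintegral_Phi (two_zpow_pos _)]
    _ ≤ _ := by rw [← two_mul]; gcongr; simp

theorem lintegral_nker_translate_le (k : ℤ) (v w : E) :
    ∫⁻ x, ‖nker k v (x - w) - nker k v x‖ₑ ≤ ENNReal.ofReal ((2 : ℝ) ^ k) * ‖w‖ₑ * kerC E := by
  obtain ⟨C, hC⟩ := bounded_lam (E := E) k
  have hcl := continuous_lam (E := E) k
  have h1 : ∀ x, nker k v (x - w) - nker k v x = (lam k (x - w) - lam k x) -
      lineAvg (phi0 ℝ) (fun z => lam k (z - w) - lam k z) v x := by
    intro x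
    rw [lineAvg_sub (phi0 ℝ).integrable (by fun_prop) (by fun_prop) (fun x => hC _) hC,
      ← lineAvg_translate]
    simp only [nker, pker]
    ring
  simp_rw [h1]
  refine (lintegral_nker_le_aux (K := fun z => lam k (z - w) - lam k z) (by fun_prop) v
    (D := ENNReal.ofReal (2 ^ k) * ‖w‖ₑ *
      (2 * ((∫⁻ x, ‖phi0 E x‖ₑ) + ∫⁻ x, ‖fderiv ℝ (phi0 E) x‖ₑ))) ?_).trans
    (le_of_eq (by rw [kerC]; ring))
  have hP := continuous_Phi (E := E) ((2 : ℝ) ^ k)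
  have hk : (2 : ℝ) ^ (k - 1) ≤ 2 ^ k := zpow_le_zpow_right₀ one_le_two (by omega)
  calc ∫⁻ x : E, ‖lam k (x - w) - lam k x‖ₑ
      ≤ ∫⁻ x : E, ‖Phi ((2 : ℝ) ^ k) (x - w) - Phi ((2 : ℝ) ^ k) x‖ₑ +
          ‖Phi ((2 : ℝ) ^ (k - 1)) (x - w) - Phi ((2 : ℝ) ^ (k - 1)) x‖ₑ := by
        refine lintegral_mono fun x => ?_
        have : lam k (x - w) - lam k x = (Phi ((2 : ℝ) ^ k) (x - w) - Phi ((2 : ℝ) ^ k) x) -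
          (Phi ((2 : ℝ) ^ (k - 1)) (x - w) - Phi ((2 : ℝ) ^ (k - 1)) x) := by
          simp only [lam]; ring
        rw [this]
        exact enorm_sub_le
    _ = (∫⁻ x : E, ‖Phi ((2 : ℝ) ^ k) (x - w) - Phi ((2 : ℝ) ^ k) x‖ₑ) +
          ∫⁻ x : E, ‖Phi ((2 : ℝ) ^ (k - 1)) (x - w) - Phi ((2 : ℝ) ^ (k - 1)) x‖ₑ :=
        lintegral_add_left (Continuous.measurable (by fun_prop)).enorm _
    _ ≤ ENNReal.ofReal (2 ^ k) * ‖w‖ₑ * (∫⁻ x, ‖fderiv ℝ (phi0 E) x‖ₑ) +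
        ENNReal.ofReal (2 ^ k) * ‖w‖ₑ * (∫⁻ x, ‖fderiv ℝ (phi0 E) x‖ₑ) := by
        refine add_le_add (lintegral_Phi_translate (two_zpow_pos _) w)
          ((lintegral_Phi_translate (two_zpow_pos _) w).trans ?_)
        gcongr
    _ ≤ _ := by
        rw [← mul_add, ← two_mul]
        gcongr
        simp

theorem cutoff_sub_nonneg (k : ℤ) (ξ : E) :
    0 ≤ cutoff E (((2 : ℝ) ^ k)⁻¹ • ξ) - cutoff E (((2 : ℝ) ^ (k - 1))⁻¹ • ξ) := by
  rw [sub_nonneg]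
  apply cutoff_anti
  rw [norm_smul, norm_smul, Real.norm_of_nonneg (by positivity), Real.norm_of_nonneg (by positivity)]
  gcongr
  · norm_num
  · omega

/-- Frequencies away from `v ^ ⊥` are killed by averaging in a direction close to `v`. -/
theorem lineAvg_psi2_nker {m : ℕ} {k : ℤ} {e θ : E} (hθ : ‖θ - e‖ ≤ (2 : ℝ) ^ (-(m : ℤ)) / 4)
    (x : E) :
    lineAvg psi2 (nker k ((2 : ℝ) ^ ((m : ℤ) - k) • e)) ((2 : ℝ) ^ ((m : ℤ) - k) • θ) x = 0 := by
  obtain ⟨C, hC⟩ := bounded_nker (E := E) k ((2 : ℝ) ^ ((m : ℤ) - k) • e)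
  refine eq_zero_of_fourier_eq_zero (lineAvg_integrable integrable_psi2 (integrable_nker _ _) _)
    (continuous_lineAvg integrable_psi2 (continuous_nker _ _) hC _) ?_ x
  ext ξ
  rw [lineAvg_fourier integrable_psi2 (integrable_nker _ _), fourier_psi2, fourier_nker,
    Pi.zero_apply, ← Complex.ofReal_mul, Complex.ofReal_eq_zero]
  by_cases h1 : ‖((2 : ℝ) ^ ((m : ℤ) - k)) * inner ℝ e ξ‖ ≤ 1
  · simp only [inner_smul_left, conj_trivial]
    rw [cutoff_eq_one h1]; simp
  by_cases h2 : 2 ≤ ‖((2 : ℝ) ^ k)⁻¹ • ξ‖ ^ 2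
  · have h3 := cutoff_sub_nonneg k ξ
    have h4 := cutoff_nonneg (((2 : ℝ) ^ (k - 1))⁻¹ • ξ)
    rw [cutoff_eq_zero h2] at h3 ⊢
    have : cutoff E (((2 : ℝ) ^ (k - 1))⁻¹ • ξ) = 0 := by linarith
    rw [this]; simp
  · rw [inner_smul_left, conj_trivial, cutoff_eq_zero (V := ℝ), zero_mul]
    push Not at h1 h2
    have h5 : ‖((2 : ℝ) ^ k)⁻¹ • ξ‖ ≤ 3 / 2 := by
      nlinarith [norm_nonneg (((2 : ℝ) ^ k)⁻¹ • ξ)]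
    rw [norm_smul, norm_inv, Real.norm_of_nonneg (by positivity)] at h5
    have h6 : |(2 : ℝ) ^ ((m : ℤ) - k) * inner ℝ (θ - e) ξ| ≤ 3 / 8 := by
      rw [abs_mul, abs_of_pos (by positivity)]
      calc (2 : ℝ) ^ ((m : ℤ) - k) * |inner ℝ (θ - e) ξ|
          ≤ (2 : ℝ) ^ ((m : ℤ) - k) * (((2 : ℝ) ^ (-(m : ℤ)) / 4) * ‖ξ‖) := by
            gcongr
            exact (abs_real_inner_le_norm _ _).trans (by gcongr)
        _ = (((2 : ℝ) ^ k)⁻¹ * ‖ξ‖) / 4 := by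
            rw [zpow_sub₀ two_ne_zero, zpow_neg]
            field_simp
        _ ≤ 3 / 8 := by linarith
    have h7 : (2 : ℝ) ^ ((m : ℤ) - k) * inner ℝ θ ξ = 2 ^ ((m : ℤ) - k) * inner ℝ e ξ +
        2 ^ ((m : ℤ) - k) * inner ℝ (θ - e) ξ := by
      rw [inner_sub_left]; ring
    rw [h7]
    rw [Real.norm_eq_abs] at h1
    rw [Real.norm_eq_abs, sq_abs]
    set a := (2 : ℝ) ^ ((m : ℤ) - k) * inner ℝ e ξ
    set b := (2 : ℝ) ^ ((m : ℤ) - k) * inner ℝ (θ - e) ξ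
    rcases abs_le.1 h6 with ⟨h8, h9⟩
    rcases lt_abs.1 h1 with h | h <;> nlinarith

theorem sum_lam (a : ℤ) (n : ℕ) (x : E) :
    ∑ i ∈ Finset.range n, lam (a + 1 + i) x = Phi ((2 : ℝ) ^ (a + n)) x - Phi ((2 : ℝ) ^ a) x := by
  have := Finset.sum_range_sub (fun i : ℕ => Phi ((2 : ℝ) ^ (a + i)) x) n
  simp only [Nat.cast_zero, add_zero] at this
  rw [← this]
  refine Finset.sum_congr rfl fun i _ => ?_
  simp only [lam]
  congr 3 <;> (push_cast; ring)

/-- Approximation by frequency truncation, quantitatively, for a `C¹` function. -/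
theorem lintegral_sub_cv_Phi_le {b : E → ℂ} (hb : ContDiff ℝ 1 b) (hb' : ∃ C, ∀ x, ‖b x‖ ≤ C)
    {c : ℝ} (hc : 0 < c) :
    ∫⁻ x, ‖b x - cv (Phi c) b x‖ₑ ≤
      (ENNReal.ofReal c⁻¹ * ∫⁻ x : E, ‖x‖ₑ * ‖phi0 E x‖ₑ) * ∫⁻ x, ‖fderiv ℝ b x‖ₑ := by
  have integral_Phi_eq : ∫ y : E, Phi c y = 1 := by
    have := fourier_Phi (E := E) hc 0
    rw [Real.fourier_eq] at this
    simp only [inner_zero_right, neg_zero, AddChar.map_zero_eq_one, one_smul, smul_zero] at this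
    rw [this, cutoff_eq_one (by simp)]
    simp
  obtain ⟨C, hC⟩ := hb'
  have hbc := hb.continuous
  have hPc := continuous_Phi (E := E) c
  have h1 : ∀ x, ‖b x - cv (Phi c) b x‖ₑ ≤ ∫⁻ y, ‖Phi c y‖ₑ * ‖b (x - y) - b x‖ₑ := by
    intro x
    have : b x - cv (Phi c) b x = - ∫ y, Phi c y * (b (x - y) - b x) := by
      rw [cv_apply]
      simp only [mul_sub]
      rw [integral_sub, integral_mul_const, integral_Phi_eq]
      · ring
      · exact (integrable_Phi hc).mul_bdd (c := C) (by fun_prop)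
          (Eventually.of_forall fun u => hC _)
      · exact (integrable_Phi hc).mul_const _
    rw [this, enorm_neg]
    refine (enorm_integral_le_lintegral_enorm _).trans ?_
    simp [enorm_mul]
  have h2 : ∫⁻ x : E, ‖x‖ₑ * ‖Phi c x‖ₑ = ENNReal.ofReal c⁻¹ * ∫⁻ x : E, ‖x‖ₑ * ‖phi0 E x‖ₑ := by
    have h3 : ∀ x : E, ‖x‖ₑ * ‖Phi c x‖ₑ =
        (ENNReal.ofReal (c ^ Module.finrank ℝ E) * ENNReal.ofReal c⁻¹) *
          (fun x => ‖x‖ₑ * ‖phi0 E x‖ₑ) (c • x) := by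
      intro x
      have h4 : ‖c‖ₑ = ENNReal.ofReal c := Real.enorm_of_nonneg hc.le
      have h5 : ENNReal.ofReal c⁻¹ * ENNReal.ofReal c = 1 := by
        rw [← ENNReal.ofReal_mul (by positivity), inv_mul_cancel₀ hc.ne', ENNReal.ofReal_one]
      have h6 : ‖((c ^ Module.finrank ℝ E : ℝ) : ℂ)‖ₑ = ENNReal.ofReal (c ^ Module.finrank ℝ E) := by
        rw [← ofReal_norm, Complex.norm_real, Real.norm_of_nonneg (by positivity)]
      simp only [enorm_mul, enorm_smul, h4, Phi, h6]
      calc _ = ENNReal.ofReal (c ^ Module.finrank ℝ E) * ‖x‖ₑ * ‖phi0 E (c • x)‖ₑ * 1 := by ring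
        _ = _ := by rw [← h5]; ring
    have hphi : Continuous (fun x => phi0 E x) := (phi0 E).continuous
    rw [lintegral_congr h3, lintegral_const_mul' _ _ (by finiteness),
      lintegral_comp_smul_of_pos (fun x => ‖x‖ₑ * ‖phi0 E x‖ₑ) hc, ← mul_assoc]
    congr 1
    rw [mul_right_comm, ← ENNReal.ofReal_mul (by positivity), mul_inv_cancel₀ (by positivity)]
    simp
  calc ∫⁻ x, ‖b x - cv (Phi c) b x‖ₑ
      ≤ ∫⁻ x, ∫⁻ y, ‖Phi c y‖ₑ * ‖b (x - y) - b x‖ₑ := lintegral_mono h1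
    _ = ∫⁻ y, ∫⁻ x, ‖Phi c y‖ₑ * ‖b (x - y) - b x‖ₑ := by
        apply lintegral_lintegral_swap
        apply Measurable.aemeasurable
        have h3 := hPc.measurable
        have h4 := hbc.measurable
        fun_prop
    _ ≤ ∫⁻ y : E, (‖y‖ₑ * ‖Phi c y‖ₑ) * ∫⁻ x, ‖fderiv ℝ b x‖ₑ := by
        refine lintegral_mono fun y => ?_
        rw [lintegral_const_mul' _ _ (by finiteness), mul_comm ‖y‖ₑ, mul_assoc]
        gcongr
        exact lintegral_translate_sub_le hb y
    _ = _ := by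
        rw [lintegral_mul_const _ (by have := hPc.measurable; fun_prop), h2]

end LPKernels

section Net

variable {E : Type*} [NormedAddCommGroup E] [InnerProductSpace ℝ E] [FiniteDimensional ℝ E]
  [MeasurableSpace E] [BorelSpace E]

theorem norm_inner_le_of_unit {ξ x : E} (hξ : ‖ξ‖ = 1) : |inner ℝ ξ x| ≤ ‖x‖ := by
  simpa [hξ] using abs_real_inner_le_norm ξ x

/-- Volume count for separated directions: thickening every direction to a row of disjoint balls. -/
theorem card_mul_volume_le {m : ℕ} {S : Finset E} (hS : ∀ e ∈ S, ‖e‖ = 1)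
    (hsep : ∀ e ∈ S, ∀ e' ∈ S, e ≠ e' → ((2 : ℝ) ^ m)⁻¹ / 4 < ‖e - e'‖) {W : Set E}
    (hW : ∀ e ∈ S, ∀ ρ : ℝ, 1 ≤ ρ → ρ ≤ 2 → closedBall (ρ • e) (((2 : ℝ) ^ m)⁻¹ / 16) ⊆ W) :
    (S.card * 2 ^ m : ℕ) * volume (closedBall (0 : E) (((2 : ℝ) ^ m)⁻¹ / 16)) ≤ volume W := by
  set δ : ℝ := ((2 : ℝ) ^ m)⁻¹ with hδ
  have hδ0 : 0 < δ := by positivity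
  have hδ1 : δ * 2 ^ m = 1 := by rw [hδ]; field_simp
  let B : E × ℕ → Set E := fun p => closedBall ((1 + p.2 * δ) • p.1) (δ / 16)
  have hdisj : (↑(S ×ˢ Finset.range (2 ^ m)) : Set (E × ℕ)).PairwiseDisjoint B := by
    rintro ⟨e, l⟩ h ⟨e', l'⟩ h' hne
    simp only [Finset.coe_product, Set.mem_prod, Finset.mem_coe] at h h'
    refine closedBall_disjoint_closedBall ?_
    simp only [dist_eq_norm]
    by_cases hl : l = l'
    · subst hl
      have hee : e ≠ e' := fun h => hne (by rw [h])
      rw [← smul_sub, norm_smul, Real.norm_of_nonneg (by positivity)]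
      have := hsep e h.1 e' h'.1 hee
      have h1 : 1 ≤ 1 + (l : ℝ) * δ := by have : 0 ≤ (l : ℝ) * δ := by positivity
                                          linarith
      nlinarith [norm_nonneg (e - e')]
    · have h1 : |‖(1 + l * δ) • e‖ - ‖(1 + l' * δ) • e'‖| ≤ ‖(1 + l * δ) • e - (1 + l' * δ) • e'‖ :=
        abs_norm_sub_norm_le _ _
      rw [norm_smul, norm_smul, hS e h.1, hS e' h'.1, Real.norm_of_nonneg (by positivity),
        Real.norm_of_nonneg (by positivity)] at h1
      have h2 : (1 + (l : ℝ) * δ) * 1 - (1 + l' * δ) * 1 = (l - l') * δ := by ring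
      rw [h2, abs_mul, abs_of_pos hδ0] at h1
      have h3 : (1 : ℝ) ≤ |(l : ℝ) - l'| := by
        have : (1 : ℤ) ≤ |(l : ℤ) - l'| := Int.one_le_abs (by omega)
        exact_mod_cast this
      nlinarith
  have hsub : (⋃ p ∈ S ×ˢ Finset.range (2 ^ m), B p) ⊆ W := by
    refine Set.iUnion₂_subset fun p hp => ?_
    rw [Finset.mem_product, Finset.mem_range] at hp
    refine hW p.1 hp.1 _ ?_ ?_
    · have : 0 ≤ (p.2 : ℝ) * δ := by positivity
      linarith
    · have : (p.2 : ℝ) ≤ 2 ^ m := by exact_mod_cast hp.2.le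
      nlinarith
  calc _ = ∑ p ∈ S ×ˢ Finset.range (2 ^ m), volume (B p) := by
        rw [Finset.sum_congr rfl (fun p _ => Measure.addHaar_closedBall_center volume _ _)]
        simp [Finset.card_product]
    _ = volume (⋃ p ∈ S ×ˢ Finset.range (2 ^ m), B p) :=
        (measure_biUnion_finset hdisj fun p _ => measurableSet_closedBall).symm
    _ ≤ volume W := measure_mono hsub

/-- The volume of a thin slab in a ball. -/
theorem volume_slab_le (m : ℕ) {ξ : E} (hξ : ‖ξ‖ = 1) :
    (2 ^ m : ℕ) * volume {x : E | ‖x‖ ≤ 3 ∧ |inner ℝ ξ x| ≤ 10 * ((2 : ℝ) ^ m)⁻¹} ≤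
      volume (closedBall (0 : E) 24) := by
  set δ : ℝ := ((2 : ℝ) ^ m)⁻¹ with hδ
  have hδ0 : 0 < δ := by positivity
  have hδ1 : δ * 2 ^ m = 1 := by rw [hδ]; field_simp
  set W := {x : E | ‖x‖ ≤ 3 ∧ |inner ℝ ξ x| ≤ 10 * δ}
  have hWm : MeasurableSet W :=
    (measurableSet_le measurable_norm measurable_const).inter
      (measurableSet_le (Continuous.measurable (by fun_prop : Continuous fun x : E => |inner ℝ ξ x|))
        measurable_const)
  let B : ℕ → Set E := fun l => (fun x => x + -((21 * l * δ) • ξ)) ⁻¹' W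
  have hB : ∀ l, volume (B l) = volume W := fun l => measure_preimage_add_right volume _ W
  have hdisj : (↑(Finset.range (2 ^ m)) : Set ℕ).PairwiseDisjoint B := by
    intro l _ l' _ hne
    rw [Function.onFun, Set.disjoint_left]
    rintro x ⟨-, hx⟩ ⟨-, hx'⟩
    simp only [← sub_eq_add_neg, inner_sub_right, inner_smul_right, real_inner_self_eq_norm_sq, hξ] at hx hx'
    have h3 : (1 : ℝ) ≤ |(l : ℝ) - l'| := by
      have : (1 : ℤ) ≤ |(l : ℤ) - l'| := Int.one_le_abs (by omega)
      exact_mod_cast this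
    rw [abs_le] at hx hx'
    rcases le_abs.1 h3 with h | h <;> nlinarith
  have hsub : (⋃ l ∈ Finset.range (2 ^ m), B l) ⊆ closedBall (0 : E) 24 := by
    refine Set.iUnion₂_subset fun l hl x hx => ?_
    rw [Finset.mem_range] at hl
    have hl' : (l : ℝ) ≤ 2 ^ m := by exact_mod_cast hl.le
    rw [mem_closedBall_zero_iff]
    have h1 : ‖x‖ ≤ ‖x - (21 * l * δ) • ξ‖ + ‖(21 * l * δ) • ξ‖ := by
      simpa using norm_add_le (x - (21 * l * δ) • ξ) ((21 * l * δ) • ξ)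
    rw [norm_smul, hξ, Real.norm_of_nonneg (by positivity)] at h1
    have h2 : ‖x - (21 * l * δ) • ξ‖ ≤ 3 := by rw [sub_eq_add_neg]; exact hx.1
    nlinarith
  calc _ = ∑ l ∈ Finset.range (2 ^ m), volume (B l) := by
        rw [Finset.sum_congr rfl (fun l _ => hB l)]
        simp
    _ = volume (⋃ l ∈ Finset.range (2 ^ m), B l) :=
        (measure_biUnion_finset hdisj fun l _ => hWm.preimage (by fun_prop)).symm
    _ ≤ _ := measure_mono hsub

/-- The number of `2⁻ᵐ / 4`-separated directions. -/
theorem card_separated_le {m : ℕ} {S : Finset E} (hS : ∀ e ∈ S, ‖e‖ = 1)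
    (hsep : ∀ e ∈ S, ∀ e' ∈ S, e ≠ e' → ((2 : ℝ) ^ m)⁻¹ / 4 < ‖e - e'‖) :
    (S.card : ℝ) * (((2 : ℝ) ^ m)⁻¹) ^ Module.finrank ℝ E ≤
      48 ^ Module.finrank ℝ E * ((2 : ℝ) ^ m)⁻¹ := by
  have hδ0 : (0 : ℝ) < ((2 : ℝ) ^ m)⁻¹ := by positivity
  have hδ1 : ((2 : ℝ) ^ m)⁻¹ ≤ 1 := inv_le_one_of_one_le₀ (one_le_pow₀ one_le_two)
  have h := card_mul_volume_le hS hsep (W := closedBall 0 3) (by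
    intro e he ρ h1 h2 x hx
    rw [mem_closedBall_iff_norm] at hx
    rw [mem_closedBall_zero_iff]
    have h3 : ‖x‖ ≤ ‖x - ρ • e‖ + ‖ρ • e‖ := by simpa using norm_add_le (x - ρ • e) (ρ • e)
    rw [norm_smul, hS e he, Real.norm_of_nonneg (by linarith)] at h3
    linarith)
  rw [Measure.addHaar_closedBall _ _ (by positivity), Measure.addHaar_closedBall _ _ (by norm_num),
    ← mul_assoc] at h
  have hb : volume (ball (0 : E) 1) ≠ 0 := (measure_ball_pos volume 0 one_pos).ne'
  have hb' : volume (ball (0 : E) 1) ≠ ∞ := measure_ball_lt_top.ne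
  rw [ENNReal.mul_le_mul_iff_left hb hb', ← ENNReal.ofReal_natCast, ← ENNReal.ofReal_mul (by positivity),
    ENNReal.ofReal_le_ofReal_iff (by positivity)] at h
  push_cast at h
  have h16 : (0 : ℝ) < 16 ^ Module.finrank ℝ E := by positivity
  have h2m : ((2 : ℝ) ^ m) * ((2 : ℝ) ^ m)⁻¹ = 1 := mul_inv_cancel₀ (by positivity)
  rw [div_pow, mul_div_assoc', div_le_iff₀ h16, ← mul_pow] at h
  norm_num only at h
  calc _ = (S.card * 2 ^ m * ((2 : ℝ) ^ m)⁻¹ ^ Module.finrank ℝ E) * ((2 : ℝ) ^ m)⁻¹ := by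
        field_simp
    _ ≤ _ := mul_le_mul_of_nonneg_right h hδ0.le

/-- The number of separated directions near a hyperplane. -/
theorem card_band_le {m : ℕ} {S : Finset E} (hS : ∀ e ∈ S, ‖e‖ = 1)
    (hsep : ∀ e ∈ S, ∀ e' ∈ S, e ≠ e' → ((2 : ℝ) ^ m)⁻¹ / 4 < ‖e - e'‖) {ξ : E}
    (hb : ∀ e ∈ S, |inner ℝ ξ e| ≤ 4 * ((2 : ℝ) ^ m)⁻¹ * ‖ξ‖) (hξ : ξ ≠ 0) :
    (S.card : ℝ) * (((2 : ℝ) ^ m)⁻¹) ^ Module.finrank ℝ E ≤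
      384 ^ Module.finrank ℝ E * ((2 : ℝ) ^ m)⁻¹ ^ 2 := by
  have hδ0 : (0 : ℝ) < ((2 : ℝ) ^ m)⁻¹ := by positivity
  have hδ1 : ((2 : ℝ) ^ m)⁻¹ ≤ 1 := inv_le_one_of_one_le₀ (one_le_pow₀ one_le_two)
  have hξ0 : 0 < ‖ξ‖ := norm_pos_iff.2 hξ
  set ζ : E := ‖ξ‖⁻¹ • ξ
  have hζ : ‖ζ‖ = 1 := by
    rw [norm_smul, norm_inv, norm_norm, inv_mul_cancel₀ hξ0.ne']
  have hb' : ∀ e ∈ S, |inner ℝ ζ e| ≤ 4 * ((2 : ℝ) ^ m)⁻¹ := by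
    intro e he
    rw [real_inner_smul_left, abs_mul, abs_of_pos (inv_pos.2 hξ0), inv_mul_le_iff₀ hξ0]
    linarith [hb e he]
  have h := card_mul_volume_le hS hsep
    (W := {x : E | ‖x‖ ≤ 3 ∧ |inner ℝ ζ x| ≤ 10 * ((2 : ℝ) ^ m)⁻¹}) (by
    intro e he ρ h1 h2 x hx
    rw [mem_closedBall_iff_norm] at hx
    have h3 : ‖x‖ ≤ ‖x - ρ • e‖ + ‖ρ • e‖ := by simpa using norm_add_le (x - ρ • e) (ρ • e)
    rw [norm_smul, hS e he, Real.norm_of_nonneg (by linarith)] at h3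
    refine ⟨by linarith, ?_⟩
    have h4 : inner ℝ ζ x = inner ℝ ζ (x - ρ • e) + ρ * inner ℝ ζ e := by
      rw [inner_sub_right, inner_smul_right]; ring
    have h5 := norm_inner_le_of_unit hζ (x := x - ρ • e)
    have h6 := hb' e he
    rw [h4]
    refine (abs_add_le _ _).trans ?_
    rw [abs_mul, abs_of_nonneg (by linarith : 0 ≤ ρ)]
    nlinarith [abs_nonneg (inner ℝ ζ e)])
  have h := (mul_le_mul_right h (2 ^ m : ℕ)).trans (volume_slab_le m hζ)
  rw [Measure.addHaar_closedBall _ _ (by positivity), Measure.addHaar_closedBall _ _ (by norm_num),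
    ← mul_assoc, ← mul_assoc] at h
  have hb : volume (ball (0 : E) 1) ≠ 0 := (measure_ball_pos volume 0 one_pos).ne'
  have hb' : volume (ball (0 : E) 1) ≠ ∞ := measure_ball_lt_top.ne
  rw [ENNReal.mul_le_mul_iff_left hb hb', ← Nat.cast_mul, ← ENNReal.ofReal_natCast,
    ← ENNReal.ofReal_mul (by positivity), ENNReal.ofReal_le_ofReal_iff (by positivity)] at h
  push_cast at h
  have h16 : (0 : ℝ) < 16 ^ Module.finrank ℝ E := by positivity
  rw [div_pow, mul_div_assoc', div_le_iff₀ h16, ← mul_pow] at h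
  norm_num only at h
  calc _ = (2 ^ m * (S.card * 2 ^ m) * ((2 : ℝ) ^ m)⁻¹ ^ Module.finrank ℝ E) *
        ((2 : ℝ) ^ m)⁻¹ ^ 2 := by
        field_simp
    _ ≤ _ := mul_le_mul_of_nonneg_right h (by positivity)

/-- Existence of a maximal separated set of directions. -/
theorem exists_net (E : Type*) [NormedAddCommGroup E] [InnerProductSpace ℝ E]
    [FiniteDimensional ℝ E] [MeasurableSpace E] [BorelSpace E] (m : ℕ) :
    ∃ S : Finset E, (∀ e ∈ S, ‖e‖ = 1) ∧
      (∀ e ∈ S, ∀ e' ∈ S, e ≠ e' → ((2 : ℝ) ^ m)⁻¹ / 4 < ‖e - e'‖) ∧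
      ∀ θ : E, ‖θ‖ = 1 → ∃ e ∈ S, ‖θ - e‖ ≤ ((2 : ℝ) ^ m)⁻¹ / 4 := by
  classical
  let P : Finset E → Prop := fun S => (∀ e ∈ S, ‖e‖ = 1) ∧
      (∀ e ∈ S, ∀ e' ∈ S, e ≠ e' → ((2 : ℝ) ^ m)⁻¹ / 4 < ‖e - e'‖)
  have hbd : ∃ N : ℕ, ∀ S, P S → S.card ≤ N := by
    refine ⟨⌈48 ^ Module.finrank ℝ E * ((2 : ℝ) ^ m)⁻¹ / (((2 : ℝ) ^ m)⁻¹) ^ Module.finrank ℝ E⌉₊,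
      fun S hS => ?_⟩
    have h := card_separated_le hS.1 hS.2
    have : (S.card : ℝ) ≤ _ := ((le_div_iff₀ (by positivity)).2 h).trans (Nat.le_ceil _)
    exact_mod_cast this
  obtain ⟨N, hN⟩ := hbd
  have hex : ∃ n, ∃ S, P S ∧ S.card = n := ⟨0, ∅, by simp [P], rfl⟩
  have hg := Nat.findGreatest_spec (P := fun n => ∃ S, P S ∧ S.card = n) (n := N) (m := 0)
    (Nat.zero_le _) ⟨∅, by simp [P], rfl⟩
  obtain ⟨S, hS, hcard⟩ := hg
  refine ⟨S, hS.1, hS.2, fun θ hθ => ?_⟩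
  by_contra! hcon
  have hθS : θ ∉ S := fun h => by
    have := hcon θ h
    simp only [sub_self, norm_zero] at this
    have h2 : (0 : ℝ) < ((2 : ℝ) ^ m)⁻¹ / 4 := by positivity
    linarith
  have hP : P (insert θ S) := by
    refine ⟨by simpa [hθ] using hS.1, ?_⟩
    intro e he e' he' hne
    rcases Finset.mem_insert.1 he with rfl | h1 <;> rcases Finset.mem_insert.1 he' with rfl | h2
    · exact absurd rfl hne
    · exact hcon _ h2
    · rw [norm_sub_rev]; exact hcon _ h1
    · exact hS.2 _ h1 _ h2 hne
  have h1 := Nat.le_findGreatest (P := fun n => ∃ S, P S ∧ S.card = n) (hN _ hP) ⟨_, hP, rfl⟩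
  rw [Finset.card_insert_of_notMem hθS] at h1
  omega

/-- The volume of a tube of length `2 R` and width `κ 2⁻ᵐ R`. -/
theorem volume_tube_le (m : ℕ) {e : E} (he : ‖e‖ = 1) {R κ : ℝ} (hR : 0 < R) (hκ : 0 ≤ κ) :
    volume {z : E | ∃ ρ : ℝ, |ρ| ≤ R ∧ ‖z - ρ • e‖ ≤ κ * ((2 : ℝ) ^ m)⁻¹ * R} ≤
      ENNReal.ofReal (3 * 2 ^ m * ((κ + 1) * ((2 : ℝ) ^ m)⁻¹ * R) ^ Module.finrank ℝ E) *
        volume (ball (0 : E) 1) := by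
  set δ : ℝ := ((2 : ℝ) ^ m)⁻¹ with hδ
  have hδ0 : 0 < δ := by positivity
  have hδ1 : δ * 2 ^ m = 1 := by rw [hδ]; field_simp
  let B : ℕ → Set E := fun l => closedBall ((-R + l * (δ * R)) • e) ((κ + 1) * δ * R)
  have hsub : {z : E | ∃ ρ : ℝ, |ρ| ≤ R ∧ ‖z - ρ • e‖ ≤ κ * δ * R} ⊆
      ⋃ l ∈ Finset.range (2 * 2 ^ m + 1), B l := by
    rintro z ⟨ρ, hρ, hz⟩
    rw [abs_le] at hρ
    have hdR : 0 < δ * R := by positivity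
    have hx0 : 0 ≤ (ρ + R) / (δ * R) := div_nonneg (by linarith) hdR.le
    refine Set.mem_iUnion₂.2 ⟨⌊(ρ + R) / (δ * R)⌋₊, ?_, ?_⟩
    · rw [Finset.mem_range, Nat.lt_succ_iff]
      refine Nat.floor_le_of_le ?_
      push_cast
      rw [div_le_iff₀ hdR]
      nlinarith
    · rw [mem_closedBall_iff_norm]
      have h1 := Nat.floor_le hx0
      have h2 := (Nat.lt_floor_add_one ((ρ + R) / (δ * R))).le
      rw [le_div_iff₀ hdR] at h1
      rw [div_le_iff₀ hdR] at h2
      set l : ℝ := (⌊(ρ + R) / (δ * R)⌋₊ : ℝ)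
      have h3 : z - (-R + l * (δ * R)) • e = (z - ρ • e) + (ρ + R - l * (δ * R)) • e := by
        module
      rw [h3]
      refine (norm_add_le _ _).trans ?_
      rw [norm_smul, he, Real.norm_of_nonneg (by linarith)]
      linarith
  calc _ ≤ volume (⋃ l ∈ Finset.range (2 * 2 ^ m + 1), B l) := measure_mono hsub
    _ ≤ ∑ l ∈ Finset.range (2 * 2 ^ m + 1), volume (B l) := measure_biUnion_finset_le _ _
    _ = (2 * 2 ^ m + 1 : ℕ) * (ENNReal.ofReal (((κ + 1) * δ * R) ^ Module.finrank ℝ E) *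
        volume (ball (0 : E) 1)) := by
        rw [Finset.sum_congr rfl (fun l _ => Measure.addHaar_closedBall volume _ (by positivity))]
        simp
    _ ≤ _ := by
        rw [← mul_assoc, ← ENNReal.ofReal_natCast, ← ENNReal.ofReal_mul (by positivity)]
        gcongr
        push_cast
        have : (1 : ℝ) ≤ 2 ^ m := one_le_pow₀ one_le_two
        linarith

end Net

section Tubes

variable {E : Type*} [NormedAddCommGroup E] [InnerProductSpace ℝ E] [FiniteDimensional ℝ E]
  [MeasurableSpace E] [BorelSpace E]

/-- The tube of length `2 ^ (j + 2)` and width comparable to `κ 2 ^ (j - m)` around the line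
spanned by `e`. -/
def tube (m : ℕ) (e : E) (κ : ℝ) (j : ℤ) : Set E :=
  {z | ∃ ρ : ℝ, |ρ| ≤ 2 ^ (j + 1) ∧ ‖z - ρ • e‖ ≤ κ * ((2 : ℝ) ^ m)⁻¹ * 2 ^ (j + 1)}

/-- The constant in the volume bound for tubes. -/
def tubeC (E : Type*) [NormedAddCommGroup E] [InnerProductSpace ℝ E] [FiniteDimensional ℝ E]
    [MeasurableSpace E] [BorelSpace E] (m : ℕ) : ℝ≥0∞ :=
  ENNReal.ofReal (3 * 2 ^ m * (5 * ((2 : ℝ) ^ m)⁻¹) ^ Module.finrank ℝ E) *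
    volume (ball (0 : E) 1)

theorem tubeC_lt_top (m : ℕ) : tubeC E m < ∞ :=
  ENNReal.mul_lt_top ENNReal.ofReal_lt_top measure_ball_lt_top

/-- The factor `2 ^ (j d)`. -/
def vsc (E : Type*) [NormedAddCommGroup E] [InnerProductSpace ℝ E] (j : ℤ) : ℝ≥0∞ :=
  ENNReal.ofReal (((2 : ℝ) ^ j) ^ Module.finrank ℝ E)

theorem vsc_ne_zero (j : ℤ) : vsc E j ≠ 0 := by
  rw [vsc, Ne, ENNReal.ofReal_eq_zero, not_le]; positivity

theorem vsc_ne_top (j : ℤ) : vsc E j ≠ ∞ := ENNReal.ofReal_ne_top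

open scoped Pointwise in
theorem measurableSet_tube (m : ℕ) (e : E) (κ : ℝ) (j : ℤ) : MeasurableSet (tube m e κ j) := by
  have h : tube m e κ j = (fun ρ : ℝ => ρ • e) '' closedBall 0 (2 ^ (j + 1)) +
      closedBall (0 : E) (κ * ((2 : ℝ) ^ m)⁻¹ * 2 ^ (j + 1)) := by
    ext z
    rw [Set.mem_add]
    constructor
    · rintro ⟨ρ, h1, h2⟩
      exact ⟨ρ • e, ⟨ρ, by simpa using h1, rfl⟩, z - ρ • e, by simpa using h2, by abel⟩
    · rintro ⟨_, ⟨ρ, h1, rfl⟩, w, h2, rfl⟩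
      exact ⟨ρ, by simpa using h1, by simpa using h2⟩
  rw [h]
  exact (((isCompact_closedBall _ _).image (by fun_prop)).add
    (isCompact_closedBall _ _)).measurableSet

theorem volume_tube_le_vsc (m : ℕ) {e : E} (he : ‖e‖ = 1) (j : ℤ) :
    volume (tube m e (3 / 2) j) ≤ tubeC E m * vsc E j := by
  refine (volume_tube_le m he (by positivity) (by norm_num)).trans (le_of_eq ?_)
  rw [tubeC, vsc, mul_right_comm (ENNReal.ofReal _), ← ENNReal.ofReal_mul (by positivity),
    mul_assoc (3 * 2 ^ m : ℝ), ← mul_pow, zpow_add₀ two_ne_zero]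
  congr 4
  ring

variable {ι : Type*} [Fintype ι] {m : ℕ} {e : E} {j : ι → ℤ} {r : ι → ℝ} {c : ι → E}
  {Q : ι → Set E} {β : ι → E → ℝ≥0∞} {α : ℝ≥0∞}

theorem sum_lintegral_tube_le (he : ‖e‖ = 1) (hr : ∀ q, r q ≤ ((2 : ℝ) ^ m)⁻¹ * 2 ^ j q)
    (hQm : ∀ q, MeasurableSet (Q q)) (hQd : Pairwise fun q q' => Disjoint (Q q) (Q q'))
    (hQ : ∀ q, Q q ⊆ closedBall (c q) (r q)) 
    (hsupp : ∀ q x, r q < ‖x - c q‖ → β q x = 0)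
    (hα : ∀ q, ∫⁻ x, β q x ≤ α * volume (Q q)) (y : E) (j₀ : ℤ) :
    ∑ q ∈ Finset.univ.filter (fun q => j q ≤ j₀),
      ∫⁻ z, (tube m e (1 / 2) j₀).indicator 1 (z - y) * β q z ≤ α * (tubeC E m * vsc E j₀) := by
  classical
  let I := Finset.univ.filter fun q => j q ≤ j₀ ∧ ∃ z, z - y ∈ tube m e (1 / 2) j₀ ∧ β q z ≠ 0
  have h1 : ∑ q ∈ Finset.univ.filter (fun q => j q ≤ j₀),
      ∫⁻ z, (tube m e (1 / 2) j₀).indicator 1 (z - y) * β q z ≤ ∑ q ∈ I, ∫⁻ z, β q z := by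
    rw [← Finset.sum_subset (s₁ := I)]
    · refine Finset.sum_le_sum fun q _ => lintegral_mono fun z => ?_
      exact mul_le_of_le_one_left' (Set.indicator_apply_le' (fun _ => le_rfl) fun _ => zero_le)
    · intro q hq
      simp only [I, Finset.mem_filter] at hq ⊢
      exact ⟨hq.1, hq.2.1⟩
    · intro q hq hqI
      simp only [I, Finset.mem_filter, Finset.mem_univ, true_and, not_and, not_exists, not_not] at hq hqI
      rw [lintegral_eq_zero_of_ae_eq_zero]
      refine Eventually.of_forall fun z => ?_
      by_cases hz : z - y ∈ tube m e (1 / 2) j₀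
      · simp [hqI hq z hz]
      · simp only [Set.indicator_of_notMem hz, zero_mul, Pi.zero_apply]
  have h2 : (⋃ q ∈ I, Q q) ⊆ (fun z => z + -y) ⁻¹' tube m e (3 / 2) j₀ := by
    refine Set.iUnion₂_subset fun q hq w hw => ?_
    simp only [I, Finset.mem_filter, Finset.mem_univ, true_and] at hq
    obtain ⟨hj, z, ⟨ρ, hρ, hz⟩, hb⟩ := hq
    refine ⟨ρ, hρ, ?_⟩
    have hzc : ‖z - c q‖ ≤ r q := by
      by_contra! h
      exact hb (hsupp q z h)
    have hwc : ‖w - c q‖ ≤ r q := mem_closedBall_iff_norm.1 (hQ q hw)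
    have h3 : w + -y - ρ • e = (z - y - ρ • e) + ((w - c q) - (z - c q)) := by abel
    have h4 : ((2 : ℝ) ^ m)⁻¹ * 2 ^ j q ≤ ((2 : ℝ) ^ m)⁻¹ * 2 ^ j₀ := by
      gcongr; norm_num
    rw [h3]
    refine (norm_add_le _ _).trans ((add_le_add hz (norm_sub_le _ _)).trans ?_)
    have h5 : (2 : ℝ) ^ (j₀ + 1) = 2 * 2 ^ j₀ := by rw [zpow_add₀ two_ne_zero]; ring
    rw [h5]
    linarith [hr q]
  calc _ ≤ ∑ q ∈ I, ∫⁻ z, β q z := h1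
    _ ≤ ∑ q ∈ I, α * volume (Q q) := Finset.sum_le_sum fun q _ => hα q
    _ = α * volume (⋃ q ∈ I, Q q) := by
        rw [← Finset.mul_sum, measure_biUnion_finset (fun q _ q' _ h => hQd h) fun q _ => hQm q]
    _ ≤ α * volume (tube m e (3 / 2) j₀) := by
        refine mul_le_mul_right ?_ _
        exact (measure_mono h2).trans (measure_preimage_add_right volume _ _).le
    _ ≤ _ := by gcongr; exact volume_tube_le_vsc m he j₀

variable {S : ι → Set E}

theorem sub_mem_tube {w w' : E} {j j' : ℤ} (hj : j' ≤ j)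
    (hw : ‖w‖ < 2 ^ (j + 1) ∧ ‖w - ‖w‖ • e‖ ≤ ((2 : ℝ) ^ m)⁻¹ * 2 ^ j / 2)
    (hw' : ‖w'‖ < 2 ^ (j' + 1) ∧ ‖w' - ‖w'‖ • e‖ ≤ ((2 : ℝ) ^ m)⁻¹ * 2 ^ j' / 2) :
    w - w' ∈ tube m e (1 / 2) j := by
  have h4 : ((2 : ℝ) ^ m)⁻¹ * 2 ^ j' ≤ ((2 : ℝ) ^ m)⁻¹ * 2 ^ j := by
    gcongr; norm_num
  have h5 : (2 : ℝ) ^ (j + 1) = 2 * 2 ^ j := by rw [zpow_add₀ two_ne_zero]; ring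
  have h6 : (2 : ℝ) ^ (j' + 1) ≤ 2 ^ (j + 1) := by gcongr; norm_num
  refine ⟨‖w‖ - ‖w'‖, ?_, ?_⟩
  · rw [abs_le]
    constructor <;> linarith [norm_nonneg w, norm_nonneg w', hw.1, hw'.1]
  · have h3 : w - w' - (‖w‖ - ‖w'‖) • e = (w - ‖w‖ • e) - (w' - ‖w'‖ • e) := by module
    rw [h3, h5]
    refine (norm_sub_le _ _).trans ?_
    linarith [hw.2, hw'.2]

/-- The normalised average of `β` over the translate of `S`. -/
def avgOn (j : ℤ) (S : Set E) (β : E → ℝ≥0∞) (x : E) : ℝ≥0∞ :=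
  (vsc E j)⁻¹ * ∫⁻ y, S.indicator 1 (x - y) * β y

theorem measurable_indicator_sub {S : Set E} (hS : MeasurableSet S) :
    Measurable fun p : E × E => S.indicator (1 : E → ℝ≥0∞) (p.1 - p.2) :=
  (measurable_one.indicator hS).comp (measurable_fst.sub measurable_snd)

theorem measurable_avgOn {j : ℤ} {S : Set E} (hS : MeasurableSet S) {β : E → ℝ≥0∞}
    (hβ : Measurable β) : Measurable (avgOn j S β) := by
  refine Measurable.const_mul ?_ _
  exact Measurable.lintegral_prod_right'
    ((measurable_indicator_sub hS).mul (hβ.comp measurable_snd))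

theorem lintegral_indicator_avgOn_le (he : ‖e‖ = 1) {j j' : ℤ} (hj : j' ≤ j) {S S' : Set E}
    (hS : ∀ w ∈ S, ‖w‖ < 2 ^ (j + 1) ∧ ‖w - ‖w‖ • e‖ ≤ ((2 : ℝ) ^ m)⁻¹ * 2 ^ j / 2)
    (hS' : ∀ w ∈ S', ‖w‖ < 2 ^ (j' + 1) ∧ ‖w - ‖w‖ • e‖ ≤ ((2 : ℝ) ^ m)⁻¹ * 2 ^ j' / 2)
    (hSm' : MeasurableSet S') {β : E → ℝ≥0∞} (hβ : Measurable β) (y : E) :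
    ∫⁻ x, S.indicator 1 (x - y) * avgOn j' S' β x ≤
      tubeC E m * ∫⁻ z, (tube m e (1 / 2) j).indicator 1 (z - y) * β z := by
  have hvol : volume S' ≤ tubeC E m * vsc E j' := by
    refine (measure_mono fun w hw => ?_).trans (volume_tube_le_vsc m he j')
    have h5 : (2 : ℝ) ^ (j' + 1) = 2 * 2 ^ j' := by rw [zpow_add₀ two_ne_zero]; ring
    have h0 : 0 ≤ ((2 : ℝ) ^ m)⁻¹ * 2 ^ j' := by positivity
    refine ⟨‖w‖, ?_, (hS' w hw).2.trans ?_⟩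
    · rw [abs_norm]; exact (hS' w hw).1.le
    · rw [h5]; linarith
  have hm1 : Measurable fun p : E × E => S'.indicator (1 : E → ℝ≥0∞) (p.1 - p.2) * β p.2 :=
    (measurable_indicator_sub hSm').mul (hβ.comp measurable_snd)
  calc ∫⁻ x, S.indicator 1 (x - y) * avgOn j' S' β x
      = ∫⁻ x, ∫⁻ z, (vsc E j')⁻¹ * (S.indicator 1 (x - y) * (S'.indicator 1 (x - z) * β z)) := by
        refine lintegral_congr fun x => ?_
        have hx : Measurable fun z => S'.indicator (1 : E → ℝ≥0∞) (x - z) * β z :=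
          hm1.comp measurable_prodMk_left
        rw [avgOn, lintegral_const_mul _ (hx.const_mul _), lintegral_const_mul _ hx]
        ring
    _ ≤ ∫⁻ x, ∫⁻ z, (vsc E j')⁻¹ * (S'.indicator 1 (x - z) *
          ((tube m e (1 / 2) j).indicator 1 (z - y) * β z)) := by
        refine lintegral_mono fun x => lintegral_mono fun z => ?_
        by_cases h1 : x - y ∈ S
        · by_cases h2 : x - z ∈ S'
          · have h3 : z - y ∈ tube m e (1 / 2) j := by
              have := sub_mem_tube hj (hS _ h1) (hS' _ h2)
              rwa [show x - y - (x - z) = z - y by abel] at this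
            simp only [Set.indicator_of_mem h1, Set.indicator_of_mem h2, Set.indicator_of_mem h3,
              Pi.one_apply, one_mul, le_refl]
          · simp [h2]
        · simp [h1]
    _ = ∫⁻ z, ∫⁻ x, (vsc E j')⁻¹ * (S'.indicator 1 (x - z) *
          ((tube m e (1 / 2) j).indicator 1 (z - y) * β z)) := by
        refine lintegral_lintegral_swap (Measurable.aemeasurable ?_)
        refine Measurable.const_mul ((measurable_indicator_sub hSm').mul ?_) _
        refine Measurable.mul ?_ (hβ.comp measurable_snd)
        exact (measurable_one.indicator (measurableSet_tube m e _ j)).comp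
          (measurable_snd.sub measurable_const)
    _ = ∫⁻ z, (vsc E j')⁻¹ * (volume S' * ((tube m e (1 / 2) j).indicator 1 (z - y) * β z)) := by
        refine lintegral_congr fun z => ?_
        have hx : Measurable fun x => S'.indicator (1 : E → ℝ≥0∞) (x - z) :=
          (measurable_indicator_sub hSm').comp measurable_prodMk_right
        rw [lintegral_const_mul _ (hx.mul_const _), lintegral_mul_const _ hx]
        congr 2
        rw [lintegral_sub_right_eq_self (fun x => S'.indicator (1 : E → ℝ≥0∞) x) z,
          lintegral_indicator_one hSm']
    _ ≤ ∫⁻ z, tubeC E m * ((tube m e (1 / 2) j).indicator 1 (z - y) * β z) := by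
        refine lintegral_mono fun z => ?_
        rw [← mul_assoc]
        gcongr
        calc _ ≤ (vsc E j')⁻¹ * (tubeC E m * vsc E j') := by gcongr
          _ = _ := by
            rw [mul_comm, mul_assoc, ENNReal.mul_inv_cancel (vsc_ne_zero _) (vsc_ne_top _), mul_one]
    _ = _ := by
        rw [lintegral_const_mul' _ _ (tubeC_lt_top m).ne]

theorem sq_sum_le (j : ι → ℤ) (x : ι → ℝ≥0∞) : (∑ q, x q) ^ 2 ≤
    2 * ∑ q, x q * ∑ q' ∈ Finset.univ.filter (fun q' => j q' ≤ j q), x q' := by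
  have h : (∑ q, x q) ^ 2 ≤ (∑ q, ∑ q', if j q' ≤ j q then x q * x q' else 0) +
      ∑ q, ∑ q', if j q ≤ j q' then x q * x q' else 0 := by
    rw [sq, Finset.sum_mul_sum, ← Finset.sum_add_distrib]
    refine Finset.sum_le_sum fun q _ => ?_
    rw [← Finset.sum_add_distrib]
    refine Finset.sum_le_sum fun q' _ => ?_
    rcases le_total (j q) (j q') with h | h
    · rw [if_pos h]; exact le_add_self
    · rw [if_pos h]; exact le_self_add
  refine h.trans (le_of_eq ?_)
  rw [Finset.sum_comm (f := fun q q' => if j q ≤ j q' then x q * x q' else 0), two_mul]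
  simp only [Finset.mul_sum, Finset.sum_filter, mul_ite, mul_zero, mul_comm]

theorem lintegral_sq_sum_avgOn_le (he : ‖e‖ = 1)
    (hr : ∀ q, r q ≤ ((2 : ℝ) ^ m)⁻¹ * 2 ^ j q)
    (hQm : ∀ q, MeasurableSet (Q q)) (hQd : Pairwise fun q q' => Disjoint (Q q) (Q q'))
    (hQ : ∀ q, Q q ⊆ closedBall (c q) (r q)) (hβ : ∀ q, Measurable (β q))
    (hsupp : ∀ q x, r q < ‖x - c q‖ → β q x = 0)
    (hα : ∀ q, ∫⁻ x, β q x ≤ α * volume (Q q)) (hSm : ∀ q, MeasurableSet (S q))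
    (hS : ∀ q, ∀ w ∈ S q, ‖w‖ < 2 ^ (j q + 1) ∧
      ‖w - ‖w‖ • e‖ ≤ ((2 : ℝ) ^ m)⁻¹ * 2 ^ j q / 2) :
    ∫⁻ x, (∑ q, avgOn (j q) (S q) (β q) x) ^ 2 ≤
      2 * (tubeC E m ^ 2 * α) * ∑ q, ∫⁻ x, β q x := by
  have hGm : ∀ q, Measurable (avgOn (j q) (S q) (β q)) := fun q => measurable_avgOn (hSm q) (hβ q)
  have key : ∀ q, ∫⁻ x, avgOn (j q) (S q) (β q) x *
      ∑ q' ∈ Finset.univ.filter (fun q' => j q' ≤ j q), avgOn (j q') (S q') (β q') x ≤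
      tubeC E m ^ 2 * α * ∫⁻ x, β q x := by
    intro q
    set H : E → ℝ≥0∞ :=
      fun x => ∑ q' ∈ Finset.univ.filter (fun q' => j q' ≤ j q), avgOn (j q') (S q') (β q') x
    have hH : Measurable H := Finset.measurable_fun_sum _ fun q' _ => hGm q'
    have hm : Measurable fun p : E × E => (S q).indicator (1 : E → ℝ≥0∞) (p.1 - p.2) :=
      measurable_indicator_sub (hSm q)
    calc _ = ∫⁻ x, ∫⁻ y, (vsc E (j q))⁻¹ * ((S q).indicator 1 (x - y) * H x * β q y) := by
          refine lintegral_congr fun x => ?_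
          have h1 : Measurable fun y => (S q).indicator (1 : E → ℝ≥0∞) (x - y) :=
            hm.comp measurable_prodMk_left
          have h2 : Measurable fun y => (S q).indicator (1 : E → ℝ≥0∞) (x - y) * H x * β q y :=
            (h1.mul_const _).mul (hβ q)
          rw [lintegral_const_mul _ h2, avgOn, mul_assoc]
          congr 1
          have h3 : Measurable fun y => (S q).indicator (1 : E → ℝ≥0∞) (x - y) * β q y :=
            h1.mul (hβ q)
          rw [← lintegral_mul_const _ h3]
          exact lintegral_congr fun y => mul_right_comm _ _ _
      _ = ∫⁻ y, ∫⁻ x, (vsc E (j q))⁻¹ * ((S q).indicator 1 (x - y) * H x * β q y) :=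
          lintegral_lintegral_swap (Measurable.aemeasurable
            (((hm.mul (hH.comp measurable_fst)).mul ((hβ q).comp measurable_snd)).const_mul _))
      _ ≤ ∫⁻ y, tubeC E m ^ 2 * α * β q y := by
          refine lintegral_mono fun y => ?_
          have h1 : Measurable fun x => (S q).indicator (1 : E → ℝ≥0∞) (x - y) :=
            hm.comp measurable_prodMk_right
          have h2 : ∫⁻ x, (S q).indicator 1 (x - y) * H x ≤
              tubeC E m * (α * (tubeC E m * vsc E (j q))) := by
            simp only [H, Finset.mul_sum]
            have h3 : ∀ q', Measurable fun x =>
                (S q).indicator (1 : E → ℝ≥0∞) (x - y) * avgOn (j q') (S q') (β q') x :=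
              fun q' => h1.mul (hGm q')
            rw [lintegral_finsetSum _ fun q' _ => h3 q']
            refine (Finset.sum_le_sum fun q' hq' => lintegral_indicator_avgOn_le he
              (Finset.mem_filter.1 hq').2 (hS q) (hS q') (hSm q') (hβ q') y).trans ?_
            rw [← Finset.mul_sum]
            gcongr
            exact sum_lintegral_tube_le he hr hQm hQd hQ hsupp hα y (j q)
          have h3 : Measurable fun x => (S q).indicator (1 : E → ℝ≥0∞) (x - y) * H x := h1.mul hH
          rw [lintegral_const_mul _ (h3.mul_const _), lintegral_mul_const _ h3, ← mul_assoc]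
          refine mul_le_mul_left ?_ _
          calc _ ≤ (vsc E (j q))⁻¹ * (tubeC E m * (α * (tubeC E m * vsc E (j q)))) := by gcongr
            _ = (vsc E (j q) * (vsc E (j q))⁻¹) * (tubeC E m ^ 2 * α) := by ring
            _ = _ := by rw [ENNReal.mul_inv_cancel (vsc_ne_zero _) (vsc_ne_top _), one_mul]
      _ = _ := lintegral_const_mul _ (hβ q)
  calc _ ≤ ∫⁻ x, 2 * ∑ q, avgOn (j q) (S q) (β q) x *
        ∑ q' ∈ Finset.univ.filter (fun q' => j q' ≤ j q), avgOn (j q') (S q') (β q') x :=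
        lintegral_mono fun x => sq_sum_le j _
    _ = 2 * ∑ q, ∫⁻ x, avgOn (j q) (S q) (β q) x *
        ∑ q' ∈ Finset.univ.filter (fun q' => j q' ≤ j q), avgOn (j q') (S q') (β q') x := by
        rw [lintegral_const_mul' _ _ (by norm_num), lintegral_finsetSum]
        exact fun q _ => (hGm q).mul (Finset.measurable_fun_sum _ fun q' _ => hGm q')
    _ ≤ 2 * ∑ q, tubeC E m ^ 2 * α * ∫⁻ x, β q x := by
        gcongr with q
        exact key q
    _ = _ := by rw [← Finset.mul_sum, mul_assoc, mul_assoc, mul_assoc]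

end Tubes

section DirPlancherel
open scoped FourierTransform SchwartzMap

variable {E : Type*} [NormedAddCommGroup E] [InnerProductSpace ℝ E] [FiniteDimensional ℝ E]
  [MeasurableSpace E] [BorelSpace E]

/-- The sum of the kernels localising frequencies near the hyperplane orthogonal to `e`. -/
def pksum (m : ℕ) (a : ℤ) (n : ℕ) (e x : E) : ℂ :=
  ∑ i ∈ Finset.range n, pker (a + 1 + i) ((2 : ℝ) ^ ((m : ℤ) - (a + 1 + i)) • e) x

/-- The Fourier transform of `pksum`. -/
def psym (m : ℕ) (a : ℤ) (n : ℕ) (e ξ : E) : ℝ :=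
  ∑ i ∈ Finset.range n, cutoff ℝ (inner ℝ ((2 : ℝ) ^ ((m : ℤ) - (a + 1 + i)) • e) ξ) *
    (cutoff E (((2 : ℝ) ^ (a + 1 + i))⁻¹ • ξ) - cutoff E (((2 : ℝ) ^ (a + 1 + i - 1))⁻¹ • ξ))

theorem continuous_pksum (m : ℕ) (a : ℤ) (n : ℕ) (e : E) : Continuous (pksum m a n e) :=
  continuous_finsetSum _ fun _ _ => continuous_pker _ _

theorem integrable_pksum (m : ℕ) (a : ℤ) (n : ℕ) (e : E) : Integrable (pksum m a n e) :=
  integrable_finsetSum _ fun _ _ => integrable_pker _ _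

theorem bounded_pksum (m : ℕ) (a : ℤ) (n : ℕ) (e : E) : ∃ C, ∀ x, ‖pksum m a n e x‖ ≤ C := by
  choose C hC using fun i : ℕ => bounded_pker (a + 1 + i) ((2 : ℝ) ^ ((m : ℤ) - (a + 1 + i)) • e)
  exact ⟨∑ i ∈ Finset.range n, C i, fun x =>
    (norm_sum_le _ _).trans (Finset.sum_le_sum fun i _ => hC i x)⟩

theorem fourier_finsetSum {ι : Type*} (s : Finset ι) {f : ι → E → ℂ} (hf : ∀ i ∈ s, Integrable (f i))
    (ξ : E) : 𝓕 (fun x => ∑ i ∈ s, f i x) ξ = ∑ i ∈ s, 𝓕 (f i) ξ := by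
  simp only [Real.fourier_eq, Finset.smul_sum]
  rw [integral_finsetSum]
  exact fun i hi => (Real.fourierIntegral_convergent_iff ξ).2 (hf i hi)

theorem fourier_pksum (m : ℕ) (a : ℤ) (n : ℕ) (e ξ : E) :
    𝓕 (pksum m a n e) ξ = (psym m a n e ξ : ℂ) := by
  have : pksum m a n e = fun x => ∑ i ∈ Finset.range n,
    pker (a + 1 + i) ((2 : ℝ) ^ ((m : ℤ) - (a + 1 + i)) • e) x := rfl
  rw [this, fourier_finsetSum _ fun i _ => integrable_pker _ _, psym, Complex.ofReal_sum]
  exact Finset.sum_congr rfl fun i _ => fourier_pker _ _ _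

theorem psym_nonneg (m : ℕ) (a : ℤ) (n : ℕ) (e ξ : E) : 0 ≤ psym m a n e ξ :=
  Finset.sum_nonneg fun _ _ => mul_nonneg (cutoff_nonneg _) (cutoff_sub_nonneg _ _)

theorem psym_le_one (m : ℕ) (a : ℤ) (n : ℕ) (e ξ : E) : psym m a n e ξ ≤ 1 := by
  have h := Finset.sum_range_sub (fun i : ℕ => cutoff E (((2 : ℝ) ^ (a + i))⁻¹ • ξ)) n
  calc psym m a n e ξ ≤ ∑ i ∈ Finset.range n, (cutoff E (((2 : ℝ) ^ (a + ((i + 1 : ℕ) : ℤ)))⁻¹ • ξ) -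
        cutoff E (((2 : ℝ) ^ (a + i))⁻¹ • ξ)) := by
        refine Finset.sum_le_sum fun i _ => ?_
        have h1 : a + ((i + 1 : ℕ) : ℤ) = a + 1 + i := by push_cast; ring
        have h2 : a + (i : ℤ) = a + 1 + i - 1 := by ring
        rw [h1, h2]
        exact mul_le_of_le_one_left (cutoff_sub_nonneg _ _) (cutoff_le_one _)
    _ ≤ 1 := by
        rw [h]
        linarith [cutoff_le_one (((2 : ℝ) ^ (a + n))⁻¹ • ξ),
          cutoff_nonneg (((2 : ℝ) ^ (a + (0 : ℕ)))⁻¹ • ξ)]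

theorem inner_le_of_psym_ne_zero {m : ℕ} {a : ℤ} {n : ℕ} {e ξ : E} (h : psym m a n e ξ ≠ 0) :
    ξ ≠ 0 ∧ |inner ℝ ξ e| ≤ 4 * ((2 : ℝ) ^ m)⁻¹ * ‖ξ‖ := by
  obtain ⟨i, -, hi⟩ := Finset.exists_ne_zero_of_sum_ne_zero h
  set k : ℤ := a + 1 + i
  have h1 := left_ne_zero_of_mul hi
  have h2 := right_ne_zero_of_mul hi
  have hk : (0 : ℝ) < 2 ^ k := by positivity
  have h3 : 2 ^ k ≤ 2 * ‖ξ‖ := by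
    by_contra! hlt
    refine h2 ?_
    have h4 : ‖((2 : ℝ) ^ (k - 1))⁻¹ • ξ‖ ≤ 1 := by
      rw [norm_smul, norm_inv, Real.norm_of_nonneg (by positivity), zpow_sub_one₀ two_ne_zero,
        inv_mul_le_iff₀ (by positivity)]
      linarith
    have h5 : ‖((2 : ℝ) ^ k)⁻¹ • ξ‖ ≤ 1 := by
      rw [norm_smul, norm_inv, Real.norm_of_nonneg (by positivity), inv_mul_le_iff₀ (by positivity)]
      linarith [norm_nonneg ξ]
    rw [cutoff_eq_one h4, cutoff_eq_one h5, sub_self]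
  refine ⟨fun h0 => ?_, ?_⟩
  · rw [h0, norm_zero] at h3; linarith
  · have h6 : ‖inner ℝ ((2 : ℝ) ^ ((m : ℤ) - k) • e) ξ‖ ^ 2 < 2 := by
      by_contra! hge
      exact h1 (cutoff_eq_zero hge)
    have hz : (2 : ℝ) ^ ((m : ℤ) - k) * ((2 : ℝ) ^ m)⁻¹ * 2 ^ k = 1 := by
      rw [zpow_sub₀ two_ne_zero, zpow_natCast]; field_simp
    rw [real_inner_smul_left, norm_mul, Real.norm_of_nonneg (by positivity), Real.norm_eq_abs,
      real_inner_comm] at h6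
    have h7 : (2 : ℝ) ^ ((m : ℤ) - k) * |inner ℝ ξ e| ≤ 2 := by
      by_contra! h8
      nlinarith
    calc |inner ℝ ξ e| = ((2 : ℝ) ^ ((m : ℤ) - k) * |inner ℝ ξ e|) * (((2 : ℝ) ^ m)⁻¹ * 2 ^ k) := by
          linear_combination (-|inner ℝ ξ e|) * hz
      _ ≤ 2 * (((2 : ℝ) ^ m)⁻¹ * (2 * ‖ξ‖)) := by gcongr
      _ = _ := by ring

theorem contDiff_psym (m : ℕ) (a : ℤ) (n : ℕ) (e : E) : ContDiff ℝ (⊤ : ℕ∞) (psym m a n e) := by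
  refine ContDiff.sum fun i _ => ?_
  refine ((contDiff_cutoff le_rfl).comp (contDiff_const.inner ℝ contDiff_id)).mul (ContDiff.sub ?_ ?_)
  · exact (contDiff_cutoff le_rfl).comp (by fun_prop)
  · exact (contDiff_cutoff le_rfl).comp (by fun_prop)

theorem hasCompactSupport_psym (m : ℕ) (a : ℤ) (n : ℕ) (e : E) : HasCompactSupport (psym m a n e) := by
  refine HasCompactSupport.intro (isCompact_closedBall (0 : E) (2 * 2 ^ (a + 1 + n))) fun ξ hξ => ?_
  refine Finset.sum_eq_zero fun i hi => ?_
  rw [mem_closedBall_zero_iff, not_le] at hξ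
  have h : ∀ k ≤ a + 1 + n, cutoff E (((2 : ℝ) ^ k)⁻¹ • ξ) = 0 := by
    intro k hk
    apply cutoff_eq_zero
    have h1 : (2 : ℝ) ^ k ≤ 2 ^ (a + 1 + n) := by gcongr; norm_num
    have h2 : 2 ≤ ‖((2 : ℝ) ^ k)⁻¹ • ξ‖ := by
      rw [norm_smul, norm_inv, Real.norm_of_nonneg (by positivity), le_inv_mul_iff₀ (by positivity)]
      linarith
    nlinarith
  have hi' := Finset.mem_range.1 hi
  rw [h _ (by omega), h _ (by omega), sub_self, mul_zero]

theorem lintegral_enorm_sq_fourier (f : 𝓢(E, ℂ)) : ∫⁻ x, ‖(𝓕 f) x‖ₑ ^ 2 = ∫⁻ x, ‖f x‖ₑ ^ 2 := by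
  have lintegral_sq_eq : ∀ f : 𝓢(E, ℂ), ∫⁻ x, ‖f x‖ₑ ^ 2 = ENNReal.ofReal (∫ x, ‖f x‖ ^ 2) := by
    intro f
    rw [ofReal_integral_eq_lintegral_ofReal]
    · refine lintegral_congr fun x => ?_
      rw [ENNReal.ofReal_pow (norm_nonneg _), ofReal_norm]
    · exact (f.memLp 2).integrable_norm_pow (by norm_num)
    · exact Eventually.of_forall fun x => by positivity
  rw [lintegral_sq_eq, lintegral_sq_eq, SchwartzMap.integral_norm_sq_fourier]

set_option maxHeartbeats 800000 in
/-- Almost orthogonality for the frequency localised pieces. -/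
theorem lintegral_sq_sum_cv_pksum_le (m : ℕ) (a : ℤ) (n : ℕ) (S : Finset E) {g : E → E → ℂ}
    (hg : ∀ e ∈ S, ContDiff ℝ (⊤ : ℕ∞) (g e)) (hgc : ∀ e ∈ S, HasCompactSupport (g e)) {N : ℝ}
    (hN : ∀ ξ : E, ξ ≠ 0 →
      ((S.filter fun e => |inner ℝ ξ e| ≤ 4 * ((2 : ℝ) ^ m)⁻¹ * ‖ξ‖).card : ℝ) ≤ N) (hN0 : 0 ≤ N) :
    ∫⁻ x, ‖∑ e ∈ S, cv (pksum m a n e) (g e) x‖ₑ ^ 2 ≤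
      ENNReal.ofReal N * ∑ e ∈ S, ∫⁻ x, ‖g e x‖ₑ ^ 2 := by
  classical
  let G : E → E → ℂ := fun e => if e ∈ S then g e else 0
  have hG : ∀ e, ContDiff ℝ (⊤ : ℕ∞) (G e) := fun e => by
    by_cases h : e ∈ S
    · simpa [G, h] using hg e h
    · simp only [G, h, if_false]
      exact contDiff_const
  have hGc : ∀ e, HasCompactSupport (G e) := fun e => by
    by_cases h : e ∈ S
    · simpa [G, h] using hgc e h
    · simpa [G, h] using HasCompactSupport.zero
  let γ : E → 𝓢(E, ℂ) := fun e => (hGc e).toSchwartzMap (hG e)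
  have hγ : ∀ e ∈ S, (γ e : E → ℂ) = g e := fun e he => by
    ext x; simp [γ, G, he]
  let R : E → ℂ := fun ξ => ∑ e ∈ S, (psym m a n e ξ : ℂ) * (𝓕 (γ e)) ξ
  have hRs : ContDiff ℝ (⊤ : ℕ∞) R := ContDiff.sum fun e _ =>
    (Complex.ofRealCLM.contDiff.comp (contDiff_psym m a n e)).mul ((𝓕 (γ e)).smooth _)
  have hRc : HasCompactSupport R := by
    refine HasCompactSupport.intro (isCompact_iUnion fun e : S =>
      (hasCompactSupport_psym m a n (e : E))) fun ξ hξ => ?_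
    refine Finset.sum_eq_zero fun e he => ?_
    have : psym m a n e ξ = 0 := by
      by_contra h
      exact hξ (Set.mem_iUnion.2 ⟨⟨e, he⟩, subset_tsupport _ h⟩)
    rw [this]; simp
  let ρ : 𝓢(E, ℂ) := hRc.toSchwartzMap hRs
  have hρ : ∀ ξ, ρ ξ = R ξ := fun ξ => rfl
  have hpi := fun e => integrable_pksum (E := E) m a n e
  have hgi : ∀ e ∈ S, Integrable (g e) := fun e he => hγ e he ▸ (γ e).integrable
  have hci : ∀ e ∈ S, Integrable (cv (pksum m a n e) (g e)) := fun e he =>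
    integrable_cv (hpi e) (hgi e he)
  have hcc : ∀ e ∈ S, Continuous (cv (pksum m a n e) (g e)) := fun e he =>
    (HasCompactSupport.continuous_convolution_right _ (hgc e he) (hpi e).locallyIntegrable
      (hg e he).continuous)
  have hF : 𝓕 (fun x => ∑ e ∈ S, cv (pksum m a n e) (g e) x) = ρ := by
    ext ξ
    rw [fourier_finsetSum S hci, hρ]
    refine Finset.sum_congr rfl fun e he => ?_
    rw [fourier_cv (hpi e) (hgi e he), fourier_pksum, SchwartzMap.fourier_coe, hγ e he]
  have hinv : (fun x => ∑ e ∈ S, cv (pksum m a n e) (g e) x) = 𝓕⁻ (ρ : E → ℂ) := by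
    rw [← hF, Continuous.fourierInv_fourier_eq (continuous_finsetSum _ hcc)
      (integrable_finsetSum _ hci) (by rw [hF]; exact ρ.integrable)]
  have hpt : ∀ ξ, ‖R ξ‖ₑ ^ 2 ≤ ENNReal.ofReal N * ∑ e ∈ S, ‖(𝓕 (γ e)) ξ‖ₑ ^ 2 := by
    intro ξ
    have h1 : ‖R ξ‖ ^ 2 ≤ N * ∑ e ∈ S, ‖(𝓕 (γ e)) ξ‖ ^ 2 := by
      by_cases h0 : ∀ e ∈ S, psym m a n e ξ = 0
      · have : R ξ = 0 := Finset.sum_eq_zero fun e he => by rw [h0 e he]; simp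
        rw [this]
        simp only [norm_zero, ne_eq, OfNat.ofNat_ne_zero, not_false_eq_true, zero_pow]
        exact mul_nonneg hN0 (Finset.sum_nonneg fun e _ => by positivity)
      push Not at h0
      obtain ⟨e₀, he₀, hne⟩ := h0
      have hξ := (inner_le_of_psym_ne_zero hne).1
      set S' := S.filter fun e => |inner ℝ ξ e| ≤ 4 * ((2 : ℝ) ^ m)⁻¹ * ‖ξ‖
      have h2 : ‖R ξ‖ ≤ ∑ e ∈ S', ‖(𝓕 (γ e)) ξ‖ := by
        have : R ξ = ∑ e ∈ S', (psym m a n e ξ : ℂ) * (𝓕 (γ e)) ξ := by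
          refine (Finset.sum_subset (Finset.filter_subset _ _) fun e he hne => ?_).symm
          have : psym m a n e ξ = 0 := by
            by_contra h
            exact hne (Finset.mem_filter.2 ⟨he, (inner_le_of_psym_ne_zero h).2⟩)
          rw [this]; simp
        rw [this]
        refine (norm_sum_le _ _).trans (Finset.sum_le_sum fun e _ => ?_)
        rw [norm_mul, Complex.norm_real, Real.norm_of_nonneg (psym_nonneg _ _ _ _ _)]
        exact mul_le_of_le_one_left (norm_nonneg _) (psym_le_one _ _ _ _ _)
      calc ‖R ξ‖ ^ 2 ≤ (∑ e ∈ S', ‖(𝓕 (γ e)) ξ‖) ^ 2 := by gcongr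
        _ ≤ S'.card * ∑ e ∈ S', ‖(𝓕 (γ e)) ξ‖ ^ 2 := sq_sum_le_card_mul_sum_sq
        _ ≤ _ := by
          refine mul_le_mul (hN ξ hξ) ?_ (Finset.sum_nonneg fun e _ => by positivity) hN0
          exact Finset.sum_le_sum_of_subset_of_nonneg (Finset.filter_subset _ _)
            fun e _ _ => by positivity
    have h3 := ENNReal.ofReal_le_ofReal h1
    rw [ENNReal.ofReal_mul hN0, ENNReal.ofReal_sum_of_nonneg fun e _ => by positivity] at h3
    simpa only [ENNReal.ofReal_pow (norm_nonneg _), ofReal_norm] using h3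
  calc _ = ∫⁻ x, ‖(𝓕⁻ ρ) x‖ₑ ^ 2 := by
        refine lintegral_congr fun x => ?_
        rw [SchwartzMap.fourierInv_coe, ← hinv]
    _ = ∫⁻ ξ, ‖R ξ‖ₑ ^ 2 := by
        rw [← lintegral_enorm_sq_fourier, FourierTransform.fourier_fourierInv_eq]
        exact lintegral_congr fun ξ => by rw [hρ]
    _ ≤ ∫⁻ ξ, ENNReal.ofReal N * ∑ e ∈ S, ‖(𝓕 (γ e)) ξ‖ₑ ^ 2 := lintegral_mono hpt
    _ = ENNReal.ofReal N * ∑ e ∈ S, ∫⁻ x, ‖g e x‖ₑ ^ 2 := by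
        rw [lintegral_const_mul' _ _ ENNReal.ofReal_ne_top, lintegral_finsetSum]
        · congr 1
          exact Finset.sum_congr rfl fun e he => by
            rw [lintegral_enorm_sq_fourier, hγ e he]
        · exact fun e _ => (𝓕 (γ e)).continuous.enorm.measurable.pow_const 2

end DirPlancherel

section Radial

variable {E : Type*} [NormedAddCommGroup E] [InnerProductSpace ℝ E] [FiniteDimensional ℝ E]
  [MeasurableSpace E] [BorelSpace E]

/-- The modulus of continuity in `L¹` of a Lipschitz function cut off to `[R, 2 R)`. -/
theorem lintegral_indicator_sub_translate_le {R : ℝ} (hR : 0 < R) {φ : ℝ → ℂ}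
    (h1 : ∀ r ∈ Set.Ico R (2 * R), ‖φ r‖ ≤ 1 / R)
    (h2 : ∀ r ∈ Set.Ico R (2 * R), ∀ r' ∈ Set.Ico R (2 * R), ‖φ r - φ r'‖ ≤ 2 * |r - r'| / R ^ 2)
    (v : ℝ) :
    ∫⁻ r, ‖(Set.Ico R (2 * R)).indicator φ r - (Set.Ico R (2 * R)).indicator φ (r - v)‖ₑ ≤
      ENNReal.ofReal (6 * |v| / R) := by
  have hpt : ∀ r, ‖(Set.Ico R (2 * R)).indicator φ r - (Set.Ico R (2 * R)).indicator φ (r - v)‖ₑ ≤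
      (Set.Ico R (2 * R)).indicator (fun _ => ENNReal.ofReal (2 * |v| / R ^ 2)) r +
      ((Set.Icc (R - |v|) (R + |v|)).indicator (fun _ => ENNReal.ofReal (1 / R)) r +
      (Set.Icc (2 * R - |v|) (2 * R + |v|)).indicator (fun _ => ENNReal.ofReal (1 / R)) r) := by
    intro r
    have hv1 := le_abs_self v
    have hv2 := neg_abs_le v
    by_cases ha : r ∈ Set.Ico R (2 * R) <;> by_cases hb : r - v ∈ Set.Ico R (2 * R)
    · rw [Set.indicator_of_mem ha, Set.indicator_of_mem hb, Set.indicator_of_mem ha]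
      refine le_add_right ?_
      rw [← ofReal_norm]
      refine ENNReal.ofReal_le_ofReal ((h2 r ha _ hb).trans ?_)
      rw [show r - (r - v) = v by ring]
    · rw [Set.indicator_of_mem ha, Set.indicator_of_notMem hb, sub_zero]
      refine le_add_left ?_
      have h3 : ‖φ r‖ₑ ≤ ENNReal.ofReal (1 / R) := by
        rw [← ofReal_norm]; exact ENNReal.ofReal_le_ofReal (h1 r ha)
      rw [Set.mem_Ico, not_and_or, not_le, not_lt] at hb
      rcases hb with hb | hb
      · rw [Set.indicator_of_mem (s := Set.Icc (R - |v|) (R + |v|))]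
        · exact le_add_right h3
        · constructor <;> linarith [ha.1]
      · rw [Set.indicator_of_mem (s := Set.Icc (2 * R - |v|) (2 * R + |v|))]
        · exact le_add_left h3
        · constructor <;> linarith [ha.2]
    · rw [Set.indicator_of_notMem ha, Set.indicator_of_mem hb, zero_sub, enorm_neg]
      refine le_add_left ?_
      have h3 : ‖φ (r - v)‖ₑ ≤ ENNReal.ofReal (1 / R) := by
        rw [← ofReal_norm]; exact ENNReal.ofReal_le_ofReal (h1 _ hb)
      rw [Set.mem_Ico, not_and_or, not_le, not_lt] at ha
      rcases ha with ha | ha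
      · rw [Set.indicator_of_mem (s := Set.Icc (R - |v|) (R + |v|))]
        · exact le_add_right h3
        · constructor <;> linarith [hb.1]
      · rw [Set.indicator_of_mem (s := Set.Icc (2 * R - |v|) (2 * R + |v|))]
        · exact le_add_left h3
        · constructor <;> linarith [hb.2]
    · simp [Set.indicator_of_notMem ha, Set.indicator_of_notMem hb]
  refine (lintegral_mono hpt).trans (le_of_eq ?_)
  rw [lintegral_add_left (measurable_const.indicator measurableSet_Ico),
    lintegral_add_left (measurable_const.indicator measurableSet_Icc),
    lintegral_indicator_const measurableSet_Ico, lintegral_indicator_const measurableSet_Icc,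
    lintegral_indicator_const measurableSet_Icc, Real.volume_Ico, Real.volume_Icc, Real.volume_Icc,
    ← ENNReal.ofReal_mul (by positivity), ← ENNReal.ofReal_mul (by positivity),
    ← ENNReal.ofReal_mul (by positivity),
    ← ENNReal.ofReal_add (mul_nonneg (by positivity) (by linarith [abs_nonneg v]))
      (mul_nonneg (by positivity) (by linarith [abs_nonneg v])),
    ← ENNReal.ofReal_add (mul_nonneg (by positivity) (by linarith)) (by
      have := abs_nonneg v
      have h3 : 0 ≤ 1 / R := by positivity
      nlinarith)]
  congr 1
  field_simp
  ring

/-- If averaging along `t • θ` kills `N`, only the oscillation of `h` contributes to the average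
of `N` along `θ`. -/
theorem enorm_lineAvg_le_of_lineAvg_eq_zero {ψ h : ℝ → ℂ} {N : E → ℂ} {θ : E} {t C : ℝ}
    (hψ : Integrable ψ) (hψ1 : ∫ u, ψ u = 1) (hh : Integrable h)
    (hN : Continuous N) (hC : ∀ x, ‖N x‖ ≤ C) (h0 : ∀ x, lineAvg ψ N (t • θ) x = 0) (x : E) :
    ‖lineAvg h N θ x‖ₑ ≤
      ∫⁻ u, ‖ψ u‖ₑ * ∫⁻ r, ‖h r - h (r - t * u)‖ₑ * ‖N (x - r • θ)‖ₑ := by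
  have hNi : ∀ {g : ℝ → ℂ}, Integrable g → Integrable fun r => g r * N (x - r • θ) := fun hg =>
    hg.mul_bdd (hN.comp (by fun_prop)).aestronglyMeasurable (Eventually.of_forall fun r => hC _)
  have hshift : ∀ u, ∫ r, h (r - t * u) * N (x - r • θ) = ∫ r, h r * N (x - r • θ - u • t • θ) := by
    intro u
    rw [← integral_sub_right_eq_self (fun r => h r * N (x - r • θ - u • t • θ)) (t * u)]
    refine integral_congr_ae (Eventually.of_forall fun r => ?_)
    simp only
    congr 2
    module
  have hz : ∫ u, ψ u * ∫ r, h (r - t * u) * N (x - r • θ) = 0 := by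
    have hprod : Integrable (fun p : ℝ × ℝ => ψ p.1 * (h p.2 * N (x - p.2 • θ - p.1 • t • θ)))
        (volume.prod volume) := by
      have := (hψ.mul_prod hh).mul_bdd (g := fun p : ℝ × ℝ => N (x - p.2 • θ - p.1 • t • θ))
        (hN.comp (by fun_prop)).aestronglyMeasurable (Eventually.of_forall fun r => hC _)
      simpa only [mul_assoc] using this
    simp only [hshift, ← integral_const_mul]
    rw [integral_integral_swap hprod]
    refine integral_eq_zero_of_ae (Eventually.of_forall fun r => ?_)
    have := h0 (x - r • θ)
    rw [lineAvg] at this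
    simp only [Pi.zero_apply]
    calc _ = ∫ u, h r * (ψ u * N (x - r • θ - u • t • θ)) := by
          congr 1; ext u; ring
      _ = 0 := by rw [integral_const_mul, this, mul_zero]
  have hint1 : Integrable fun u => ψ u * ∫ r, h r * N (x - r • θ) := hψ.mul_const _
  have hint2 : Integrable fun u => ψ u * ∫ r, h (r - t * u) * N (x - r • θ) := by
    simp only [hshift]
    have hprod : Integrable (fun p : ℝ × ℝ => ψ p.1 * (h p.2 * N (x - p.2 • θ - p.1 • t • θ)))
        (volume.prod volume) := by
      have := (hψ.mul_prod hh).mul_bdd (g := fun p : ℝ × ℝ => N (x - p.2 • θ - p.1 • t • θ))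
        (hN.comp (by fun_prop)).aestronglyMeasurable (Eventually.of_forall fun r => hC _)
      simpa only [mul_assoc] using this
    simpa only [integral_const_mul] using hprod.integral_prod_left
  have heq : lineAvg h N θ x = ∫ u, ψ u * ∫ r, (h r - h (r - t * u)) * N (x - r • θ) := by
    have h1 : ∀ u, ψ u * ∫ r, (h r - h (r - t * u)) * N (x - r • θ) =
        (ψ u * ∫ r, h r * N (x - r • θ)) - ψ u * ∫ r, h (r - t * u) * N (x - r • θ) := by
      intro u
      rw [← mul_sub, ← integral_sub (hNi hh) (hNi (hh.comp_sub_right _))]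
      simp only [sub_mul]
    simp only [h1]
    rw [integral_sub hint1 hint2, hz, integral_mul_const, hψ1, one_mul, sub_zero, lineAvg]
  rw [heq]
  refine (enorm_integral_le_lintegral_enorm _).trans (lintegral_mono fun u => ?_)
  rw [enorm_mul]
  gcongr
  refine (enorm_integral_le_lintegral_enorm _).trans (lintegral_mono fun r => ?_)
  rw [enorm_mul]

/-- A rough homogeneous kernel with a modulation, cut off to a dyadic shell. -/
def skern (j : ℤ) (f M : E → ℂ) : E → ℂ :=
  (shell E j).indicator fun w => f w * M w * (((‖w‖ ^ Module.finrank ℝ E)⁻¹ : ℝ) : ℂ)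

theorem measurable_skern (j : ℤ) {f M : E → ℂ} (hf : Measurable f) (hM : Measurable M) :
    Measurable (skern j f M) :=
  (by fun_prop : Measurable _).indicator (measurableSet_shell j)

theorem lintegral_skern_le [Nontrivial E] (j : ℤ) {f M : E → ℂ} (hf : Measurable f)
    (hom : ∀ r : ℝ, 0 < r → ∀ x : E, x ≠ 0 → f (r • x) = f x) (hM1 : ∀ w, ‖M w‖ ≤ 1) :
    ∫⁻ w, ‖skern j f M w‖ₑ ≤ ∫⁻ θ : sphere (0 : E) 1, ‖f θ‖ₑ ∂(volume : Measure E).toSphere := by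
  refine le_trans (lintegral_mono fun w => ?_) (lintegral_shell_le (f := fun w => ‖f w‖ₑ) hf.enorm
    (fun r hr x hx => by simp only [hom r hr x hx]) j)
  rw [skern, enorm_indicator_eq_indicator_enorm]
  refine Set.indicator_le_indicator ?_
  rw [enorm_mul, enorm_mul]
  have h1 : ‖M w‖ₑ ≤ 1 := by
    rw [← ofReal_norm]; exact ENNReal.ofReal_le_one.2 (hM1 w)
  have h2 : ‖((((‖w‖ ^ Module.finrank ℝ E)⁻¹ : ℝ)) : ℂ)‖ₑ =
      ENNReal.ofReal ((‖w‖ ^ Module.finrank ℝ E)⁻¹) := by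
    rw [← ofReal_norm, Complex.norm_real, Real.norm_of_nonneg (by positivity)]
  rw [h2]
  calc _ ≤ ‖f w‖ₑ * 1 * _ := by gcongr
    _ = _ := by rw [mul_one]

theorem integrable_skern [Nontrivial E] (j : ℤ) {f M : E → ℂ} (hf : Measurable f)
    (hM : Measurable M) (hom : ∀ r : ℝ, 0 < r → ∀ x : E, x ≠ 0 → f (r • x) = f x)
    (hM1 : ∀ w, ‖M w‖ ≤ 1)
    (hfi : ∫⁻ θ : sphere (0 : E) 1, ‖f θ‖ₑ ∂(volume : Measure E).toSphere < ∞) :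
    Integrable (skern j f M) :=
  ⟨(measurable_skern j hf hM).aestronglyMeasurable, (lintegral_skern_le j hf hom hM1).trans_lt hfi⟩

/-- The radial profile of `skern` in the direction `θ`. -/
def prof (j : ℤ) (M : E → ℂ) (θ : E) : ℝ → ℂ :=
  (Set.Ico ((2 : ℝ) ^ j) (2 * (2 : ℝ) ^ j)).indicator fun r => M (r • θ) * ((r⁻¹ : ℝ) : ℂ)

theorem measurable_prof (j : ℤ) {M : E → ℂ} (hM : Measurable M) :
    Measurable fun p : E × ℝ => prof j M p.1 p.2 := by
  have : (fun p : E × ℝ => prof j M p.1 p.2) =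
      (Prod.snd ⁻¹' Set.Ico ((2 : ℝ) ^ j) (2 * (2 : ℝ) ^ j)).indicator
        fun p : E × ℝ => M (p.2 • p.1) * ((p.2⁻¹ : ℝ) : ℂ) := by
    ext p
    simp only [prof, Set.indicator, Set.mem_preimage]
  rw [this]
  exact (by fun_prop : Measurable _).indicator (measurable_snd measurableSet_Ico)

theorem norm_prof_le {j : ℤ} {M : E → ℂ} (hM1 : ∀ w, ‖M w‖ ≤ 1) (θ : E) {r : ℝ}
    (hr : r ∈ Set.Ico ((2 : ℝ) ^ j) (2 * (2 : ℝ) ^ j)) :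
    ‖M (r • θ) * ((r⁻¹ : ℝ) : ℂ)‖ ≤ 1 / (2 : ℝ) ^ j := by
  have hR := two_zpow_pos j
  rw [norm_mul, Complex.norm_real, Real.norm_of_nonneg (inv_nonneg.2 (hR.le.trans hr.1)),
    one_div]
  calc _ ≤ 1 * r⁻¹ := mul_le_mul_of_nonneg_right (hM1 _) (inv_nonneg.2 (hR.le.trans hr.1))
    _ = r⁻¹ := one_mul _
    _ ≤ _ := inv_anti₀ hR hr.1

theorem integrable_prof (j : ℤ) {M : E → ℂ} (hM : Measurable M) (hM1 : ∀ w, ‖M w‖ ≤ 1) (θ : E) :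
    Integrable (prof j M θ) := by
  rw [prof, integrable_indicator_iff measurableSet_Ico]
  exact Measure.integrableOn_of_bounded (M := 1 / (2 : ℝ) ^ j) (by simp)
    (by fun_prop : Measurable fun r : ℝ => M (r • θ) * ((r⁻¹ : ℝ) : ℂ)).aestronglyMeasurable
    ((ae_restrict_iff' measurableSet_Ico).2 (Eventually.of_forall fun r hr => norm_prof_le hM1 θ hr))

theorem lintegral_prof_sub_le (j : ℤ) {M : E → ℂ} (hM1 : ∀ w, ‖M w‖ ≤ 1) {θ : E}
    (hML : ∀ r r' : ℝ, 0 < r → 0 < r' → ‖M (r • θ) - M (r' • θ)‖ ≤ |r - r'| / r) (v : ℝ) :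
    ∫⁻ r, ‖prof j M θ r - prof j M θ (r - v)‖ₑ ≤ ENNReal.ofReal (6 * |v| / 2 ^ j) := by
  have hR := two_zpow_pos j
  refine lintegral_indicator_sub_translate_le hR (fun r hr => norm_prof_le hM1 θ hr) ?_ v
  intro r hr r' hr'
  have hr0 : 0 < r := hR.trans_le hr.1
  have hr0' : 0 < r' := hR.trans_le hr'.1
  have h1 : M (r • θ) * ((r⁻¹ : ℝ) : ℂ) - M (r' • θ) * ((r'⁻¹ : ℝ) : ℂ) =
      (M (r • θ) - M (r' • θ)) * ((r⁻¹ : ℝ) : ℂ) + M (r' • θ) * ((r⁻¹ - r'⁻¹ : ℝ) : ℂ) := by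
    push_cast; ring
  rw [h1]
  refine (norm_add_le _ _).trans ?_
  rw [norm_mul, norm_mul, Complex.norm_real, Complex.norm_real, Real.norm_eq_abs, Real.norm_eq_abs,
    abs_of_pos (inv_pos.2 hr0)]
  have h2 : |r⁻¹ - r'⁻¹| ≤ |r - r'| / (2 ^ j) ^ 2 := by
    rw [inv_sub_inv hr0.ne' hr0'.ne', abs_div, abs_sub_comm r' r, abs_of_pos (mul_pos hr0 hr0'), sq]
    gcongr
    · exact hr.1
    · exact hr'.1
  have h3 : ‖M (r • θ) - M (r' • θ)‖ * r⁻¹ ≤ |r - r'| / (2 ^ j) ^ 2 := by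
    calc _ ≤ |r - r'| / r * r⁻¹ := by gcongr; exact hML r r' hr0 hr0'
      _ = |r - r'| / (r * r) := by field_simp
      _ ≤ _ := by
        rw [sq]
        have := hr.1
        gcongr
  have h4 : ‖M (r' • θ)‖ * |r⁻¹ - r'⁻¹| ≤ 1 * (|r - r'| / (2 ^ j) ^ 2) := by
    gcongr
    exact hM1 _
  calc _ ≤ |r - r'| / (2 ^ j) ^ 2 + 1 * (|r - r'| / (2 ^ j) ^ 2) := add_le_add h3 h4
    _ = _ := by ring

theorem cv_skern_eq [Nontrivial E] (j : ℤ) {f M : E → ℂ} (hf : Measurable f)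
    (hM : Measurable M) (hom : ∀ r : ℝ, 0 < r → ∀ x : E, x ≠ 0 → f (r • x) = f x)
    (hM1 : ∀ w, ‖M w‖ ≤ 1)
    (hfi : ∫⁻ θ : sphere (0 : E) 1, ‖f θ‖ₑ ∂(volume : Measure E).toSphere < ∞)
    {N : E → ℂ} (hN : Continuous N) (hNb : ∃ C, ∀ x, ‖N x‖ ≤ C) (x : E) :
    cv (skern j f M) N x = ∫ θ : sphere (0 : E) 1, f θ * lineAvg (prof j M θ) N θ x
      ∂(volume : Measure E).toSphere := by
  obtain ⟨C, hC⟩ := hNb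
  have h_integrable : Integrable fun y => skern j f M y * N (x - y) :=
    (integrable_skern j hf hM hom hM1 hfi).mul_bdd (c := C)
    (hN.comp (by fun_prop)).aestronglyMeasurable (Eventually.of_forall fun y => hC _)
  rw [cv_apply, integral_polar h_integrable]
  congr 1
  ext θ
  have hθ : ‖(θ : E)‖ = 1 := by simp
  have hθ0 : (θ : E) ≠ 0 := by intro h; simp [h] at hθ
  have hd : 0 < Module.finrank ℝ E := Module.finrank_pos
  rw [lineAvg, ← integral_const_mul]
  rw [← integral_indicator measurableSet_Ioi]
  congr 1
  ext r
  by_cases hr : 0 < r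
  · rw [Set.indicator_of_mem (by exact hr), skern, prof]
    by_cases hm : r ∈ Set.Ico ((2 : ℝ) ^ j) (2 * (2 : ℝ) ^ j)
    · rw [Set.indicator_of_mem hm, Set.indicator_of_mem, hom r hr _ hθ0, norm_smul, hθ, mul_one,
        Real.norm_of_nonneg hr.le, Complex.real_smul]
      · have : (r : ℂ) ≠ 0 := by exact_mod_cast hr.ne'
        obtain ⟨n, hn⟩ : ∃ n, Module.finrank ℝ E = n + 1 := ⟨_, (Nat.succ_pred_eq_of_pos hd).symm⟩
        rw [hn]
        push_cast
        field_simp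
        ring
      · rw [shell, Set.mem_ofPred_eq, norm_smul, hθ, mul_one, Real.norm_of_nonneg hr.le,
          zpow_add₀ two_ne_zero, zpow_one, mul_comm _ (2 : ℝ)]
        exact hm
    · rw [Set.indicator_of_notMem hm, Set.indicator_of_notMem]
      · simp
      · rw [shell, Set.mem_ofPred_eq, norm_smul, hθ, mul_one, Real.norm_of_nonneg hr.le,
          zpow_add₀ two_ne_zero, zpow_one, mul_comm _ (2 : ℝ)]
        exact hm
  · rw [Set.indicator_of_notMem (by exact hr), prof, Set.indicator_of_notMem]
    · simp
    · intro h
      exact hr ((two_zpow_pos j).trans_le h.1)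

set_option maxHeartbeats 1000000 in
theorem lintegral_cv_skern_nker_le [Nontrivial E] (j : ℤ) {f M : E → ℂ} (hf : Measurable f)
    (hM : Measurable M) (hom : ∀ r : ℝ, 0 < r → ∀ x : E, x ≠ 0 → f (r • x) = f x)
    (hM1 : ∀ w, ‖M w‖ ≤ 1)
    (hML : ∀ θ : E, ‖θ‖ = 1 → ∀ r r' : ℝ, 0 < r → 0 < r' →
      ‖M (r • θ) - M (r' • θ)‖ ≤ |r - r'| / r)
    (hfi : ∫⁻ θ : sphere (0 : E) 1, ‖f θ‖ₑ ∂(volume : Measure E).toSphere < ∞)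
    {m : ℕ} {k : ℤ} {e : E} (hfe : ∀ θ, ‖θ‖ = 1 → f θ ≠ 0 → ‖θ - e‖ ≤ (2 : ℝ) ^ (-(m : ℤ)) / 4) :
    ∫⁻ x, ‖cv (skern j f M) (nker k ((2 : ℝ) ^ ((m : ℤ) - k) • e)) x‖ₑ ≤
      ENNReal.ofReal (6 * 2 ^ ((m : ℤ) - k) / 2 ^ j) * (∫⁻ u : ℝ, ‖u‖ₑ * ‖psi2 u‖ₑ) * kerC E *
        ∫⁻ θ : sphere (0 : E) 1, ‖f θ‖ₑ ∂(volume : Measure E).toSphere := by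
  set t : ℝ := 2 ^ ((m : ℤ) - k) with ht
  have ht0 : 0 < t := two_zpow_pos _
  set N : E → ℂ := nker k (t • e) with hNdef
  have hNc : Continuous N := continuous_nker _ _
  obtain ⟨C, hC⟩ : ∃ C, ∀ x, ‖N x‖ ≤ C := bounded_nker _ _
  set σ := (volume : Measure E).toSphere with hσ
  have hpt : ∀ x, ‖cv (skern j f M) N x‖ₑ ≤ ∫⁻ θ : sphere (0 : E) 1, (∫⁻ u : ℝ, ∫⁻ r : ℝ,
      ‖f θ‖ₑ * ‖psi2 u‖ₑ * ‖prof j M θ r - prof j M θ (r - t * u)‖ₑ * ‖N (x - r • (θ : E))‖ₑ) ∂σ := by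
    intro x
    rw [cv_skern_eq j hf hM hom hM1 hfi hNc ⟨C, hC⟩ x]
    refine (enorm_integral_le_lintegral_enorm _).trans (lintegral_mono fun θ => ?_)
    by_cases h0 : f θ = 0
    · simp [h0]
    have hθ : ‖(θ : E)‖ = 1 := by simp
    rw [enorm_mul]
    have h1 := enorm_lineAvg_le_of_lineAvg_eq_zero integrable_psi2 integral_psi2
      (integrable_prof j hM hM1 (θ : E)) hNc hC (lineAvg_psi2_nker (hfe θ hθ h0)) x
    refine (mul_le_mul_right h1 _).trans (le_of_eq ?_)
    have hmp := measurable_prof j hM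
    have hmp' : Measurable fun r => prof j M (θ : E) r :=
      hmp.comp (by fun_prop : Measurable fun r : ℝ => ((θ : E), r))
    have hmN := hNc.measurable
    have hmψ := continuous_psi2.measurable
    have hm3 : Measurable fun p : ℝ × ℝ => ‖prof j M θ p.2 - prof j M θ (p.2 - t * p.1)‖ₑ *
        ‖N (x - p.2 • (θ : E))‖ₑ := by fun_prop
    have hm4 : Measurable fun u : ℝ => ∫⁻ r : ℝ, ‖prof j M θ r - prof j M θ (r - t * u)‖ₑ *
        ‖N (x - r • (θ : E))‖ₑ := hm3.lintegral_prod_right'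
    have hm5 : Measurable fun u : ℝ => ‖psi2 u‖ₑ * ∫⁻ r : ℝ,
        ‖prof j M θ r - prof j M θ (r - t * u)‖ₑ * ‖N (x - r • (θ : E))‖ₑ := hmψ.enorm.mul hm4
    rw [← lintegral_const_mul _ hm5]
    refine lintegral_congr fun u => ?_
    have hm6 : Measurable fun r : ℝ => ‖prof j M θ r - prof j M θ (r - t * u)‖ₑ *
        ‖N (x - r • (θ : E))‖ₑ := by fun_prop
    rw [← mul_assoc, ← lintegral_const_mul _ hm6]
    refine lintegral_congr fun r => ?_
    simp only [mul_assoc]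
  have hmp := measurable_prof j hM
  have hmN := hNc.measurable
  have hmψ := continuous_psi2.measurable
  let G : E → sphere (0 : E) 1 × (ℝ × ℝ) → ℝ≥0∞ := fun x p =>
    ‖f p.1‖ₑ * ‖psi2 p.2.1‖ₑ * ‖prof j M p.1 p.2.2 - prof j M p.1 (p.2.2 - t * p.2.1)‖ₑ *
      ‖N (x - p.2.2 • (p.1 : E))‖ₑ
  have hG : Measurable (Function.uncurry G) := by
    have h1 : Measurable fun q : E × (sphere (0 : E) 1 × (ℝ × ℝ)) => prof j M q.2.1 q.2.2.2 :=
      hmp.comp (by fun_prop : Measurable fun q : E × (sphere (0 : E) 1 × (ℝ × ℝ)) =>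
        (((q.2.1 : E)), q.2.2.2))
    have h2 : Measurable fun q : E × (sphere (0 : E) 1 × (ℝ × ℝ)) =>
        prof j M q.2.1 (q.2.2.2 - t * q.2.2.1) :=
      hmp.comp (by fun_prop : Measurable fun q : E × (sphere (0 : E) 1 × (ℝ × ℝ)) =>
        (((q.2.1 : E)), q.2.2.2 - t * q.2.2.1))
    have h3 : Measurable fun q : E × (sphere (0 : E) 1 × (ℝ × ℝ)) => N (q.1 - q.2.2.2 • (q.2.1 : E)) :=
      hmN.comp (by fun_prop)
    have h4 : Measurable fun q : E × (sphere (0 : E) 1 × (ℝ × ℝ)) => f (q.2.1 : E) :=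
      hf.comp (by fun_prop)
    exact ((h4.enorm.mul (hmψ.comp (by fun_prop)).enorm).mul (h1.sub h2).enorm).mul h3.enorm
  have hprod : ∀ H : sphere (0 : E) 1 × (ℝ × ℝ) → ℝ≥0∞, Measurable H →
      ∫⁻ θ, (∫⁻ u, ∫⁻ r, H (θ, (u, r))) ∂σ = ∫⁻ p, H p ∂(σ.prod (volume.prod volume)) := by
    intro H hH
    rw [lintegral_prod _ hH.aemeasurable]
    refine lintegral_congr fun θ => ?_
    have hH' : Measurable fun q : ℝ × ℝ => H (θ, q) := hH.comp (by fun_prop)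
    rw [lintegral_prod _ hH'.aemeasurable]
  calc _ ≤ ∫⁻ x, (∫⁻ p, G x p ∂(σ.prod (volume.prod volume))) := by
        refine lintegral_mono fun x => (hpt x).trans (le_of_eq ?_)
        exact hprod (G x) hG.of_uncurry_left
    _ = ∫⁻ p, (∫⁻ x, G x p) ∂(σ.prod (volume.prod volume)) :=
        lintegral_lintegral_swap hG.aemeasurable
    _ ≤ ∫⁻ p, ‖f p.1‖ₑ * ‖psi2 p.2.1‖ₑ *
          ‖prof j M p.1 p.2.2 - prof j M p.1 (p.2.2 - t * p.2.1)‖ₑ * kerC E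
          ∂(σ.prod (volume.prod volume)) := by
        refine lintegral_mono fun p => ?_
        have h1 : Measurable fun x => ‖N (x - p.2.2 • (p.1 : E))‖ₑ := by fun_prop
        simp only [G]
        rw [lintegral_const_mul _ h1]
        refine mul_le_mul_right ?_ _
        rw [lintegral_sub_right_eq_self (fun x => ‖N x‖ₑ)]
        exact lintegral_nker_le _ _
    _ = ∫⁻ θ : sphere (0 : E) 1, (∫⁻ u : ℝ, ∫⁻ r : ℝ, ‖f θ‖ₑ * ‖psi2 u‖ₑ *
          ‖prof j M θ r - prof j M θ (r - t * u)‖ₑ * kerC E) ∂σ := by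
        rw [← hprod]
        have h1 : Measurable fun q : (sphere (0 : E) 1 × (ℝ × ℝ)) => prof j M q.1 q.2.2 :=
          hmp.comp (by fun_prop : Measurable fun q : (sphere (0 : E) 1 × (ℝ × ℝ)) =>
            (((q.1 : E)), q.2.2))
        have h2 : Measurable fun q : (sphere (0 : E) 1 × (ℝ × ℝ)) =>
            prof j M q.1 (q.2.2 - t * q.2.1) :=
          hmp.comp (by fun_prop : Measurable fun q : (sphere (0 : E) 1 × (ℝ × ℝ)) =>
            (((q.1 : E)), q.2.2 - t * q.2.1))
        have h4 : Measurable fun q : (sphere (0 : E) 1 × (ℝ × ℝ)) => f (q.1 : E) :=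
          hf.comp (by fun_prop)
        exact ((h4.enorm.mul (hmψ.comp (by fun_prop)).enorm).mul (h1.sub h2).enorm).mul_const _
    _ ≤ ∫⁻ θ : sphere (0 : E) 1, (∫⁻ u : ℝ, ‖f θ‖ₑ *
          ((‖u‖ₑ * ‖psi2 u‖ₑ) * (ENNReal.ofReal (6 * t / 2 ^ j) * kerC E))) ∂σ := by
        refine lintegral_mono fun θ => lintegral_mono fun u => ?_
        have hθ : ‖(θ : E)‖ = 1 := by simp
        have hmp' : Measurable fun r => prof j M (θ : E) r :=
          hmp.comp (by fun_prop : Measurable fun r : ℝ => ((θ : E), r))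
        have h1 : Measurable fun r => ‖f θ‖ₑ * ‖psi2 u‖ₑ *
          ‖prof j M θ r - prof j M θ (r - t * u)‖ₑ := by fun_prop
        have h2 : Measurable fun r =>
          ‖prof j M θ r - prof j M θ (r - t * u)‖ₑ := by fun_prop
        rw [lintegral_mul_const _ h1, lintegral_const_mul _ h2]
        have h3 := lintegral_prof_sub_le j hM1 (hML θ hθ) (t * u)
        have h4 : ENNReal.ofReal (6 * |t * u| / 2 ^ j) = ‖u‖ₑ * ENNReal.ofReal (6 * t / 2 ^ j) := by
          rw [← ofReal_norm, Real.norm_eq_abs, ← ENNReal.ofReal_mul (abs_nonneg _), abs_mul,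
            abs_of_pos ht0]
          congr 1
          ring
        rw [h4] at h3
        calc _ ≤ ‖f θ‖ₑ * ‖psi2 u‖ₑ * (‖u‖ₑ * ENNReal.ofReal (6 * t / 2 ^ j)) * kerC E := by
              gcongr
          _ = _ := by ring
    _ = _ := by
        have h1 : Measurable fun u : ℝ => ‖u‖ₑ * ‖psi2 u‖ₑ := by fun_prop
        have h2 : Measurable fun u : ℝ => ‖u‖ₑ * ‖psi2 u‖ₑ *
          (ENNReal.ofReal (6 * t / 2 ^ j) * kerC E) := by fun_prop
        have h3 : Measurable fun θ : sphere (0 : E) 1 => ‖f θ‖ₑ :=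
          (hf.comp measurable_subtype_coe).enorm
        simp only [lintegral_const_mul _ h2, lintegral_mul_const _ h1]
        rw [lintegral_mul_const _ h3]
        ring

end Radial

section Single
open scoped FourierTransform

variable {E : Type*} [NormedAddCommGroup E] [InnerProductSpace ℝ E] [FiniteDimensional ℝ E]
  [MeasurableSpace E] [BorelSpace E]

theorem continuous_cv {f g : E → ℂ} (hf : Integrable f) (hg : Continuous g)
    (hgb : ∃ C, ∀ x, ‖g x‖ ≤ C) : Continuous (cv f g) := by
  obtain ⟨C, hC⟩ := hgb
  exact BddAbove.continuous_convolution_right_of_integrable _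
    ⟨C, by rintro _ ⟨x, rfl⟩; exact hC x⟩ hf hg

theorem integrable_mul_comp_sub {K g : E → ℂ} (hK : Continuous K) (hKb : ∃ C, ∀ x, ‖K x‖ ≤ C)
    (hg : Integrable g) (x : E) : Integrable fun t => K t * g (x - t) := by
  obtain ⟨C, hC⟩ := hKb
  exact (hg.comp_sub_left x).bdd_mul hK.aestronglyMeasurable (Eventually.of_forall hC)

theorem bounded_cv {f g : E → ℂ} (hf : Integrable f) (hgb : ∃ C, ∀ x, ‖g x‖ ≤ C) :
    ∃ C, ∀ x, ‖cv f g x‖ ≤ C := by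
  obtain ⟨C, hC⟩ := hgb
  refine ⟨∫ t, ‖f t‖ * C, fun x => (norm_integral_le_of_norm_le (hf.norm.mul_const C)
    (Eventually.of_forall fun t => ?_))⟩
  exact (norm_mul_le _ _).trans (mul_le_mul_of_nonneg_left (hC _) (norm_nonneg _))

theorem eq_of_fourier_eq {f g : E → ℂ} (hf : Integrable f) (hg : Integrable g)
    (hfc : Continuous f) (hgc : Continuous g) (h : ∀ ξ, 𝓕 f ξ = 𝓕 g ξ) : f = g := by
  ext x
  refine sub_eq_zero.1 (eq_zero_of_fourier_eq_zero (hf.sub hg) (hfc.sub hgc) ?_ x)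
  ext ξ
  have h1 := h ξ
  rw [Real.fourier_eq, Real.fourier_eq] at h1
  rw [Real.fourier_eq]
  simp only [Pi.sub_apply, smul_sub, Pi.zero_apply]
  rw [integral_sub ((Real.fourierIntegral_convergent_iff ξ).2 hf)
    ((Real.fourierIntegral_convergent_iff ξ).2 hg), h1, sub_self]

theorem cv_left_comm {K H b : E → ℂ} (hK : Integrable K) (hH : Integrable H) (hb : Integrable b)
    (hbc : Continuous b) (hbb : ∃ C, ∀ x, ‖b x‖ ≤ C) : cv K (cv H b) = cv H (cv K b) := by
  refine eq_of_fourier_eq (integrable_cv hK (integrable_cv hH hb))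
    (integrable_cv hH (integrable_cv hK hb)) (continuous_cv hK (continuous_cv hH hbc hbb)
      (bounded_cv hH hbb)) (continuous_cv hH (continuous_cv hK hbc hbb) (bounded_cv hK hbb)) ?_
  intro ξ
  rw [fourier_cv hK (integrable_cv hH hb), fourier_cv hH hb, fourier_cv hH (integrable_cv hK hb),
    fourier_cv hK hb]
  ring

theorem cv_cv_eq {K H b : E → ℂ} (hK : Integrable K) (hH : Integrable H) (hb : Integrable b)
    (hbc : Continuous b) (hbb : ∃ C, ∀ x, ‖b x‖ ≤ C) : cv K (cv H b) = cv (cv H K) b := by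
  refine eq_of_fourier_eq (integrable_cv hK (integrable_cv hH hb))
    (integrable_cv (integrable_cv hH hK) hb) (continuous_cv hK (continuous_cv hH hbc hbb)
      (bounded_cv hH hbb)) (continuous_cv (integrable_cv hH hK) hbc hbb) ?_
  intro ξ
  rw [fourier_cv hK (integrable_cv hH hb), fourier_cv hH hb, fourier_cv (integrable_cv hH hK) hb,
    fourier_cv hH hK]
  ring

/-- A bounded increasing function whose increments dominate `2 ^ (-|z|)`. -/
def expSum (z : ℤ) : ℝ := if z ≤ 0 then 2 * 2 ^ z else 4 - 2 * 2 ^ (-z)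

theorem expSum_nonneg (z : ℤ) : 0 ≤ expSum z := by
  rw [expSum]
  split_ifs with h
  · positivity
  · have : (2 : ℝ) ^ (-z) ≤ 1 := zpow_le_one_of_nonpos₀ (by norm_num) (by omega)
    linarith

theorem expSum_le (z : ℤ) : expSum z ≤ 4 := by
  rw [expSum]
  split_ifs with h
  · have : (2 : ℝ) ^ z ≤ 1 := zpow_le_one_of_nonpos₀ (by norm_num) h
    linarith
  · have : (0 : ℝ) < (2 : ℝ) ^ (-z) := by positivity
    linarith

theorem le_expSum_sub (z : ℤ) : (2 : ℝ) ^ (-|z|) ≤ expSum (z + 1) - expSum z := by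
  rw [expSum, expSum]
  rcases lt_trichotomy z 0 with h | h | h
  · rw [if_pos (by omega), if_pos (by omega), abs_of_neg h, neg_neg,
      zpow_add₀ two_ne_zero, zpow_one]
    have : (0 : ℝ) < (2 : ℝ) ^ z := by positivity
    linarith
  · subst h
    norm_num
  · rw [if_neg (by omega), if_neg (by omega), abs_of_pos h, neg_add, zpow_add₀ two_ne_zero]
    norm_num
    have : (0 : ℝ) < ((2 : ℝ) ^ z)⁻¹ := by positivity
    linarith

theorem sum_two_zpow_neg_abs_le (z : ℤ) (n : ℕ) :
    ∑ i ∈ Finset.range n, (2 : ℝ) ^ (-|z + i|) ≤ 4 := by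
  have := Finset.sum_range_sub (fun i : ℕ => expSum (z + i)) n
  calc _ ≤ ∑ i ∈ Finset.range n, (expSum (z + ((i + 1 : ℕ) : ℤ)) - expSum (z + i)) := by
        refine Finset.sum_le_sum fun i _ => ?_
        have h := le_expSum_sub (z + i)
        rwa [show z + ((i + 1 : ℕ) : ℤ) = z + i + 1 by push_cast; ring]
    _ ≤ 4 := by
        rw [this]
        linarith [expSum_le (z + n), expSum_nonneg (z + (0 : ℕ))]

/-- The constant in `lintegral_sub_cv_pksum_le`. -/
def singC (E : Type*) [NormedAddCommGroup E] [InnerProductSpace ℝ E] [FiniteDimensional ℝ E]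
    [MeasurableSpace E] [BorelSpace E] : ℝ≥0∞ :=
  1 + kerC E + (kerC E + 6 * (∫⁻ u : ℝ, ‖u‖ₑ * ‖psi2 u‖ₑ) * kerC E) * 4

theorem singC_lt_top : singC E < ∞ := by
  rw [singC]
  have h1 := kerC_lt_top (E := E)
  have h2 := lintegral_norm_mul_psi2
  refine ENNReal.add_lt_top.2 ⟨ENNReal.add_lt_top.2 ⟨by simp, h1⟩, ENNReal.mul_lt_top
    (ENNReal.add_lt_top.2 ⟨h1, ENNReal.mul_lt_top (ENNReal.mul_lt_top (by simp) h2) h1⟩) (by simp)⟩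

theorem lintegral_sub_cv_pksum_le [Nontrivial E] {i : ℤ} {s m : ℕ} (hms : 3 * m ≤ s) {f M b : E → ℂ}
    (hf : Measurable f) (hM : Measurable M)
    (hom : ∀ r : ℝ, 0 < r → ∀ x : E, x ≠ 0 → f (r • x) = f x) (hM1 : ∀ w, ‖M w‖ ≤ 1)
    (hML : ∀ θ : E, ‖θ‖ = 1 → ∀ r r' : ℝ, 0 < r → 0 < r' →
      ‖M (r • θ) - M (r' • θ)‖ ≤ |r - r'| / r)
    (hfi : ∫⁻ θ : sphere (0 : E) 1, ‖f θ‖ₑ ∂(volume : Measure E).toSphere < ∞)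
    {e : E} (hfe : ∀ θ, ‖θ‖ = 1 → f θ ≠ 0 → ‖θ - e‖ ≤ (2 : ℝ) ^ (-(m : ℤ)) / 4)
    (hb : Integrable b) (hbc : Continuous b) (hbb : ∃ C, ∀ x, ‖b x‖ ≤ C) {c : E}
    (hsupp : ∀ x, (2 : ℝ) ^ i < ‖x - c‖ → b x = 0) (h0 : ∫ x, b x = 0) {a : ℤ} {n : ℕ}
    (ha : a ≤ -i - m)
    (hn : ∫⁻ x, ‖b x - cv (Phi ((2 : ℝ) ^ (a + n))) b x‖ₑ ≤
      ENNReal.ofReal ((2 : ℝ) ^ (-(m : ℤ))) * ∫⁻ x, ‖b x‖ₑ) :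
    ∫⁻ x, ‖cv (skern (i + s) f M) b x - cv (pksum m a n e) (cv (skern (i + s) f M) b) x‖ₑ ≤
      singC E * ENNReal.ofReal ((2 : ℝ) ^ (-(m : ℤ))) *
        (∫⁻ θ : sphere (0 : E) 1, ‖f θ‖ₑ ∂(volume : Measure E).toSphere) * ∫⁻ x, ‖b x‖ₑ := by
  set H := skern (i + s) f M with hHdef
  have hH : Integrable H := integrable_skern _ hf hM hom hM1 hfi
  set Λ := ∫⁻ θ : sphere (0 : E) 1, ‖f θ‖ₑ ∂(volume : Measure E).toSphere with hΛ
  have hHΛ : ∫⁻ w, ‖H w‖ₑ ≤ Λ := lintegral_skern_le _ hf hom hM1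
  set β := ∫⁻ x, ‖b x‖ₑ with hβ
  set g := cv H b with hg
  have hgi : Integrable g := integrable_cv hH hb
  set δ := ENNReal.ofReal ((2 : ℝ) ^ (-(m : ℤ))) with hδ
  let Nk : ℕ → E → ℂ := fun l => nker (a + 1 + l) ((2 : ℝ) ^ ((m : ℤ) - (a + 1 + l)) • e)
  have hdec : ∀ x, g x - cv (pksum m a n e) g x = (g x - cv (Phi ((2 : ℝ) ^ (a + n))) g x) +
      (cv (Phi ((2 : ℝ) ^ a)) g x + ∑ l ∈ Finset.range n, cv (Nk l) g x) := by
    intro x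
    have hI1 := integrable_mul_comp_sub (continuous_Phi ((2 : ℝ) ^ (a + n))) (bounded_Phi _) hgi x
    have hI2 := integrable_mul_comp_sub (continuous_Phi ((2 : ℝ) ^ a)) (bounded_Phi _) hgi x
    have hI3 := integrable_mul_comp_sub (continuous_pksum m a n e) (bounded_pksum _ _ _ _) hgi x
    have h1 : ∑ l ∈ Finset.range n, cv (Nk l) g x = cv (Phi ((2 : ℝ) ^ (a + n))) g x -
        cv (Phi ((2 : ℝ) ^ a)) g x - cv (pksum m a n e) g x := by
      simp only [cv_apply]
      rw [← integral_finsetSum _ fun l _ => integrable_mul_comp_sub (continuous_nker _ _)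
        (bounded_nker _ _) hgi x, ← integral_sub hI1 hI2,
        ← integral_sub (f := fun t => Phi ((2 : ℝ) ^ (a + n)) t * g (x - t) -
          Phi ((2 : ℝ) ^ a) t * g (x - t)) (hI1.sub hI2) hI3]
      refine integral_congr_ae (Eventually.of_forall fun t => ?_)
      simp only
      rw [← Finset.sum_mul, ← sub_mul, ← sub_mul, ← sum_lam, pksum, ← Finset.sum_sub_distrib]
      rfl
    rw [h1]
    ring
  have hT1 : ∫⁻ x, ‖g x - cv (Phi ((2 : ℝ) ^ (a + n))) g x‖ₑ ≤ δ * Λ * β := by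
    have hPi : Integrable (Phi ((2 : ℝ) ^ (a + n)) : E → ℂ) := integrable_Phi (two_zpow_pos _)
    have h1 : ∀ x, g x - cv (Phi ((2 : ℝ) ^ (a + n))) g x =
        cv H (fun y => b y - cv (Phi ((2 : ℝ) ^ (a + n))) b y) x := by
      intro x
      rw [hg, cv_left_comm hPi hH hb hbc hbb, cv_apply, cv_apply,
        cv_apply, ← integral_sub]
      · refine integral_congr_ae (Eventually.of_forall fun t => ?_)
        simp only [mul_sub]
      · obtain ⟨C, hC⟩ := hbb
        exact hH.mul_bdd (c := C) (by fun_prop) (Eventually.of_forall fun u => hC _)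
      · obtain ⟨C, hC⟩ := bounded_cv hPi hbb
        have hcc := continuous_cv hPi hbc hbb
        exact hH.mul_bdd (c := C) (by fun_prop) (Eventually.of_forall fun u => hC _)
    simp only [h1]
    refine (lintegral_cv_le hH.aestronglyMeasurable
      (hb.sub (integrable_cv hPi hb)).aestronglyMeasurable).trans ?_
    calc _ ≤ Λ * (δ * β) := mul_le_mul' hHΛ hn
      _ = _ := by ring
  have hcancel : ∀ {K : E → ℂ} {k : ℤ}, Integrable K → Continuous K → (∃ C, ∀ x, ‖K x‖ ≤ C) →
      (∀ v, ∫⁻ x, ‖K (x - v) - K x‖ₑ ≤ ENNReal.ofReal ((2 : ℝ) ^ k) * ‖v‖ₑ * kerC E) →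
      ∫⁻ x, ‖cv K g x‖ₑ ≤ ENNReal.ofReal ((2 : ℝ) ^ (k + i)) * kerC E * Λ * β := by
    intro K k hK hKc hKb hKt
    rw [hg, cv_left_comm hK hH hb hbc hbb]
    refine (lintegral_cv_le hH.aestronglyMeasurable
      (integrable_cv hK hb).aestronglyMeasurable).trans ?_
    have h2 := lintegral_cv_cancel_le hKc hKb hb hbc.measurable hsupp h0
      (D := ENNReal.ofReal ((2 : ℝ) ^ (k + i)) * kerC E) (fun v hv => (hKt v).trans (by
        gcongr
        rw [← ofReal_norm, ← ENNReal.ofReal_mul (by positivity), zpow_add₀ two_ne_zero]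
        gcongr))
    calc _ ≤ Λ * (ENNReal.ofReal ((2 : ℝ) ^ (k + i)) * kerC E * β) := mul_le_mul' hHΛ h2
      _ = _ := by ring
  have hmono : ∀ {z w : ℤ}, z ≤ w →
      ENNReal.ofReal ((2 : ℝ) ^ z) ≤ ENNReal.ofReal ((2 : ℝ) ^ w) := fun h =>
    ENNReal.ofReal_le_ofReal (zpow_le_zpow_right₀ (by norm_num) h)
  have hT2 : ∫⁻ x, ‖cv (Phi ((2 : ℝ) ^ a)) g x‖ₑ ≤ δ * kerC E * Λ * β := by
    refine (hcancel (integrable_Phi (two_zpow_pos _)) (continuous_Phi _) (bounded_Phi _)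
      (fun v => lintegral_Phi_translate_le (two_zpow_pos a) v)).trans ?_
    gcongr
    exact hmono (by omega)
  set D := kerC E + 6 * (∫⁻ u : ℝ, ‖u‖ₑ * ‖psi2 u‖ₑ) * kerC E with hD
  have hT3 : ∀ l : ℕ, ∫⁻ x, ‖cv (Nk l) g x‖ₑ ≤
      ENNReal.ofReal ((2 : ℝ) ^ (-|(a + 1 + i + s - 2 * m) + (l : ℤ)|)) * (D * δ * Λ * β) := by
    intro l
    have hNi : Integrable (Nk l) := integrable_nker _ _
    have hmul : ∀ z w : ℤ, ENNReal.ofReal ((2 : ℝ) ^ z) * ENNReal.ofReal ((2 : ℝ) ^ w) =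
        ENNReal.ofReal ((2 : ℝ) ^ (z + w)) := by
      intro z w
      rw [← ENNReal.ofReal_mul (by positivity), zpow_add₀ two_ne_zero]
    rcases le_or_gt ((a + 1 + i + s - 2 * m) + (l : ℤ)) 0 with hle | hgt
    · refine (hcancel (k := a + 1 + l) hNi (continuous_nker _ _) (bounded_nker _ _)
        (fun v => lintegral_nker_translate_le _ _ v)).trans ?_
      calc _ ≤ (ENNReal.ofReal ((2 : ℝ) ^ (-|(a + 1 + i + s - 2 * m) + (l : ℤ)|)) * δ) * D * Λ * β := by
            rw [hδ, hmul]
            refine mul_le_mul_left (mul_le_mul_left (mul_le_mul' (hmono ?_) le_self_add) _) _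
            rw [abs_of_nonpos hle]; omega
        _ = _ := by ring
    · rw [hg, cv_cv_eq hNi hH hb hbc hbb]
      refine (lintegral_cv_le (integrable_cv hH hNi).aestronglyMeasurable
        hb.aestronglyMeasurable).trans ?_
      have h1 := lintegral_cv_skern_nker_le (i + s) hf hM hom hM1 hML hfi (m := m)
        (k := a + 1 + l) hfe
      have h2 : ENNReal.ofReal (6 * (2 : ℝ) ^ ((m : ℤ) - (a + 1 + l)) / 2 ^ (i + (s : ℤ))) =
          6 * (ENNReal.ofReal ((2 : ℝ) ^ (-|(a + 1 + i + s - 2 * m) + (l : ℤ)|)) * δ) := by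
        rw [hδ, hmul, abs_of_pos hgt, mul_div_assoc, ENNReal.ofReal_mul (by norm_num),
          ← zpow_sub₀ two_ne_zero]
        congr 1
        · norm_num
        · congr 2; ring
      rw [h2] at h1
      calc _ ≤ _ := mul_le_mul_left h1 β
        _ = (ENNReal.ofReal ((2 : ℝ) ^ (-|(a + 1 + i + s - 2 * m) + (l : ℤ)|)) * δ) *
            (6 * (∫⁻ u : ℝ, ‖u‖ₑ * ‖psi2 u‖ₑ) * kerC E) * Λ * β := by ring
        _ ≤ (ENNReal.ofReal ((2 : ℝ) ^ (-|(a + 1 + i + s - 2 * m) + (l : ℤ)|)) * δ) *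
            D * Λ * β := by gcongr; rw [hD]; exact le_add_self
        _ = _ := by ring
  have hgc : Continuous g := continuous_cv hH hbc hbb
  have hgb := bounded_cv hH hbb
  have hm1 : Measurable fun x => ‖g x - cv (Phi ((2 : ℝ) ^ (a + n))) g x‖ₑ :=
    (hgc.sub (continuous_cv (integrable_Phi (two_zpow_pos _)) hgc hgb)).measurable.enorm
  have hm2 : Measurable fun x => ‖cv (Phi ((2 : ℝ) ^ a)) g x‖ₑ :=
    (continuous_cv (integrable_Phi (two_zpow_pos _)) hgc hgb).measurable.enorm
  have hm3 : ∀ l, Measurable fun x => ‖cv (Nk l) g x‖ₑ := fun l =>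
    (continuous_cv (integrable_nker _ _) hgc hgb).measurable.enorm
  calc _ ≤ ∫⁻ x, (‖g x - cv (Phi ((2 : ℝ) ^ (a + n))) g x‖ₑ + (‖cv (Phi ((2 : ℝ) ^ a)) g x‖ₑ +
        ∑ l ∈ Finset.range n, ‖cv (Nk l) g x‖ₑ)) := by
        refine lintegral_mono fun x => ?_
        simp only
        rw [hdec]
        refine (enorm_add_le _ _).trans (add_le_add le_rfl ((enorm_add_le _ _).trans
          (add_le_add le_rfl (enorm_sum_le _ _))))
    _ = (∫⁻ x, ‖g x - cv (Phi ((2 : ℝ) ^ (a + n))) g x‖ₑ) + ((∫⁻ x, ‖cv (Phi ((2 : ℝ) ^ a)) g x‖ₑ) +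
        ∑ l ∈ Finset.range n, ∫⁻ x, ‖cv (Nk l) g x‖ₑ) := by
        rw [lintegral_add_left hm1, lintegral_add_left hm2,
          lintegral_finsetSum _ fun l _ => hm3 l]
    _ ≤ δ * Λ * β + (δ * kerC E * Λ * β + 4 * (D * δ * Λ * β)) := by
        refine add_le_add hT1 (add_le_add hT2 ?_)
        refine (Finset.sum_le_sum fun l _ => hT3 l).trans ?_
        rw [← Finset.sum_mul, ← ENNReal.ofReal_sum_of_nonneg fun _ _ => by positivity]
        gcongr
        refine (ENNReal.ofReal_le_ofReal (sum_two_zpow_neg_abs_le _ _)).trans (by norm_num)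
    _ = _ := by
        rw [singC, ← hD]
        ring

end Single

section Core
open scoped FourierTransform

variable {E : Type*} [NormedAddCommGroup E] [InnerProductSpace ℝ E] [FiniteDimensional ℝ E]
  [MeasurableSpace E] [BorelSpace E]

/-- The cone of directions close to `e`. -/
def cone (m : ℕ) (e : E) : Set E := {w | ‖‖w‖⁻¹ • w - e‖ ≤ ((2 : ℝ) ^ m)⁻¹ / 4}

theorem measurableSet_cone (m : ℕ) (e : E) : MeasurableSet (cone m e) :=
  measurableSet_le (by fun_prop) measurable_const

theorem smul_mem_cone_iff {m : ℕ} {e w : E} {r : ℝ} (hr : 0 < r) :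
    r • w ∈ cone m e ↔ w ∈ cone m e := by
  simp only [cone, Set.mem_ofPred_eq, norm_smul, Real.norm_of_nonneg hr.le, smul_smul]
  rw [show (r * ‖w‖)⁻¹ * r = ‖w‖⁻¹ by field_simp]

theorem norm_sub_le_of_mem_cone {m : ℕ} {e w : E} (hw : w ∈ cone m e) :
    ‖w - ‖w‖ • e‖ ≤ ‖w‖ * (((2 : ℝ) ^ m)⁻¹ / 4) := by
  rcases eq_or_ne w 0 with rfl | h
  · simp
  · have h1 : w - ‖w‖ • e = ‖w‖ • (‖w‖⁻¹ • w - e) := by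
      rw [smul_sub, smul_smul, mul_inv_cancel₀ (norm_ne_zero_iff.2 h), one_smul]
    rw [h1, norm_smul, norm_norm]
    exact mul_le_mul_of_nonneg_left hw (norm_nonneg _)

open Classical in
/-- A partition of unity subordinate to the cones around the points of `S`. -/
def coneW (m : ℕ) (S : Finset E) (e w : E) : ℝ :=
  (cone m e).indicator 1 w / ∑ e' ∈ S, (cone m e').indicator (1 : E → ℝ) w

theorem measurable_coneW (m : ℕ) (S : Finset E) (e : E) : Measurable (coneW m S e) :=
  (measurable_one.indicator (measurableSet_cone m e)).div
    (Finset.measurable_fun_sum _ fun e' _ => measurable_one.indicator (measurableSet_cone m e'))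

theorem coneW_nonneg (m : ℕ) (S : Finset E) (e w : E) : 0 ≤ coneW m S e w :=
  div_nonneg (Set.indicator_nonneg (fun _ _ => zero_le_one) _)
    (Finset.sum_nonneg fun _ _ => Set.indicator_nonneg (fun _ _ => zero_le_one) _)

theorem coneW_le_one (m : ℕ) {S : Finset E} {e : E} (he : e ∈ S) (w : E) : coneW m S e w ≤ 1 :=
  div_le_one_of_le₀ (Finset.single_le_sum (f := fun e' => (cone m e').indicator (1 : E → ℝ) w)
    (fun _ _ => Set.indicator_nonneg (fun _ _ => zero_le_one) _) he)
    (Finset.sum_nonneg fun _ _ => Set.indicator_nonneg (fun _ _ => zero_le_one) _)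

theorem mem_cone_of_coneW_ne_zero {m : ℕ} {S : Finset E} {e w : E} (h : coneW m S e w ≠ 0) :
    w ∈ cone m e := by
  by_contra hw
  exact h (by rw [coneW, Set.indicator_of_notMem hw, zero_div])

theorem coneW_smul (m : ℕ) (S : Finset E) (e : E) {r : ℝ} (hr : 0 < r) (w : E) :
    coneW m S e (r • w) = coneW m S e w := by
  have h : ∀ e' : E, (cone m e').indicator (1 : E → ℝ) (r • w) = (cone m e').indicator 1 w := by
    intro e'
    by_cases hw : w ∈ cone m e'
    · rw [Set.indicator_of_mem hw, Set.indicator_of_mem ((smul_mem_cone_iff hr).2 hw)]; rfl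
    · rw [Set.indicator_of_notMem hw, Set.indicator_of_notMem fun h => hw ((smul_mem_cone_iff hr).1 h)]
  simp only [coneW, h]

theorem sum_coneW {m : ℕ} {S : Finset E}
    (hS : ∀ θ : E, ‖θ‖ = 1 → ∃ e ∈ S, ‖θ - e‖ ≤ ((2 : ℝ) ^ m)⁻¹ / 4) {w : E} (hw : w ≠ 0) :
    ∑ e ∈ S, coneW m S e w = 1 := by
  simp only [coneW]
  rw [← Finset.sum_div, div_self]
  obtain ⟨e, he, h⟩ := hS (‖w‖⁻¹ • w) (by
    rw [norm_smul, norm_inv, norm_norm, inv_mul_cancel₀ (norm_ne_zero_iff.2 hw)])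
  refine ne_of_gt (Finset.sum_pos' (fun _ _ => Set.indicator_nonneg (fun _ _ => zero_le_one) _)
    ⟨e, he, ?_⟩)
  rw [Set.indicator_of_mem (show w ∈ cone m e from h)]
  exact one_pos

theorem norm_eq_one_inv_smul {w : E} (hw : ‖w‖ = 1) : ‖w‖⁻¹ • w = w := by simp [hw]

theorem ne_zero_of_mem_shell {j : ℤ} {w : E} (hw : w ∈ shell E j) : w ≠ 0 := by
  rintro rfl
  have := hw.1
  rw [norm_zero] at this
  exact absurd (two_zpow_pos j) (not_lt.2 this)

theorem hasCompactSupport_skern (j : ℤ) (f M : E → ℂ) : HasCompactSupport (skern j f M) := by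
  refine HasCompactSupport.of_support_subset_isCompact (isCompact_closedBall 0 ((2 : ℝ) ^ (j + 1)))
    fun w hw => ?_
  have h : w ∈ shell E j := by
    by_contra h
    exact hw (Set.indicator_of_notMem h _)
  rw [mem_closedBall_zero_iff]
  exact h.2.le

theorem enorm_cv_skern_le {j : ℤ} {f M b : E → ℂ} {B : ℝ} (hB : ∀ w, ‖f w‖ ≤ B)
    (hM1 : ∀ w, ‖M w‖ ≤ 1) {V : Set E} (hV : ∀ w, f w ≠ 0 → w ∈ V) (x : E) :
    ‖cv (skern j f M) b x‖ₑ ≤ ENNReal.ofReal B * avgOn j (V ∩ shell E j) (fun y => ‖b y‖ₑ) x := by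
  have h1 : ∀ w, ‖skern j f M w‖ₑ ≤
      (V ∩ shell E j).indicator 1 w * (ENNReal.ofReal B * (vsc E j)⁻¹) := by
    intro w
    by_cases hw : w ∈ V ∩ shell E j
    · rw [Set.indicator_of_mem hw, Pi.one_apply, one_mul, skern, Set.indicator_of_mem hw.2,
        enorm_mul, enorm_mul]
      have hj := (two_zpow_pos j)
      have h2 : ‖((((‖w‖ ^ Module.finrank ℝ E)⁻¹ : ℝ)) : ℂ)‖ₑ ≤ (vsc E j)⁻¹ := by
        rw [← ofReal_norm, Complex.norm_real, Real.norm_of_nonneg (by positivity), vsc,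
          ← ENNReal.ofReal_inv_of_pos (by positivity)]
        refine ENNReal.ofReal_le_ofReal (inv_anti₀ (by positivity) ?_)
        exact pow_le_pow_left₀ hj.le hw.2.1 _
      have h3 : ‖f w‖ₑ ≤ ENNReal.ofReal B := by
        rw [← ofReal_norm]; exact ENNReal.ofReal_le_ofReal (hB w)
      have h4 : ‖M w‖ₑ ≤ 1 := by
        rw [← ofReal_norm]; exact ENNReal.ofReal_le_one.2 (hM1 w)
      calc _ ≤ ENNReal.ofReal B * 1 * (vsc E j)⁻¹ := by gcongr
        _ = _ := by rw [mul_one]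
    · have : skern j f M w = 0 := by
        rw [skern]
        by_cases hs : w ∈ shell E j
        · rw [Set.indicator_of_mem hs]
          have : f w = 0 := by
            by_contra h
            exact hw ⟨hV w h, hs⟩
          simp [this]
        · exact Set.indicator_of_notMem hs _
      simp [this]
  rw [cv_comm, cv_apply]
  refine (enorm_integral_le_lintegral_enorm _).trans ?_
  calc _ ≤ ∫⁻ y, (ENNReal.ofReal B * (vsc E j)⁻¹) * ((V ∩ shell E j).indicator 1 (x - y) * ‖b y‖ₑ) := by
        refine lintegral_mono fun y => ?_
        rw [enorm_mul]
        calc _ ≤ ‖b y‖ₑ * ((V ∩ shell E j).indicator 1 (x - y) *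
              (ENNReal.ofReal B * (vsc E j)⁻¹)) := mul_le_mul_right (h1 _) _
          _ = _ := by ring
    _ = _ := by
        rw [lintegral_const_mul' _ _ (ENNReal.mul_ne_top ENNReal.ofReal_ne_top
          (ENNReal.inv_ne_top.2 (vsc_ne_zero _))), avgOn, mul_assoc]

/-- A finite family of cancelling smooth functions attached to disjoint sets, as produced by a
Calderón–Zygmund decomposition at height `α`. -/
structure Atoms (E : Type*) [NormedAddCommGroup E] [InnerProductSpace ℝ E] [FiniteDimensional ℝ E]
    [MeasurableSpace E] [BorelSpace E] (ι : Type*) (α : ℝ≥0∞) where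
  scale : ι → ℤ
  center : ι → E
  fn : ι → E → ℂ
  cube : ι → Set E
  smooth : ∀ q, ContDiff ℝ (⊤ : ℕ∞) (fn q)
  supp : ∀ q x, (2 : ℝ) ^ scale q < ‖x - center q‖ → fn q x = 0
  mean : ∀ q, ∫ x, fn q x = 0
  meas : ∀ q, MeasurableSet (cube q)
  disj : Pairwise fun q q' => Disjoint (cube q) (cube q')
  sub : ∀ q, cube q ⊆ closedBall (center q) ((2 : ℝ) ^ scale q)
  size : ∀ q, ∫⁻ x, ‖fn q x‖ₑ ≤ α * volume (cube q)

namespace Atoms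

variable {ι : Type*} {α : ℝ≥0∞} (D : Atoms E ι α)

theorem hasCompactSupport (q : ι) : HasCompactSupport (D.fn q) := by
  refine HasCompactSupport.of_support_subset_isCompact
    (isCompact_closedBall (D.center q) ((2 : ℝ) ^ D.scale q)) fun w hw => ?_
  rw [mem_closedBall, dist_eq_norm]
  by_contra h
  exact hw (D.supp q w (not_le.1 h))

theorem continuous (q : ι) : Continuous (D.fn q) := (D.smooth q).continuous

theorem integrable (q : ι) : Integrable (D.fn q) :=
  (D.continuous q).integrable_of_hasCompactSupport (D.hasCompactSupport q)

theorem bounded (q : ι) : ∃ C, ∀ x, ‖D.fn q x‖ ≤ C :=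
  (D.hasCompactSupport q).exists_bound_of_continuous (D.continuous q)

end Atoms

theorem eventually_lintegral_sub_cv_Phi_le {b : E → ℂ} (hb : ContDiff ℝ (⊤ : ℕ∞) b)
    (hbs : HasCompactSupport b) (a : ℤ) {ε : ℝ≥0∞} (hε : ε ≠ 0) :
    ∀ᶠ n : ℕ in atTop, ∫⁻ x, ‖b x - cv (Phi ((2 : ℝ) ^ (a + n))) b x‖ₑ ≤ ε * ∫⁻ x, ‖b x‖ₑ := by
  have hbc := hb.continuous
  have hbi : Integrable b := hbc.integrable_of_hasCompactSupport hbs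
  have hbb := hbs.exists_bound_of_continuous hbc
  have hb1 : ContDiff ℝ 1 b := hb.of_le (by exact_mod_cast le_top)
  rcases eq_or_ne (∫⁻ x, ‖b x‖ₑ) 0 with h0 | h0
  · refine Eventually.of_forall fun n => ?_
    have hPi : Integrable (Phi ((2 : ℝ) ^ (a + n)) : E → ℂ) := integrable_Phi (two_zpow_pos _)
    calc _ ≤ ∫⁻ x, (‖b x‖ₑ + ‖cv (Phi ((2 : ℝ) ^ (a + n))) b x‖ₑ) :=
          lintegral_mono fun x => enorm_sub_le
      _ = (∫⁻ x, ‖b x‖ₑ) + ∫⁻ x, ‖cv (Phi ((2 : ℝ) ^ (a + n))) b x‖ₑ :=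
          lintegral_add_left hbc.measurable.enorm _
      _ ≤ 0 + (∫⁻ x : E, ‖Phi ((2 : ℝ) ^ (a + n)) x‖ₑ) * 0 := by
          rw [h0]
          refine add_le_add le_rfl ((lintegral_cv_le hPi.aestronglyMeasurable
            hbi.aestronglyMeasurable).trans ?_)
          rw [h0]
      _ ≤ _ := by simp
  · have hfd : ∫⁻ x, ‖fderiv ℝ b x‖ₑ < ∞ :=
      ((hb1.continuous_fderiv one_ne_zero).integrable_of_hasCompactSupport
        (hbs.fderiv ℝ)).hasFiniteIntegral
    have hP : ∫⁻ x : E, ‖x‖ₑ * ‖phi0 E x‖ₑ < ∞ := by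
      have := lintegral_norm_mul_Phi_lt_top (E := E) one_pos
      simpa [Phi] using this
    have hlim : Tendsto (fun n : ℕ => (ENNReal.ofReal (((2 : ℝ) ^ (a + n))⁻¹) *
        ∫⁻ x : E, ‖x‖ₑ * ‖phi0 E x‖ₑ) * ∫⁻ x, ‖fderiv ℝ b x‖ₑ) atTop (𝓝 0) := by
      have h1 : Tendsto (fun n : ℕ => ENNReal.ofReal (((2 : ℝ) ^ (a + n))⁻¹)) atTop (𝓝 0) := by
        rw [← ENNReal.ofReal_zero]
        refine ENNReal.tendsto_ofReal ?_
        have h2 : ∀ n : ℕ, ((2 : ℝ) ^ (a + n))⁻¹ = ((2 : ℝ) ^ a)⁻¹ * (1 / 2) ^ n := by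
          intro n
          rw [zpow_add₀ two_ne_zero, mul_inv, zpow_natCast, one_div, inv_pow]
        simp only [h2]
        simpa using (tendsto_pow_atTop_nhds_zero_of_lt_one (r := (1 / 2 : ℝ)) (by norm_num)
          (by norm_num)).const_mul (((2 : ℝ) ^ a)⁻¹)
      have h3 := ENNReal.Tendsto.mul_const (ENNReal.Tendsto.mul_const h1
        (Or.inr hP.ne)) (Or.inr hfd.ne)
      simpa using h3
    have hpos : 0 < ε * ∫⁻ x, ‖b x‖ₑ := pos_iff_ne_zero.2 (mul_ne_zero hε h0)
    filter_upwards [(hlim.eventually (gt_mem_nhds hpos))] with n hn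
    exact (lintegral_sub_cv_Phi_le hb1 hbb (two_zpow_pos _)).trans hn.le

end Core

section CoreThm
open scoped FourierTransform

variable {E : Type*} [NormedAddCommGroup E] [InnerProductSpace ℝ E] [FiniteDimensional ℝ E]
  [MeasurableSpace E] [BorelSpace E]

/-- The constant in the `L²` part of the main estimate. -/
def sqC (E : Type*) [NormedAddCommGroup E] [InnerProductSpace ℝ E] [FiniteDimensional ℝ E]
    [MeasurableSpace E] [BorelSpace E] : ℝ≥0∞ :=
  ENNReal.ofReal (384 ^ Module.finrank ℝ E * 48 ^ Module.finrank ℝ E * 9 *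
    25 ^ Module.finrank ℝ E * 2) * volume (ball (0 : E) 1) ^ 2

theorem sqC_lt_top : sqC E < ∞ :=
  ENNReal.mul_lt_top ENNReal.ofReal_lt_top (ENNReal.pow_lt_top measure_ball_lt_top)

theorem contDiff_cv {f g : E → ℂ} (hf : Integrable f) (hg : ContDiff ℝ (⊤ : ℕ∞) g)
    (hgc : HasCompactSupport g) : ContDiff ℝ (⊤ : ℕ∞) (cv f g) :=
  hgc.contDiff_convolution_right (ContinuousLinearMap.mul ℝ ℂ) hf.locallyIntegrable hg

theorem hasCompactSupport_cv {f g : E → ℂ} (hf : HasCompactSupport f)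
    (hg : HasCompactSupport g) : HasCompactSupport (cv f g) :=
  hf.convolution _ hg

theorem cv_finset_sum {κ : Type*} (S : Finset κ) {f : κ → E → ℂ} {g : E → ℂ}
    (hf : ∀ e ∈ S, Integrable (f e)) (hg : Continuous g) (hgb : ∃ C, ∀ x, ‖g x‖ ≤ C) (x : E) :
    cv (fun w => ∑ e ∈ S, f e w) g x = ∑ e ∈ S, cv (f e) g x := by
  simp only [cv_apply, Finset.sum_mul]
  refine integral_finsetSum _ fun e he => ?_
  obtain ⟨C, hC⟩ := hgb
  exact (hf e he).mul_bdd (by fun_prop) (Eventually.of_forall fun y => hC (x - y))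

theorem cv_finset_sum_right {κ : Type*} (S : Finset κ) {f : E → ℂ} {g : κ → E → ℂ}
    (hf : Integrable f) (hg : ∀ q ∈ S, Continuous (g q)) (hgb : ∀ q ∈ S, ∃ C, ∀ x, ‖g q x‖ ≤ C)
    (x : E) :
    cv f (fun w => ∑ q ∈ S, g q w) x = ∑ q ∈ S, cv f (g q) x := by
  simp only [cv_apply, Finset.mul_sum]
  refine integral_finsetSum _ fun e he => ?_
  obtain ⟨C, hC⟩ := hgb e he
  have := hg e he
  exact hf.mul_bdd (by fun_prop) (Eventually.of_forall fun y => hC (x - y))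

/-- The part of `f` living in the cone around `e`. -/
def conePart (m : ℕ) (S : Finset E) (f : E → ℂ) (e : E) : E → ℂ :=
  fun w => f w * ((coneW m S e w : ℝ) : ℂ)

section conePart
variable (m : ℕ) {S : Finset E} {f : E → ℂ}

theorem measurable_conePart (hf : Measurable f) (e : E) : Measurable (conePart m S f e) :=
  hf.mul (Complex.measurable_ofReal.comp (measurable_coneW m S e))

theorem conePart_smul (hom : ∀ r : ℝ, 0 < r → ∀ x : E, x ≠ 0 → f (r • x) = f x) (e : E)
    (r : ℝ) (hr : 0 < r) (x : E) (hx : x ≠ 0) :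
    conePart m S f e (r • x) = conePart m S f e x := by
  rw [conePart, conePart, hom r hr x hx, coneW_smul m S e hr]

theorem norm_conePart (e w : E) : ‖conePart m S f e w‖ = ‖f w‖ * coneW m S e w := by
  rw [conePart, norm_mul, Complex.norm_real, Real.norm_of_nonneg (coneW_nonneg m S e w)]

theorem norm_conePart_le {e : E} (he : e ∈ S) (w : E) : ‖conePart m S f e w‖ ≤ ‖f w‖ := by
  rw [norm_conePart]
  exact mul_le_of_le_one_right (norm_nonneg _) (coneW_le_one m he w)

theorem mem_cone_of_conePart_ne_zero {e w : E} (h : conePart m S f e w ≠ 0) : w ∈ cone m e :=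
  mem_cone_of_coneW_ne_zero (S := S) fun h' => h (by rw [conePart, h']; simp)

variable {m}

theorem sum_conePart (hS : ∀ θ : E, ‖θ‖ = 1 → ∃ e ∈ S, ‖θ - e‖ ≤ ((2 : ℝ) ^ m)⁻¹ / 4)
    {w : E} (hw : w ≠ 0) : ∑ e ∈ S, conePart m S f e w = f w := by
  simp only [conePart]
  rw [← Finset.mul_sum, ← Complex.ofReal_sum, sum_coneW hS hw]
  simp

theorem sum_lintegral_conePart
    (hS : ∀ θ : E, ‖θ‖ = 1 → ∃ e ∈ S, ‖θ - e‖ ≤ ((2 : ℝ) ^ m)⁻¹ / 4) (hf : Measurable f) :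
    ∑ e ∈ S, ∫⁻ θ : sphere (0 : E) 1, ‖conePart m S f e θ‖ₑ ∂(volume : Measure E).toSphere
      = ∫⁻ θ : sphere (0 : E) 1, ‖f θ‖ₑ ∂(volume : Measure E).toSphere := by
  have hm : ∀ e ∈ S, Measurable fun θ : sphere (0 : E) 1 => ‖conePart m S f e θ‖ₑ := fun e _ =>
    ((measurable_conePart m hf e).comp measurable_subtype_coe).enorm
  rw [← lintegral_finsetSum _ hm]
  refine lintegral_congr fun θ => ?_
  have h : ∀ e, ‖conePart m S f e θ‖ₑ = ENNReal.ofReal (‖f θ‖ * coneW m S e θ) := fun e => by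
    rw [← norm_conePart, ofReal_norm]
  simp only [h]
  rw [← ENNReal.ofReal_sum_of_nonneg fun e _ => mul_nonneg (norm_nonneg _) (coneW_nonneg m S e θ),
    ← Finset.mul_sum, sum_coneW hS (ne_zero_of_mem_unit_sphere θ), mul_one, ofReal_norm]

theorem sum_skern_conePart (hS : ∀ θ : E, ‖θ‖ = 1 → ∃ e ∈ S, ‖θ - e‖ ≤ ((2 : ℝ) ^ m)⁻¹ / 4)
    (j : ℤ) (M : E → ℂ) (w : E) :
    ∑ e ∈ S, skern j (conePart m S f e) M w = skern j f M w := by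
  by_cases hw : w ∈ shell E j
  · simp only [skern, Set.indicator_of_mem hw]
    rw [← Finset.sum_mul, ← Finset.sum_mul, sum_conePart hS (ne_zero_of_mem_shell hw)]
  · simp only [skern, Set.indicator_of_notMem hw, Finset.sum_const_zero]

end conePart

theorem lintegral_sphere_lt_top_of_bounded {f : E → ℂ} {B : ℝ} (hB : ∀ x, ‖f x‖ ≤ B) :
    ∫⁻ θ : sphere (0 : E) 1, ‖f θ‖ₑ ∂(volume : Measure E).toSphere < ∞ := by
  calc _ ≤ ∫⁻ θ : sphere (0 : E) 1, ENNReal.ofReal B ∂(volume : Measure E).toSphere := by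
        refine lintegral_mono fun θ => ?_
        rw [← ofReal_norm]
        exact ENNReal.ofReal_le_ofReal (hB _)
    _ < ∞ := by
        rw [lintegral_const]
        exact ENNReal.mul_lt_top ENNReal.ofReal_lt_top (measure_lt_top _ _)

theorem lintegral_sq_sum_cv_skern_le {ι : Type*} [Fintype ι] {s m : ℕ} (hms : m ≤ s)
    {α : ℝ≥0∞} (D : Atoms E ι α) {f : E → ℂ} {B : ℝ} (hB : ∀ x, ‖f x‖ ≤ B)
    {M : ι → E → ℂ} (hM1 : ∀ q w, ‖M q w‖ ≤ 1) {e : E} (he : ‖e‖ = 1)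
    (hV : ∀ w, f w ≠ 0 → w ∈ cone m e) :
    ∫⁻ x, ‖∑ q, cv (skern (D.scale q + s) f (M q)) (D.fn q) x‖ₑ ^ 2
      ≤ ENNReal.ofReal B ^ 2 * (2 * (tubeC E m ^ 2 * α) * ∑ q, ∫⁻ x, ‖D.fn q x‖ₑ) := by
  have hd : (0 : ℝ) < ((2 : ℝ) ^ m)⁻¹ := by positivity
  have key := lintegral_sq_sum_avgOn_le (m := m) (e := e) (j := fun q => D.scale q + s)
    (r := fun q => (2 : ℝ) ^ D.scale q) (c := D.center) (Q := D.cube)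
    (β := fun q y => ‖D.fn q y‖ₑ) (α := α)
    (S := fun q => cone m e ∩ shell E (D.scale q + s)) he
    (fun q => by
      have h1 : (2 : ℝ) ^ (D.scale q + (s : ℤ)) = 2 ^ D.scale q * 2 ^ s := by
        rw [zpow_add₀ two_ne_zero, zpow_natCast]
      have h2 : (1 : ℝ) ≤ ((2 : ℝ) ^ m)⁻¹ * 2 ^ s := by
        rw [inv_mul_eq_div, one_le_div (by positivity)]
        exact pow_le_pow_right₀ one_le_two hms
      have h3 := two_zpow_pos (D.scale q)
      rw [h1]
      nlinarith)
    D.meas D.disj D.sub (fun q => (D.continuous q).measurable.enorm)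
    (fun q x hx => by simp [D.supp q x hx]) D.size
    (fun q => (measurableSet_cone m e).inter (measurableSet_shell _))
    (fun q w hw => by
      refine ⟨hw.2.2, (norm_sub_le_of_mem_cone hw.1).trans ?_⟩
      have h1 : ‖w‖ ≤ 2 * 2 ^ (D.scale q + (s : ℤ)) := by
        have := hw.2.2.le
        rwa [zpow_add_one₀ two_ne_zero, mul_comm] at this
      nlinarith)
  have hmeas : Measurable fun x => (∑ q, avgOn (D.scale q + s)
      (cone m e ∩ shell E (D.scale q + s)) (fun y => ‖D.fn q y‖ₑ) x) ^ 2 := by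
    refine Measurable.pow_const (Finset.measurable_fun_sum _ fun q _ => ?_) 2
    exact measurable_avgOn ((measurableSet_cone m e).inter (measurableSet_shell _))
      (D.continuous q).measurable.enorm
  calc _ ≤ ∫⁻ x, ENNReal.ofReal B ^ 2 * (∑ q, avgOn (D.scale q + s)
      (cone m e ∩ shell E (D.scale q + s)) (fun y => ‖D.fn q y‖ₑ) x) ^ 2 := by
        refine lintegral_mono fun x => ?_
        rw [← mul_pow]
        refine pow_le_pow_left' ?_ 2
        refine (enorm_sum_le _ _).trans ?_
        rw [Finset.mul_sum]
        exact Finset.sum_le_sum fun q _ => enorm_cv_skern_le hB (hM1 q) hV x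
    _ ≤ _ := by
        rw [lintegral_const_mul _ hmeas]
        exact mul_le_mul_right key _

theorem card_constant_le {δ c : ℝ} (hd : 0 < δ) (n : ℕ) (hc : c * δ ^ n ≤ 48 ^ n * δ) :
    384 ^ n * δ ^ 2 / δ ^ n * (c * (2 * (3 * δ⁻¹ * (5 * δ) ^ n) ^ 2)) ≤
      384 ^ n * 48 ^ n * 9 * 25 ^ n * 2 * δ := by
  have h25 : (25 : ℝ) ^ n = 5 ^ n * 5 ^ n := by rw [← mul_pow]; norm_num
  have hp : 0 < δ ^ n := pow_pos hd n
  have h384 : (0 : ℝ) ≤ 384 ^ n * 25 ^ n := by positivity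
  rw [mul_pow 5 δ]
  generalize (384 : ℝ) ^ n = A at *
  generalize (48 : ℝ) ^ n = A' at *
  generalize (25 : ℝ) ^ n = A₂ at *
  generalize (5 : ℝ) ^ n = A₃ at *
  generalize δ ^ n = D at *
  calc _ = (A * A₂) * 18 * (c * D) := by
        rw [h25]
        field_simp
        ring
    _ ≤ (A * A₂) * 18 * (A' * δ) := by gcongr
    _ = _ := by ring

theorem sqC_bound {m : ℕ} {S : Finset E} (hS1 : ∀ e ∈ S, ‖e‖ = 1)
    (hS2 : ∀ e ∈ S, ∀ e' ∈ S, e ≠ e' → ((2 : ℝ) ^ m)⁻¹ / 4 < ‖e - e'‖) (X α Y : ℝ≥0∞) :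
    ENNReal.ofReal (384 ^ Module.finrank ℝ E * ((2 : ℝ) ^ m)⁻¹ ^ 2 /
        ((2 : ℝ) ^ m)⁻¹ ^ Module.finrank ℝ E) *
      ∑ _e ∈ S, (X * (2 * (tubeC E m ^ 2 * α) * Y))
    ≤ sqC E * ENNReal.ofReal ((2 : ℝ) ^ (-(m : ℤ))) * X * α * Y := by
  have hc := card_separated_le hS1 hS2
  have hz : (2 : ℝ) ^ (-(m : ℤ)) = ((2 : ℝ) ^ m)⁻¹ := by rw [zpow_neg, zpow_natCast]
  have h2m : (2 : ℝ) ^ m = (((2 : ℝ) ^ m)⁻¹)⁻¹ := by rw [inv_inv]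
  have hd : 0 < ((2 : ℝ) ^ m)⁻¹ := by positivity
  rw [Finset.sum_const, nsmul_eq_mul, hz, tubeC, sqC]
  have h1 := ENNReal.ofReal_le_ofReal (card_constant_le hd _ hc)
  rw [inv_inv] at h1
  generalize ((2 : ℝ) ^ m)⁻¹ = δ at *
  generalize (2 : ℝ) ^ m = μ at *
  generalize hn : Module.finrank ℝ E = n at *
  subst h2m
  have h48 : (0 : ℝ) ≤ 384 ^ n * 48 ^ n * 9 * 25 ^ n * 2 := by positivity
  rw [ENNReal.ofReal_mul (by positivity), ENNReal.ofReal_mul (by positivity),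
    ENNReal.ofReal_mul zero_le_two, ENNReal.ofReal_pow (by positivity), ENNReal.ofReal_natCast,
    ENNReal.ofReal_mul h48] at h1
  generalize ENNReal.ofReal (384 ^ n * δ ^ 2 / δ ^ n) = X1 at *
  generalize ENNReal.ofReal (384 ^ n * 48 ^ n * 9 * 25 ^ n * 2) = X2 at *
  generalize ENNReal.ofReal (3 * δ⁻¹ * (5 * δ) ^ n) = X3 at *
  calc _ = (X1 * ((S.card : ℝ≥0∞) * (ENNReal.ofReal 2 * X3 ^ 2))) *
      (volume (ball (0 : E) 1) ^ 2 * X * α * Y) := by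
        rw [ENNReal.ofReal_ofNat]; ring
    _ ≤ _ := mul_le_mul_left h1 _
    _ = _ := by ring

theorem exists_bot_int {ι : Type*} [Fintype ι] (f : ι → ℤ) : ∃ a, ∀ q, a ≤ f q := by
  obtain ⟨a, ha⟩ := (Set.finite_range f).bddBelow
  exact ⟨a, fun q => ha ⟨q, rfl⟩⟩

set_option maxHeartbeats 1000000 in
/-- The main estimate: the contribution of the shells at relative scale `s` splits into a part
that is small in `L¹` and a part that is small in `L²`. -/
theorem exists_splitting [Nontrivial E] {ι : Type*} [Fintype ι] {s m : ℕ} (hms : 3 * m ≤ s)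
    {α : ℝ≥0∞} (D : Atoms E ι α) {f : E → ℂ} (hf : Measurable f)
    (hom : ∀ r : ℝ, 0 < r → ∀ x : E, x ≠ 0 → f (r • x) = f x)
    {B : ℝ} (hB : ∀ x, ‖f x‖ ≤ B) {M : ι → E → ℂ} (hM : ∀ q, Measurable (M q))
    (hM1 : ∀ q w, ‖M q w‖ ≤ 1)
    (hML : ∀ q, ∀ θ : E, ‖θ‖ = 1 → ∀ r r' : ℝ, 0 < r → 0 < r' →
      ‖M q (r • θ) - M q (r' • θ)‖ ≤ |r - r'| / r) :
    ∃ G : E → ℂ, Continuous G ∧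
      ∫⁻ x, ‖(∑ q, cv (skern (D.scale q + s) f (M q)) (D.fn q) x) - G x‖ₑ ≤
        singC E * ENNReal.ofReal ((2 : ℝ) ^ (-(m : ℤ))) *
          (∫⁻ θ : sphere (0 : E) 1, ‖f θ‖ₑ ∂(volume : Measure E).toSphere) *
          ∑ q, ∫⁻ x, ‖D.fn q x‖ₑ ∧
      ∫⁻ x, ‖G x‖ₑ ^ 2 ≤ sqC E * ENNReal.ofReal ((2 : ℝ) ^ (-(m : ℤ))) *
        ENNReal.ofReal B ^ 2 * α * ∑ q, ∫⁻ x, ‖D.fn q x‖ₑ := by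
  obtain ⟨S, hS1, hS2, hS3⟩ := exists_net E m
  have hzm : (2 : ℝ) ^ (-(m : ℤ)) = ((2 : ℝ) ^ m)⁻¹ := by rw [zpow_neg, zpow_natCast]
  obtain ⟨a, ha⟩ := exists_bot_int fun q => -D.scale q - (m : ℤ)
  have hεne : ENNReal.ofReal ((2 : ℝ) ^ (-(m : ℤ))) ≠ 0 :=
    (ENNReal.ofReal_pos.2 (two_zpow_pos _)).ne'
  obtain ⟨n, hn⟩ := (eventually_all.2 fun q =>
    eventually_lintegral_sub_cv_Phi_le (D.smooth q) (D.hasCompactSupport q) a hεne).exists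
  have hcm : ∀ e, Measurable (conePart m S f e) := measurable_conePart m hf
  have hcB : ∀ e ∈ S, ∀ w, ‖conePart m S f e w‖ ≤ B := fun e he w =>
    (norm_conePart_le m he w).trans (hB w)
  have hcf : ∀ e ∈ S, ∫⁻ θ : sphere (0 : E) 1, ‖conePart m S f e θ‖ₑ
      ∂(volume : Measure E).toSphere < ∞ := fun e he =>
    lintegral_sphere_lt_top_of_bounded (hcB e he)
  have hHi : ∀ e ∈ S, ∀ q, Integrable (skern (D.scale q + s) (conePart m S f e) (M q)) :=
    fun e he q => integrable_skern _ (hcm e) (hM q) (conePart_smul m hom e) (hM1 q) (hcf e he)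
  set g : E → E → ℂ := fun e x =>
    ∑ q, cv (skern (D.scale q + s) (conePart m S f e) (M q)) (D.fn q) x with hg
  have hgq : ∀ e ∈ S, ∀ q, ContDiff ℝ (⊤ : ℕ∞)
      (cv (skern (D.scale q + s) (conePart m S f e) (M q)) (D.fn q)) := fun e he q =>
    contDiff_cv (hHi e he q) (D.smooth q) (D.hasCompactSupport q)
  have hgqc : ∀ e, ∀ q, HasCompactSupport
      (cv (skern (D.scale q + s) (conePart m S f e) (M q)) (D.fn q)) := fun e q =>
    hasCompactSupport_cv (hasCompactSupport_skern _ _ _) (D.hasCompactSupport q)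
  have hgs : ∀ e ∈ S, ContDiff ℝ (⊤ : ℕ∞) (g e) := fun e he =>
    ContDiff.sum fun q _ => hgq e he q
  have hgc : ∀ e, HasCompactSupport (g e) := by
    intro e
    have : ∀ T : Finset ι, HasCompactSupport fun x =>
        ∑ q ∈ T, cv (skern (D.scale q + s) (conePart m S f e) (M q)) (D.fn q) x := by
      classical
      intro T
      induction T using Finset.induction_on with
      | empty =>
        simp only [Finset.sum_empty]
        exact (HasCompactSupport.zero : HasCompactSupport (0 : E → ℂ))
      | insert q T hq ih =>
        simp only [Finset.sum_insert hq]
        exact (hgqc e q).add ih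
    exact this _
  have hpi := fun e => integrable_pksum (E := E) m a n e
  have hqb : ∀ e ∈ S, ∀ q, ∃ C, ∀ x,
      ‖cv (skern (D.scale q + s) (conePart m S f e) (M q)) (D.fn q) x‖ ≤ C := fun e he q =>
    (hgqc e q).exists_bound_of_continuous (hgq e he q).continuous
  have hcont : ∀ e ∈ S, Continuous (cv (pksum m a n e) (g e)) := fun e he =>
    continuous_cv (hpi e) (hgs e he).continuous
      ((hgc e).exists_bound_of_continuous (hgs e he).continuous)
  refine ⟨fun x => ∑ e ∈ S, cv (pksum m a n e) (g e) x, continuous_finsetSum _ hcont, ?_, ?_⟩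
  · have htot : ∀ x, (∑ q, cv (skern (D.scale q + s) f (M q)) (D.fn q) x) -
        ∑ e ∈ S, cv (pksum m a n e) (g e) x = ∑ e ∈ S, ∑ q,
        (cv (skern (D.scale q + s) (conePart m S f e) (M q)) (D.fn q) x -
        cv (pksum m a n e) (cv (skern (D.scale q + s) (conePart m S f e) (M q)) (D.fn q)) x) := by
      intro x
      simp only [Finset.sum_sub_distrib]
      congr 1
      · rw [Finset.sum_comm]
        refine Finset.sum_congr rfl fun q _ => ?_
        rw [← cv_finset_sum S (fun e he => hHi e he q) (D.continuous q) (D.bounded q)]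
        congr 1
        funext w
        exact (sum_skern_conePart hS3 _ _ w).symm
      · refine Finset.sum_congr rfl fun e he => ?_
        exact cv_finset_sum_right _ (hpi e) (fun q _ => (hgq e he q).continuous)
          (fun q _ => hqb e he q) x
    simp only [htot]
    have hterm : ∀ e ∈ S, ∀ q, ∫⁻ x,
        ‖cv (skern (D.scale q + s) (conePart m S f e) (M q)) (D.fn q) x -
        cv (pksum m a n e) (cv (skern (D.scale q + s) (conePart m S f e) (M q)) (D.fn q)) x‖ₑ ≤
        singC E * ENNReal.ofReal ((2 : ℝ) ^ (-(m : ℤ))) *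
          (∫⁻ θ : sphere (0 : E) 1, ‖conePart m S f e θ‖ₑ ∂(volume : Measure E).toSphere) *
          ∫⁻ x, ‖D.fn q x‖ₑ := by
      intro e he q
      refine lintegral_sub_cv_pksum_le hms (hcm e) (hM q) (conePart_smul m hom e) (hM1 q) (hML q)
        (hcf e he) ?_ (D.integrable q) (D.continuous q) (D.bounded q) (D.supp q) (D.mean q)
        (ha q) (hn q)
      intro θ hθ h0
      have := mem_cone_of_conePart_ne_zero m h0
      rw [cone, Set.mem_ofPred_eq, norm_eq_one_inv_smul hθ] at this
      rwa [hzm]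
    have hms1 : ∀ e ∈ S, ∀ q, Measurable fun x =>
        ‖cv (skern (D.scale q + s) (conePart m S f e) (M q)) (D.fn q) x -
        cv (pksum m a n e) (cv (skern (D.scale q + s) (conePart m S f e) (M q)) (D.fn q)) x‖ₑ := by
      intro e he q
      exact ((hgq e he q).continuous.sub
        (continuous_cv (hpi e) (hgq e he q).continuous (hqb e he q))).measurable.enorm
    calc _ ≤ ∫⁻ x, ∑ e ∈ S, ∑ q,
        ‖cv (skern (D.scale q + s) (conePart m S f e) (M q)) (D.fn q) x -
        cv (pksum m a n e) (cv (skern (D.scale q + s) (conePart m S f e) (M q)) (D.fn q)) x‖ₑ :=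
          lintegral_mono fun x => (enorm_sum_le _ _).trans
            (Finset.sum_le_sum fun e _ => enorm_sum_le _ _)
      _ = ∑ e ∈ S, ∑ q, ∫⁻ x,
        ‖cv (skern (D.scale q + s) (conePart m S f e) (M q)) (D.fn q) x -
        cv (pksum m a n e) (cv (skern (D.scale q + s) (conePart m S f e) (M q)) (D.fn q)) x‖ₑ := by
          rw [lintegral_finsetSum' _ fun e he =>
            (Finset.measurable_fun_sum _ fun q _ => hms1 e he q).aemeasurable]
          refine Finset.sum_congr rfl fun e he => ?_
          rw [lintegral_finsetSum _ fun q _ => hms1 e he q]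
      _ ≤ ∑ e ∈ S, ∑ q, singC E * ENNReal.ofReal ((2 : ℝ) ^ (-(m : ℤ))) *
          (∫⁻ θ : sphere (0 : E) 1, ‖conePart m S f e θ‖ₑ ∂(volume : Measure E).toSphere) *
          ∫⁻ x, ‖D.fn q x‖ₑ :=
          Finset.sum_le_sum fun e he => Finset.sum_le_sum fun q _ => hterm e he q
      _ = _ := by
          simp only [← Finset.mul_sum, ← Finset.sum_mul]
          rw [sum_lintegral_conePart hS3 hf]
  · have hband : ∀ ξ : E, ξ ≠ 0 →
        ((S.filter fun e => |inner ℝ ξ e| ≤ 4 * ((2 : ℝ) ^ m)⁻¹ * ‖ξ‖).card : ℝ) ≤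
        384 ^ Module.finrank ℝ E * ((2 : ℝ) ^ m)⁻¹ ^ 2 / ((2 : ℝ) ^ m)⁻¹ ^ Module.finrank ℝ E := by
      intro ξ hξ
      rw [le_div_iff₀ (by positivity)]
      refine card_band_le (fun e he => hS1 e (Finset.mem_filter.1 he).1)
        (fun e he e' he' => hS2 e (Finset.mem_filter.1 he).1 e' (Finset.mem_filter.1 he').1)
        (fun e he => (Finset.mem_filter.1 he).2) hξ
    refine (lintegral_sq_sum_cv_pksum_le m a n S hgs (fun e _ => hgc e) hband
      (by positivity)).trans ?_
    refine le_trans ?_ (sqC_bound hS1 hS2 (ENNReal.ofReal B ^ 2) α _)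
    refine mul_le_mul_right (Finset.sum_le_sum fun e he => ?_) _
    exact lintegral_sq_sum_cv_skern_le (by lia) D (hcB e he) hM1 (hS1 e he)
      fun w hw => mem_cone_of_conePart_ne_zero m hw

end CoreThm

section Dyadic

variable {d : ℕ}

/-- The index of the dyadic cube of side `2^{-n}` containing `x`. -/
def dyIndex (n : ℤ) (x : EuclideanSpace ℝ (Fin d)) : Fin d → ℤ := fun i => ⌊(2 : ℝ) ^ n * x i⌋

/-- Dyadic cubes of side `2^{-n}`. -/
def dyCube (n : ℤ) (v : Fin d → ℤ) : Set (EuclideanSpace ℝ (Fin d)) := {x | dyIndex n x = v}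

theorem dyCube_eq (n : ℤ) (v : Fin d → ℤ) : dyCube n v = WithLp.ofLp ⁻¹' (Set.univ.pi fun i =>
    Set.Ico (((2 : ℝ) ^ n)⁻¹ * v i) (((2 : ℝ) ^ n)⁻¹ * (v i + 1))) := by
  have h := two_zpow_pos n
  ext x
  simp only [dyCube, dyIndex, Set.mem_ofPred_eq, funext_iff, Int.floor_eq_iff, Set.mem_preimage,
    Set.mem_pi, Set.mem_univ, true_imp_iff, Set.mem_Ico, inv_mul_le_iff₀ h, lt_inv_mul_iff₀ h]

theorem measurableSet_dyCube (n : ℤ) (v : Fin d → ℤ) : MeasurableSet (dyCube n v) := by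
  rw [dyCube_eq]
  exact (PiLp.volume_preserving_ofLp (Fin d)).measurable
    (MeasurableSet.univ_pi fun i => measurableSet_Ico)

theorem volume_dyCube (n : ℤ) (v : Fin d → ℤ) :
    volume (dyCube n v) = ENNReal.ofReal (((2 : ℝ) ^ n)⁻¹ ^ d) := by
  have h := two_zpow_pos n
  rw [dyCube_eq, (PiLp.volume_preserving_ofLp (Fin d)).measure_preimage
    (MeasurableSet.univ_pi fun i => measurableSet_Ico).nullMeasurableSet, Real.volume_pi_Ico]
  have : ∀ i, ((2 : ℝ) ^ n)⁻¹ * (v i + 1) - ((2 : ℝ) ^ n)⁻¹ * v i = ((2 : ℝ) ^ n)⁻¹ := fun i => by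
    ring
  simp only [this]
  rw [Finset.prod_const, Finset.card_univ, Fintype.card_fin, ENNReal.ofReal_pow (by positivity)]

theorem dyIndex_sub_nat (n : ℤ) (k : ℕ) (x : EuclideanSpace ℝ (Fin d)) :
    dyIndex (n - k) x = fun i => dyIndex n x i / ((2 ^ k : ℕ) : ℤ) := by
  funext i
  simp only [dyIndex]
  rw [← Int.floor_div_natCast, zpow_sub₀ two_ne_zero, zpow_natCast]
  push_cast
  congr 1
  ring

theorem dyIndex_eq_of_le {n n' : ℤ} (h : n' ≤ n) {x y : EuclideanSpace ℝ (Fin d)}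
    (hxy : dyIndex n x = dyIndex n y) : dyIndex n' x = dyIndex n' y := by
  obtain ⟨k, hk⟩ := Int.le.dest h
  have : n' = n - k := by lia
  rw [this, dyIndex_sub_nat, dyIndex_sub_nat, hxy]

theorem norm_le_of_forall_abs_le {x : EuclideanSpace ℝ (Fin d)} {δ : ℝ} (hδ : 0 ≤ δ)
    (h : ∀ i, |x i| ≤ δ) : ‖x‖ ≤ 2 ^ d * δ := by
  rw [EuclideanSpace.norm_eq]
  refine Real.sqrt_le_iff.2 ⟨by positivity, ?_⟩
  calc _ ≤ ∑ _i : Fin d, δ ^ 2 := by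
        refine Finset.sum_le_sum fun i _ => ?_
        rw [Real.norm_eq_abs]
        exact pow_le_pow_left₀ (abs_nonneg _) (h i) 2
    _ = d * δ ^ 2 := by simp
    _ ≤ (2 ^ d * 2 ^ d) * δ ^ 2 := by
        have h1 : (d : ℝ) ≤ 2 ^ d := by exact_mod_cast Nat.lt_two_pow_self.le
        have h2 : (1 : ℝ) ≤ 2 ^ d := one_le_pow₀ one_le_two
        gcongr
        nlinarith
    _ = _ := by ring

theorem norm_sub_le_of_dyIndex_eq {n : ℤ} {x y : EuclideanSpace ℝ (Fin d)}
    (h : dyIndex n x = dyIndex n y) : ‖x - y‖ ≤ 2 ^ d * ((2 : ℝ) ^ n)⁻¹ := by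
  have hn := two_zpow_pos n
  refine norm_le_of_forall_abs_le (by positivity) fun i => ?_
  have h1 := (Int.abs_sub_lt_one_of_floor_eq_floor (congrFun h i)).le
  rw [← mul_sub, abs_mul, abs_of_pos hn] at h1
  rw [← one_div, le_div_iff₀ hn, mul_comm]
  exact h1

theorem finite_dyIndex (n : ℤ) (R : ℝ) :
    {v : Fin d → ℤ | ∃ x : EuclideanSpace ℝ (Fin d), ‖x‖ ≤ R ∧ dyIndex n x = v}.Finite := by
  have hn := two_zpow_pos n
  refine (Set.finite_Icc (fun _ : Fin d => ⌊(2 : ℝ) ^ n * -R⌋) fun _ => ⌊(2 : ℝ) ^ n * R⌋).subset ?_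
  rintro v ⟨x, hx, rfl⟩
  have h1 : ∀ i, |x i| ≤ R := fun i => (PiLp.norm_apply_le x i).trans hx
  refine ⟨fun i => Int.floor_mono ?_, fun i => Int.floor_mono ?_⟩
  · exact mul_le_mul_of_nonneg_left (abs_le.1 (h1 i)).1 hn.le
  · exact mul_le_mul_of_nonneg_left (abs_le.1 (h1 i)).2 hn.le

/-- Calderón–Zygmund stopping cubes for a continuous function of compact support. -/
theorem exists_stopping_cubes (hd : d ≠ 0) {f : EuclideanSpace ℝ (Fin d) → ℂ}
    (hf : Continuous f) (hfc : HasCompactSupport f) {α : ℝ} (hα : 0 < α) :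
    ∃ S : Finset (ℤ × (Fin d → ℤ)),
      (∀ p ∈ S, ∃ x : EuclideanSpace ℝ (Fin d), dyIndex p.1 x = p.2) ∧
      (∀ p ∈ S, ENNReal.ofReal α * volume (dyCube p.1 p.2) ≤ ∫⁻ x in dyCube p.1 p.2, ‖f x‖ₑ) ∧
      (∀ p ∈ S, ∫⁻ x in dyCube p.1 p.2, ‖f x‖ₑ ≤
        ENNReal.ofReal (2 ^ d * α) * volume (dyCube p.1 p.2)) ∧
      (∀ p ∈ S, ∀ p' ∈ S, p ≠ p' → Disjoint (dyCube p.1 p.2) (dyCube p'.1 p'.2)) ∧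
      ∀ x, (∀ p ∈ S, x ∉ dyCube p.1 p.2) → ‖f x‖ ≤ 2 * α := by
  have hfi : ∫⁻ x, ‖f x‖ₑ < ∞ := (hf.integrable_of_hasCompactSupport hfc).hasFiniteIntegral
  let heavy : ℤ → EuclideanSpace ℝ (Fin d) → Prop := fun n x =>
    ENNReal.ofReal α * volume (dyCube n (dyIndex n x)) ≤ ∫⁻ y in dyCube n (dyIndex n x), ‖f y‖ₑ
  -- a level too coarse for any cube to be heavy
  obtain ⟨n0, hn0, hcoarse⟩ : ∃ n0 : ℤ, n0 ≤ 0 ∧ ∀ x, ¬ heavy n0 x := by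
    obtain ⟨k, hk⟩ := pow_unbounded_of_one_lt ((∫⁻ x, ‖f x‖ₑ).toReal / α) one_lt_two
    refine ⟨-k, by lia, fun x hx => ?_⟩
    have h1 : ∫⁻ y in dyCube (-k : ℤ) (dyIndex (-k : ℤ) x), ‖f y‖ₑ ≤ ∫⁻ y, ‖f y‖ₑ :=
      setLIntegral_le_lintegral _ _
    have h2 := hx.trans h1
    rw [volume_dyCube, ← ENNReal.ofReal_mul hα.le,
      ENNReal.ofReal_le_iff_le_toReal hfi.ne, zpow_neg, inv_inv, zpow_natCast] at h2
    rw [div_lt_iff₀ hα] at hk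
    have h3 : (2 : ℝ) ^ k ≤ (2 ^ k) ^ d := le_self_pow₀ (one_le_pow₀ one_le_two) hd
    nlinarith
  -- a level fine enough to catch all large values
  obtain ⟨N, hN, hfine⟩ : ∃ N : ℤ, 0 ≤ N ∧ ∀ x, 2 * α < ‖f x‖ → heavy N x := by
    obtain ⟨r, hr, hur⟩ := Metric.uniformContinuous_iff.1
      (hfc.uniformContinuous_of_continuous hf) α hα
    obtain ⟨k, hk⟩ := pow_unbounded_of_one_lt (2 ^ d / r) one_lt_two
    refine ⟨k, by lia, fun x hx => ?_⟩
    change _ ≤ _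
    rw [← setLIntegral_const]
    refine setLIntegral_mono' (measurableSet_dyCube _ _) fun y hy => ?_
    have h1 := norm_sub_le_of_dyIndex_eq (show dyIndex k y = dyIndex k x from hy)
    have h2 : 2 ^ d * ((2 : ℝ) ^ (k : ℤ))⁻¹ < r := by
      rw [zpow_natCast, ← div_eq_mul_inv, div_lt_iff₀ (by positivity)]
      rw [div_lt_iff₀ hr] at hk
      linarith
    have h3 := hur (a := y) (b := x) (by rw [dist_eq_norm]; linarith)
    rw [dist_eq_norm] at h3
    rw [← ofReal_norm]
    refine ENNReal.ofReal_le_ofReal ?_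
    have h4 := norm_sub_norm_le (f x) (f y)
    rw [norm_sub_rev] at h4
    linarith
  have hheavy : ∀ {n n' x y}, n' ≤ n → dyIndex n x = dyIndex n y → heavy n' x → heavy n' y := by
    intro n n' x y h hxy hx
    have := dyIndex_eq_of_le h hxy
    simp only [heavy] at hx ⊢
    rwa [← this]
  obtain ⟨R, hR⟩ := hfc.isBounded.exists_norm_le
  let sel : Set (ℤ × (Fin d → ℤ)) := {p | ∃ x, dyIndex p.1 x = p.2 ∧ n0 ≤ p.1 ∧ p.1 ≤ N ∧
    heavy p.1 x ∧ ∀ n', n0 ≤ n' → n' < p.1 → ¬ heavy n' x}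
  have hfin : sel.Finite := by
    refine ((Set.finite_Icc n0 N).biUnion fun n _ =>
      (Set.finite_singleton n).prod (finite_dyIndex (d := d) n R)).subset ?_
    rintro ⟨n, v⟩ ⟨x, hxv, h1, h2, h3, -⟩
    simp only [Set.mem_iUnion, Set.mem_prod, Set.mem_singleton_iff]
    refine ⟨n, ⟨h1, h2⟩, rfl, ?_⟩
    by_contra hcon
    have h0 : ∫⁻ y in dyCube n (dyIndex n x), ‖f y‖ₑ = 0 := by
      rw [setLIntegral_congr_fun (g := 0) (measurableSet_dyCube _ _) fun y hy => ?_]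
      · simp
      · have : y ∉ tsupport f := fun hy' => hcon ⟨y, hR y hy',
          (show dyIndex n y = dyIndex n x from hy).trans hxv⟩
        simp [image_eq_zero_of_notMem_tsupport this]
    simp only [heavy] at h3
    rw [h0, nonpos_iff_eq_zero, mul_eq_zero, volume_dyCube] at h3
    have hp : 0 < ((2 : ℝ) ^ n)⁻¹ ^ d := pow_pos (inv_pos.2 (two_zpow_pos n)) d
    rcases h3 with h3 | h3
    · exact absurd (ENNReal.ofReal_eq_zero.1 h3) (not_le.2 hα)
    · exact absurd (ENNReal.ofReal_eq_zero.1 h3) (not_le.2 hp)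
  refine ⟨hfin.toFinset, ?_, ?_, ?_, ?_, ?_⟩
  · intro p hp
    obtain ⟨x, hx, -⟩ := hfin.mem_toFinset.1 hp
    exact ⟨x, hx⟩
  · intro p hp
    obtain ⟨x, hx, -, -, h, -⟩ := hfin.mem_toFinset.1 hp
    rw [← hx]
    exact h
  · intro p hp
    obtain ⟨x, hx, h1, h2, h3, h4⟩ := hfin.mem_toFinset.1 hp
    have hne : p.1 ≠ n0 := fun h => hcoarse x (h ▸ h3)
    have h5 := h4 (p.1 - 1) (by lia) (by lia)
    simp only [heavy] at h5
    rw [← hx]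
    calc ∫⁻ y in dyCube p.1 (dyIndex p.1 x), ‖f y‖ₑ
        ≤ ∫⁻ y in dyCube (p.1 - 1) (dyIndex (p.1 - 1) x), ‖f y‖ₑ :=
          lintegral_mono_set fun y hy => dyIndex_eq_of_le (by lia) hy
      _ ≤ ENNReal.ofReal α * volume (dyCube (p.1 - 1) (dyIndex (p.1 - 1) x)) := (not_le.1 h5).le
      _ = _ := by
          have hp := two_zpow_pos p.1
          rw [volume_dyCube, volume_dyCube, ← ENNReal.ofReal_mul hα.le,
            ← ENNReal.ofReal_mul (by positivity), zpow_sub_one₀ two_ne_zero, mul_inv, inv_inv,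
            mul_pow]
          congr 1
          ring
  · rintro p hp p' hp' hne
    obtain ⟨x, hx, h1, h2, h3, h4⟩ := hfin.mem_toFinset.1 hp
    obtain ⟨x', hx', h1', h2', h3', h4'⟩ := hfin.mem_toFinset.1 hp'
    refine Set.disjoint_left.2 fun y hy hy' => ?_
    have e1 : dyIndex p.1 x = dyIndex p.1 y := hx.trans (show dyIndex p.1 y = p.2 from hy).symm
    have e2 : dyIndex p'.1 x' = dyIndex p'.1 y :=
      hx'.trans (show dyIndex p'.1 y = p'.2 from hy').symm
    rcases lt_trichotomy p.1 p'.1 with h | h | h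
    · exact h4' p.1 h1 h (hheavy h.le e2.symm (hheavy le_rfl e1 h3))
    · refine hne (Prod.ext h ?_)
      rw [← hx, ← hx', e1, e2, h]
    · exact h4 p'.1 h1' h (hheavy h.le e1.symm (hheavy le_rfl e2 h3'))
  · intro x hx
    by_contra hcon
    have hhx := hfine x (not_le.1 hcon)
    obtain ⟨n, ⟨hn1, hn2, hn3⟩, hmin⟩ := Int.exists_least_of_bdd
      (P := fun n => n0 ≤ n ∧ n ≤ N ∧ heavy n x) ⟨n0, fun z hz => hz.1⟩
      ⟨N, by lia, le_rfl, hhx⟩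
    refine hx (n, dyIndex n x) (hfin.mem_toFinset.2 ⟨x, rfl, hn1, hn2, hn3, ?_⟩) rfl
    intro n' h1 h2 h3
    exact absurd (hmin n' ⟨h1, by lia, h3⟩) (not_le.2 h2)

end Dyadic

section Mollify

variable {E : Type*} [NormedAddCommGroup E] [InnerProductSpace ℝ E] [FiniteDimensional ℝ E]
  [MeasurableSpace E] [BorelSpace E]

/-- A smooth approximate identity supported in the ball of radius `r`. -/
structure IsMollifier (ρ : E → ℂ) (r : ℝ) : Prop where
  smooth : ContDiff ℝ (⊤ : ℕ∞) ρ
  compact : HasCompactSupport ρ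
  supp : ∀ x, r ≤ ‖x‖ → ρ x = 0
  int_one : ∫ x, ρ x = 1
  norm_one : ∫ x, ‖ρ x‖ = 1

theorem exists_isMollifier {r : ℝ} (hr : 0 < r) : ∃ ρ : E → ℂ, IsMollifier ρ r := by
  let φ : ContDiffBump (0 : E) := ⟨r / 2, r, by positivity, by linarith⟩
  refine ⟨fun x => ((φ.normed volume x : ℝ) : ℂ), ?_, ?_, ?_, ?_, ?_⟩
  · exact Complex.ofRealCLM.contDiff.comp φ.contDiff_normed
  · exact φ.hasCompactSupport_normed.comp_left (g := Complex.ofReal) Complex.ofReal_zero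
  · intro x hx
    have : x ∉ Function.support (φ.normed volume) := by
      rw [φ.support_normed_eq, mem_ball_zero_iff]
      exact not_lt.2 hx
    rw [Function.notMem_support.1 this, Complex.ofReal_zero]
  · rw [integral_complex_ofReal, φ.integral_normed, Complex.ofReal_one]
  · simp only [Complex.norm_real, Real.norm_of_nonneg (φ.nonneg_normed _)]
    exact φ.integral_normed

namespace IsMollifier

variable {ρ : E → ℂ} {r : ℝ} (h : IsMollifier ρ r)
include h

theorem integrable : Integrable ρ :=
  h.smooth.continuous.integrable_of_hasCompactSupport h.compact

theorem bounded : ∃ C, ∀ x, ‖ρ x‖ ≤ C := h.compact.exists_bound_of_continuous h.smooth.continuous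

theorem lintegral_enorm : ∫⁻ x, ‖ρ x‖ₑ = 1 := by
  have := ofReal_integral_norm_eq_lintegral_enorm h.integrable
  rw [← this, h.norm_one, ENNReal.ofReal_one]

theorem norm_cv_le {g : E → ℂ} {C : ℝ} (hC : ∀ x, ‖g x‖ ≤ C) (x : E) : ‖cv g ρ x‖ ≤ C := by
  rw [cv_comm, cv_apply]
  calc _ ≤ ∫ t, ‖ρ t‖ * C := by
        refine norm_integral_le_of_norm_le (h.integrable.norm.mul_const C)
          (Eventually.of_forall fun t => ?_)
        rw [norm_mul]
        exact mul_le_mul_of_nonneg_left (hC _) (norm_nonneg _)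
    _ = C := by rw [integral_mul_const, h.norm_one, one_mul]

theorem norm_sub_cv_le {f : E → ℂ} (hf : Continuous f) (hfb : ∃ C, ∀ x, ‖f x‖ ≤ C) {α : ℝ}
    (hα : ∀ x y, ‖x - y‖ < r → ‖f x - f y‖ ≤ α) (x : E) : ‖f x - cv f ρ x‖ ≤ α := by
  obtain ⟨C, hC⟩ := hfb
  have h1 : Integrable fun t => ρ t * f (x - t) :=
    h.integrable.mul_bdd (by fun_prop) (Eventually.of_forall fun t => hC (x - t))
  have h2 : f x = ∫ t, ρ t * f x := by rw [integral_mul_const, h.int_one, one_mul]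
  rw [cv_comm, cv_apply]
  nth_rw 1 [h2]
  rw [← integral_sub (h.integrable.mul_const _) h1]
  calc _ ≤ ∫ t, ‖ρ t‖ * α := by
        refine norm_integral_le_of_norm_le (h.integrable.norm.mul_const α)
          (Eventually.of_forall fun t => ?_)
        rw [← mul_sub, norm_mul]
        rcases lt_or_ge ‖t‖ r with ht | ht
        · exact mul_le_mul_of_nonneg_left (hα _ _ (by simpa using ht)) (norm_nonneg _)
        · simp [h.supp t ht]
    _ = α := by rw [integral_mul_const, h.norm_one, one_mul]

theorem cv_eq_zero {b : E → ℂ} {c : E} {R R' : ℝ} (hRr : R + r ≤ R')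
    (hb : ∀ x, R < ‖x - c‖ → b x = 0) {x : E} (hx : R' < ‖x - c‖) : cv b ρ x = 0 := by
  rw [cv_apply]
  refine integral_eq_zero_of_ae (Eventually.of_forall fun t => ?_)
  rcases lt_or_ge R ‖t - c‖ with ht | ht
  · simp [hb t ht]
  · have h1 : r ≤ ‖x - t‖ := by
      have := norm_add_le (x - t) (t - c)
      rw [sub_add_sub_cancel] at this
      linarith
    simp [h.supp _ h1]

theorem integral_cv {b : E → ℂ} (hb : Integrable b) : ∫ x, cv b ρ x = ∫ x, b x := by
  have := integral_convolution (ContinuousLinearMap.mul ℂ ℂ) (μ := (volume : Measure E))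
    (ν := volume) hb h.integrable
  rw [h.int_one] at this
  simpa [cv] using this

theorem lintegral_cv_le {b : E → ℂ} (hb : Integrable b) :
    ∫⁻ x, ‖cv b ρ x‖ₑ ≤ ∫⁻ x, ‖b x‖ₑ := by
  refine (_root_.lintegral_cv_le hb.aestronglyMeasurable h.integrable.aestronglyMeasurable).trans ?_
  rw [h.lintegral_enorm, mul_one]

end IsMollifier

end Mollify

section Decomposition

variable {d : ℕ}

/-- The restriction of `f - f_Q` to `Q`. -/
def cubeOsc (f : EuclideanSpace ℝ (Fin d) → ℂ) (Q : Set (EuclideanSpace ℝ (Fin d))) :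
    EuclideanSpace ℝ (Fin d) → ℂ := Q.indicator fun x => f x - ⨍ y in Q, f y

section cubeOsc
variable {f : EuclideanSpace ℝ (Fin d) → ℂ} {Q : Set (EuclideanSpace ℝ (Fin d))}

theorem integrable_cubeOsc (hf : Integrable f) (hQ : MeasurableSet Q) (hQf : volume Q ≠ ∞) :
    Integrable (cubeOsc f Q) := by
  rw [cubeOsc, integrable_indicator_iff hQ]
  exact hf.integrableOn.sub (integrableOn_const hQf)

theorem integral_cubeOsc (hQ : MeasurableSet Q) (hQf : volume Q ≠ ∞) :
    ∫ x, cubeOsc f Q x = 0 := by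
  rw [cubeOsc, integral_indicator hQ]
  have : IsFiniteMeasure (volume.restrict Q) := ⟨by
    rw [Measure.restrict_apply_univ]; exact hQf.lt_top⟩
  exact integral_sub_average _ f

theorem enorm_average_mul_le (hQf : volume Q ≠ ∞) :
    ‖⨍ y in Q, f y‖ₑ * volume Q ≤ ∫⁻ y in Q, ‖f y‖ₑ := by
  rcases eq_or_ne (volume Q) 0 with h0 | h0
  · simp [h0]
  rw [setAverage_eq, enorm_smul]
  have h1 : ‖(volume.real Q)⁻¹‖ₑ = (volume Q)⁻¹ := by
    rw [Real.enorm_eq_ofReal (by positivity), measureReal_def, ENNReal.ofReal_inv_of_pos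
      (ENNReal.toReal_pos h0 hQf), ENNReal.ofReal_toReal hQf]
  rw [h1, mul_right_comm, ENNReal.inv_mul_cancel h0 hQf, one_mul]
  exact enorm_integral_le_lintegral_enorm _

theorem lintegral_cubeOsc_le (hf : Measurable f) (hQ : MeasurableSet Q) (hQf : volume Q ≠ ∞) :
    ∫⁻ x, ‖cubeOsc f Q x‖ₑ ≤ 2 * ∫⁻ x in Q, ‖f x‖ₑ := by
  have h1 : ∀ x, ‖cubeOsc f Q x‖ₑ = Q.indicator (fun x => ‖f x - ⨍ y in Q, f y‖ₑ) x := fun x => by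
    rw [cubeOsc, enorm_indicator_eq_indicator_enorm]
  simp only [h1]
  rw [lintegral_indicator hQ]
  calc _ ≤ ∫⁻ x in Q, (‖f x‖ₑ + ‖⨍ y in Q, f y‖ₑ) := lintegral_mono fun x => enorm_sub_le
    _ = (∫⁻ x in Q, ‖f x‖ₑ) + ‖⨍ y in Q, f y‖ₑ * volume Q := by
        rw [lintegral_add_left hf.enorm, setLIntegral_const]
    _ ≤ (∫⁻ x in Q, ‖f x‖ₑ) + ∫⁻ x in Q, ‖f x‖ₑ := by
        gcongr
        exact enorm_average_mul_le hQf
    _ = _ := (two_mul _).symm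

end cubeOsc

set_option maxHeartbeats 1000000 in
/-- The Calderón–Zygmund decomposition of a test function, with smooth good and bad parts. -/
theorem exists_cz_decomposition (hd : d ≠ 0) {f : EuclideanSpace ℝ (Fin d) → ℂ}
    (hf : ContDiff ℝ (⊤ : ℕ∞) f) (hfc : HasCompactSupport f) {α : ℝ} (hα : 0 < α) :
    ∃ (ι : Type) (_ : Fintype ι)
      (D : Atoms (EuclideanSpace ℝ (Fin d)) ι (ENNReal.ofReal (2 ^ (d + 1) * α)))
      (g : EuclideanSpace ℝ (Fin d) → ℂ),
      ContDiff ℝ (⊤ : ℕ∞) g ∧ HasCompactSupport g ∧ (∀ x, f x = g x + ∑ q, D.fn q x) ∧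
      (∀ x, ‖g x‖ ≤ (2 ^ (d + 1) + 1) * α) ∧
      ∑ q, ∫⁻ x, ‖D.fn q x‖ₑ ≤ 2 * ∫⁻ x, ‖f x‖ₑ ∧
      ENNReal.ofReal α * ∑ q, ENNReal.ofReal (((2 : ℝ) ^ D.scale q) ^ d) ≤
        ENNReal.ofReal ((2 ^ (d + 1)) ^ d) * ∫⁻ x, ‖f x‖ₑ := by
  have hcont := hf.continuous
  have hfi : Integrable f := hcont.integrable_of_hasCompactSupport hfc
  obtain ⟨S, hS0, hS1, hS2, hS3, hS4⟩ := exists_stopping_cubes hd hcont hfc hα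
  have hvol : ∀ p : ℤ × (Fin d → ℤ), volume (dyCube p.1 p.2) ≠ ∞ := fun p => by
    rw [volume_dyCube]; exact ENNReal.ofReal_ne_top
  have hvol0 : ∀ p : ℤ × (Fin d → ℤ), volume (dyCube p.1 p.2) ≠ 0 := fun p => by
    rw [volume_dyCube]
    exact (ENNReal.ofReal_pos.2 (pow_pos (inv_pos.2 (two_zpow_pos _)) _)).ne'
  choose c hc using hS0
  obtain ⟨r0, hr0, hur⟩ := Metric.uniformContinuous_iff.1
    (hfc.uniformContinuous_of_continuous hcont) α hα
  obtain ⟨k, hk⟩ : ∃ k : ℤ, ∀ q : S, k ≤ -q.1.1 := exists_bot_int _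
  have hrpos : 0 < min r0 ((2 : ℝ) ^ k) := lt_min hr0 (two_zpow_pos _)
  obtain ⟨ρ, hρ⟩ := exists_isMollifier (E := EuclideanSpace ℝ (Fin d)) hrpos
  set r := min r0 ((2 : ℝ) ^ k) with hr
  have hmQ : ∀ p : S, MeasurableSet (dyCube p.1.1 p.1.2) := fun p => measurableSet_dyCube _ _
  let b0 : S → EuclideanSpace ℝ (Fin d) → ℂ := fun p => cubeOsc f (dyCube p.1.1 p.1.2)
  have hb0 : ∀ p, Integrable (b0 p) := fun p => integrable_cubeOsc hfi (hmQ p) (hvol _)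
  have hscale : ∀ n : ℤ, (2 : ℝ) ^ ((d : ℤ) + 1 - n) = 2 ^ d * 2 * ((2 : ℝ) ^ n)⁻¹ := by
    intro n
    rw [zpow_sub₀ two_ne_zero, zpow_add₀ two_ne_zero, zpow_natCast, zpow_one, div_eq_mul_inv]
  have hball : ∀ p : S, ∀ x, x ∈ dyCube p.1.1 p.1.2 →
      ‖x - c p.1 p.2‖ ≤ 2 ^ d * ((2 : ℝ) ^ p.1.1)⁻¹ := fun p x hx =>
    norm_sub_le_of_dyIndex_eq ((show dyIndex p.1.1 x = p.1.2 from hx).trans (hc p.1 p.2).symm)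
  have hL1 : ∀ p : S, ∫⁻ x, ‖cv (b0 p) ρ x‖ₑ ≤ 2 * ∫⁻ x in dyCube p.1.1 p.1.2, ‖f x‖ₑ := fun p =>
    (hρ.lintegral_cv_le (hb0 p)).trans (lintegral_cubeOsc_le hcont.measurable (hmQ p) (hvol _))
  let D : Atoms (EuclideanSpace ℝ (Fin d)) S (ENNReal.ofReal (2 ^ (d + 1) * α)) :=
    { scale := fun p => (d : ℤ) + 1 - p.1.1
      center := fun p => c p.1 p.2
      fn := fun p => cv (b0 p) ρ
      cube := fun p => dyCube p.1.1 p.1.2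
      smooth := fun p => contDiff_cv (hb0 p) hρ.smooth hρ.compact
      supp := by
        intro p x hx
        refine hρ.cv_eq_zero (R := 2 ^ d * ((2 : ℝ) ^ p.1.1)⁻¹) ?_ ?_ hx
        · have h1 : r ≤ ((2 : ℝ) ^ p.1.1)⁻¹ := by
            refine (min_le_right _ _).trans ?_
            rw [← zpow_neg]
            exact zpow_le_zpow_right₀ one_le_two (hk p)
          have h2 : (1 : ℝ) ≤ 2 ^ d := one_le_pow₀ one_le_two
          have h3 : 0 < ((2 : ℝ) ^ p.1.1)⁻¹ := inv_pos.2 (two_zpow_pos _)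
          rw [hscale]
          nlinarith
        · intro y hy
          exact Set.indicator_of_notMem (fun hyQ => absurd (hball p y hyQ) (not_le.2 hy)) _
      mean := by
        intro p
        rw [hρ.integral_cv (hb0 p)]
        exact integral_cubeOsc (hmQ p) (hvol _)
      meas := hmQ
      disj := fun p p' hne => hS3 p.1 p.2 p'.1 p'.2 fun h => hne (Subtype.ext h)
      sub := by
        intro p x hx
        rw [mem_closedBall, dist_eq_norm]
        refine (hball p x hx).trans ?_
        have h3 : 0 < ((2 : ℝ) ^ p.1.1)⁻¹ := inv_pos.2 (two_zpow_pos _)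
        have h2 : (1 : ℝ) ≤ 2 ^ d := one_le_pow₀ one_le_two
        rw [hscale]
        nlinarith
      size := by
        intro p
        refine (hL1 p).trans ?_
        refine (mul_le_mul_right (hS2 p.1 p.2) 2).trans_eq ?_
        have h2 : ENNReal.ofReal (2 ^ (d + 1) * α) = 2 * ENNReal.ofReal (2 ^ d * α) := by
          rw [pow_succ, mul_right_comm, mul_comm, ENNReal.ofReal_mul zero_le_two,
            ENNReal.ofReal_ofNat]
        rw [← mul_assoc, h2] }
  have hsumQ : ∑ p : S, ∫⁻ x in dyCube p.1.1 p.1.2, ‖f x‖ₑ ≤ ∫⁻ x, ‖f x‖ₑ := by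
    rw [← lintegral_biUnion_finset (s := Finset.univ) (t := fun p : S => dyCube p.1.1 p.1.2)
      (fun p _ p' _ hne => D.disj hne) (fun p _ => hmQ p)]
    exact setLIntegral_le_lintegral _ _
  have hDc : HasCompactSupport fun x => ∑ q, D.fn q x := by
    have : ∀ T : Finset S, HasCompactSupport fun x => ∑ q ∈ T, D.fn q x := by
      classical
      intro T
      induction T using Finset.induction_on with
      | empty =>
        simp only [Finset.sum_empty]
        exact (HasCompactSupport.zero : HasCompactSupport (0 : EuclideanSpace ℝ (Fin d) → ℂ))
      | insert q T hq ih =>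
        simp only [Finset.sum_insert hq]
        exact (D.hasCompactSupport q).add ih
    exact this _
  refine ⟨S, inferInstance, D, fun x => f x - ∑ q, D.fn q x,
    hf.sub (ContDiff.sum fun q _ => D.smooth q), hfc.sub hDc, fun x => by ring, ?_, ?_, ?_⟩
  · intro x
    -- the unmollified good function
    have hg0 : ∀ y, ‖f y - ∑ q, b0 q y‖ ≤ 2 ^ (d + 1) * α := by
      intro y
      by_cases hy : ∃ p : S, y ∈ dyCube p.1.1 p.1.2
      · obtain ⟨p, hp⟩ := hy
        have h1 : ∑ q, b0 q y = b0 p y := by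
          refine Finset.sum_eq_single p (fun q _ hq => ?_) (by simp)
          exact Set.indicator_of_notMem (fun hyq => Set.disjoint_left.1 (D.disj hq) hyq hp) _
        have h2 : b0 p y = f y - ⨍ z in dyCube p.1.1 p.1.2, f z := Set.indicator_of_mem hp _
        rw [h1, h2, _root_.sub_sub_cancel]
        have h3 := (enorm_average_mul_le (f := f) (hvol p.1)).trans (hS2 p.1 p.2)
        rw [ENNReal.mul_le_mul_iff_left (hvol0 _) (hvol _), ← ofReal_norm,
          ENNReal.ofReal_le_ofReal_iff (by positivity)] at h3
        refine h3.trans ?_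
        rw [pow_succ]
        have : (0 : ℝ) ≤ 2 ^ d * α := by positivity
        linarith
      · have h1 : ∑ q, b0 q y = 0 := Finset.sum_eq_zero fun q _ =>
          Set.indicator_of_notMem (fun h => hy ⟨q, h⟩) _
        rw [h1, sub_zero]
        refine (hS4 y fun p hp h => hy ⟨⟨p, hp⟩, h⟩).trans ?_
        rw [pow_succ]
        have h2 : (1 : ℝ) ≤ 2 ^ d := one_le_pow₀ one_le_two
        nlinarith
    have h1 : cv (fun y => f y - ∑ q, b0 q y) ρ x = cv f ρ x - ∑ q, cv (b0 q) ρ x := by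
      have e : ∀ h : EuclideanSpace ℝ (Fin d) → ℂ, Integrable h →
          Integrable fun t => h t * ρ (x - t) := fun h hh => by
        obtain ⟨C, hC⟩ := hρ.bounded
        have := hρ.smooth.continuous
        exact hh.mul_bdd (by fun_prop) (Eventually.of_forall fun t => hC (x - t))
      rw [← cv_finset_sum _ (fun q _ => hb0 q) hρ.smooth.continuous hρ.bounded]
      simp only [cv_apply, sub_mul]
      exact integral_sub (e f hfi) (e _ (integrable_finsetSum _ fun q _ => hb0 q))
    have h2 : f x - ∑ q, D.fn q x = (f x - cv f ρ x) + cv (fun y => f y - ∑ q, b0 q y) ρ x := by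
      rw [h1]; ring
    refine (congrArg norm h2).trans_le ?_
    refine (norm_add_le _ _).trans ?_
    have h3 := hρ.norm_sub_cv_le hcont (hfc.exists_bound_of_continuous hcont) (α := α)
      (fun y z hyz => by
        have := hur (a := y) (b := z) (by
          rw [dist_eq_norm]; exact hyz.trans_le (min_le_left _ _))
        rw [dist_eq_norm] at this
        exact this.le) x
    have h4 := hρ.norm_cv_le hg0 x
    linarith
  · calc ∑ q, ∫⁻ x, ‖D.fn q x‖ₑ ≤ ∑ p : S, 2 * ∫⁻ x in dyCube p.1.1 p.1.2, ‖f x‖ₑ :=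
          Finset.sum_le_sum fun p _ => hL1 p
      _ ≤ _ := by
          rw [← Finset.mul_sum]
          exact mul_le_mul_right hsumQ _
  · rw [Finset.mul_sum]
    calc ∑ q : S, ENNReal.ofReal α * ENNReal.ofReal (((2 : ℝ) ^ D.scale q) ^ d)
        ≤ ∑ p : S, ENNReal.ofReal ((2 ^ (d + 1)) ^ d) * ∫⁻ x in dyCube p.1.1 p.1.2, ‖f x‖ₑ := by
          refine Finset.sum_le_sum fun p _ => ?_
          refine le_trans (le_of_eq ?_) (mul_le_mul_right (hS1 p.1 p.2) _)
          have h3 : 0 < ((2 : ℝ) ^ p.1.1)⁻¹ := inv_pos.2 (two_zpow_pos _)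
          change ENNReal.ofReal α * ENNReal.ofReal (((2 : ℝ) ^ ((d : ℤ) + 1 - p.1.1)) ^ d) = _
          rw [hscale, volume_dyCube, mul_pow _ ((2 : ℝ) ^ p.1.1)⁻¹ d, ← pow_succ,
            ENNReal.ofReal_mul (p := ((2 : ℝ) ^ (d + 1)) ^ d) (by positivity)]
          ring
      _ ≤ _ := by
          rw [← Finset.mul_sum]
          exact mul_le_mul_right hsumQ _

end Decomposition

section FixedScale

variable {E : Type*} [NormedAddCommGroup E] [InnerProductSpace ℝ E] [FiniteDimensional ℝ E]
  [MeasurableSpace E] [BorelSpace E]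

theorem measurable_lintegral_sub_mul {h β : E → ℝ≥0∞} (hh : Measurable h) (hβ : Measurable β) :
    Measurable fun x => ∫⁻ y, h (x - y) * β y :=
  have hm : Measurable fun p : E × E => h (p.1 - p.2) * β p.2 := by fun_prop
  hm.lintegral_prod_right'

theorem lintegral_lintegral_sub_mul {h β : E → ℝ≥0∞} (hh : Measurable h) (hβ : Measurable β) :
    ∫⁻ x, ∫⁻ y, h (x - y) * β y = (∫⁻ x, h x) * ∫⁻ y, β y := by
  have hm : Measurable fun p : E × E => h (p.1 - p.2) * β p.2 := by fun_prop
  rw [lintegral_lintegral_swap hm.aemeasurable]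
  have h1 : ∀ y, ∫⁻ x, h (x - y) * β y = (∫⁻ x, h x) * β y := fun y => by
    have h2 : Measurable fun x => h (x - y) := by fun_prop
    rw [lintegral_mul_const _ h2, lintegral_sub_right_eq_self]
  simp only [h1]
  exact lintegral_const_mul _ hβ

/-- The modulating factor of a variable kernel `f w * M y w / ‖w‖ ^ d`, with `w = x - y`. -/
structure IsModulator (M : E → E → ℂ) : Prop where
  meas : Measurable fun p : E × E => M p.1 p.2
  norm_le : ∀ y w, ‖M y w‖ ≤ 1
  radial : ∀ y θ, ‖θ‖ = 1 → ∀ r r' : ℝ, 0 < r → 0 < r' →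
    ‖M y (r • θ) - M y (r' • θ)‖ ≤ |r - r'| / r
  transl : ∀ y c w, ‖M y w - M c w‖ ≤ ‖y - c‖ / ‖w‖

namespace IsModulator

variable {M : E → E → ℂ} (hM : IsModulator M)
include hM

theorem measurable_right (y : E) : Measurable (M y) := hM.meas.of_uncurry_left

theorem measurable_skern (j : ℤ) {f : E → ℂ} (hf : Measurable f) (x : E) :
    Measurable fun y => skern j f (M y) (x - y) := by
  have h1 : Measurable fun y => M y (x - y) :=
    hM.meas.comp (measurable_id.prodMk (measurable_const.sub measurable_id))
  have h2 : Measurable fun y => f (x - y) * M y (x - y) *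
      (((‖x - y‖ ^ Module.finrank ℝ E)⁻¹ : ℝ) : ℂ) := by
    have h3 : Measurable fun y => (‖x - y‖ ^ Module.finrank ℝ E)⁻¹ := by fun_prop
    exact ((hf.comp (measurable_const.sub measurable_id)).mul h1).mul
      (Complex.measurable_ofReal.comp h3)
  exact h2.indicator ((measurableSet_shell j).preimage (measurable_const.sub measurable_id))

theorem norm_skern_le (j : ℤ) (f : E → ℂ) (x y : E) :
    ‖skern j f (M y) (x - y)‖ ≤ ‖skern j f (fun _ => 1) (x - y)‖ := by
  by_cases h : x - y ∈ shell E j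
  · simp only [skern, Set.indicator_of_mem h, norm_mul, mul_one]
    have := hM.norm_le y (x - y)
    gcongr
    exact mul_le_of_le_one_right (norm_nonneg _) this
  · simp only [skern, Set.indicator_of_notMem h, le_refl]

theorem integrable_skern_mul [Nontrivial E] (j : ℤ) {f : E → ℂ} (hf : Measurable f)
    (hom : ∀ r : ℝ, 0 < r → ∀ x : E, x ≠ 0 → f (r • x) = f x)
    (hfi : ∫⁻ θ : sphere (0 : E) 1, ‖f θ‖ₑ ∂(volume : Measure E).toSphere < ∞)
    {b : E → ℂ} (hb : Continuous b) (hbb : ∃ C, ∀ x, ‖b x‖ ≤ C) (x : E) :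
    Integrable fun y => skern j f (M y) (x - y) * b y := by
  obtain ⟨C, hC⟩ := hbb
  have h1 : Integrable fun y => skern j f (fun _ => 1) (x - y) :=
    (integrable_skern j hf measurable_const hom (by simp) hfi).comp_sub_left x
  have h2 : Integrable fun y => skern j f (M y) (x - y) :=
    h1.mono (hM.measurable_skern j hf x).aestronglyMeasurable
      (Eventually.of_forall fun y => hM.norm_skern_le j f x y)
  exact h2.mul_bdd hb.aestronglyMeasurable (Eventually.of_forall hC)

end IsModulator

/-- The part of `f` where it is at most `B`. -/
def loPart (f : E → ℂ) (B : ℝ) : E → ℂ := {w | ‖f w‖ ≤ B}.indicator f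

section loPart
variable {f : E → ℂ} {B : ℝ}

theorem measurable_loPart (hf : Measurable f) : Measurable (loPart f B) :=
  hf.indicator (measurableSet_le hf.norm measurable_const)

theorem norm_loPart_le (hB : 0 ≤ B) (w : E) : ‖loPart f B w‖ ≤ B := by
  by_cases h : w ∈ {w | ‖f w‖ ≤ B}
  · rw [loPart, Set.indicator_of_mem h]; exact h
  · rw [loPart, Set.indicator_of_notMem h, norm_zero]; exact hB

theorem enorm_loPart_le (w : E) : ‖loPart f B w‖ₑ ≤ ‖f w‖ₑ :=
  enorm_indicator_le_enorm_self _ _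

theorem loPart_smul (hom : ∀ r : ℝ, 0 < r → ∀ x : E, x ≠ 0 → f (r • x) = f x)
    (r : ℝ) (hr : 0 < r) (x : E) (hx : x ≠ 0) : loPart f B (r • x) = loPart f B x := by
  simp only [loPart, Set.indicator, Set.mem_ofPred_eq, hom r hr x hx]

theorem measurable_sub_loPart (hf : Measurable f) : Measurable fun w => f w - loPart f B w :=
  hf.sub (measurable_loPart hf)

end loPart

/-- The pointwise bound for freezing the modulator and truncating `f`. -/
theorem enorm_skern_sub_le {M : E → E → ℂ} (hM : IsModulator M) {i : ℤ} {s : ℕ} {f : E → ℂ}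
    {B : ℝ} {c y : E} (hy : ‖y - c‖ ≤ 2 ^ i) (w : E) :
    ‖skern (i + s) f (M y) w - skern (i + s) (loPart f B) (M c) w‖ₑ ≤
      (shell E (i + s)).indicator (fun w => (‖f w - loPart f B w‖ₑ +
        ENNReal.ofReal (((2 : ℝ) ^ s)⁻¹) * ‖f w‖ₑ) *
        ENNReal.ofReal ((‖w‖ ^ Module.finrank ℝ E)⁻¹)) w := by
  by_cases h : w ∈ shell E (i + s)
  · simp only [skern, Set.indicator_of_mem h]
    rw [← sub_mul, enorm_mul]
    have h1 : ‖((((‖w‖ ^ Module.finrank ℝ E)⁻¹ : ℝ)) : ℂ)‖ₑ =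
        ENNReal.ofReal ((‖w‖ ^ Module.finrank ℝ E)⁻¹) := by
      rw [← ofReal_norm, Complex.norm_real, Real.norm_of_nonneg (by positivity)]
    rw [h1]
    refine mul_le_mul_left ?_ _
    have h2 : f w * M y w - loPart f B w * M c w =
        (f w - loPart f B w) * M y w + loPart f B w * (M y w - M c w) := by ring
    rw [h2]
    refine (enorm_add_le _ _).trans (add_le_add ?_ ?_)
    · rw [enorm_mul]
      refine mul_le_of_le_one_right' ?_
      rw [← ofReal_norm]
      exact ENNReal.ofReal_le_one.2 (hM.norm_le y w)
    · rw [enorm_mul, mul_comm]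
      refine mul_le_mul' ?_ (enorm_loPart_le w)
      rw [← ofReal_norm]
      refine ENNReal.ofReal_le_ofReal ((hM.transl y c w).trans ?_)
      have hi := two_zpow_pos i
      have hw := h.1
      rw [zpow_add₀ two_ne_zero, zpow_natCast] at hw
      rw [div_le_iff₀ (lt_of_lt_of_le (by positivity) hw), inv_mul_eq_div,
        le_div_iff₀ (by positivity)]
      nlinarith [pow_pos (two_pos : (0 : ℝ) < 2) s]
  · simp [skern, Set.indicator_of_notMem h]

set_option maxHeartbeats 1000000 in
/-- The contribution of a fixed relative scale `s` for a variable kernel. -/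
theorem exists_splitting_variable [Nontrivial E] {ι : Type*} [Fintype ι] {s m : ℕ}
    (hms : 3 * m ≤ s) {α : ℝ≥0∞} (D : Atoms E ι α) {f : E → ℂ} (hf : Measurable f)
    (hom : ∀ r : ℝ, 0 < r → ∀ x : E, x ≠ 0 → f (r • x) = f x)
    (hfi : ∫⁻ θ : sphere (0 : E) 1, ‖f θ‖ₑ ∂(volume : Measure E).toSphere < ∞)
    {B : ℝ} (hB : 0 ≤ B) {M : E → E → ℂ} (hM : IsModulator M) :
    ∃ G Z : E → ℝ≥0∞, Measurable G ∧ Measurable Z ∧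
      (∀ x, ‖∑ q, ∫ y, skern (D.scale q + s) f (M y) (x - y) * D.fn q y‖ₑ ≤ G x + Z x) ∧
      ∫⁻ x, Z x ≤
        ((∫⁻ θ : sphere (0 : E) 1, ‖f θ - loPart f B θ‖ₑ ∂(volume : Measure E).toSphere) +
        (ENNReal.ofReal (((2 : ℝ) ^ s)⁻¹) + singC E * ENNReal.ofReal ((2 : ℝ) ^ (-(m : ℤ)))) *
          (∫⁻ θ : sphere (0 : E) 1, ‖f θ‖ₑ ∂(volume : Measure E).toSphere)) *
          ∑ q, ∫⁻ x, ‖D.fn q x‖ₑ ∧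
      ∫⁻ x, G x ^ 2 ≤ sqC E * ENNReal.ofReal ((2 : ℝ) ^ (-(m : ℤ))) *
        ENNReal.ofReal B ^ 2 * α * ∑ q, ∫⁻ x, ‖D.fn q x‖ₑ := by
  have hlm := measurable_loPart (B := B) hf
  have hlh := loPart_smul (B := B) hom
  have hlb := norm_loPart_le (f := f) hB
  have hli : ∫⁻ θ : sphere (0 : E) 1, ‖loPart f B θ‖ₑ ∂(volume : Measure E).toSphere < ∞ :=
    lintegral_sphere_lt_top_of_bounded hlb
  obtain ⟨G, hG, hG1, hG2⟩ := exists_splitting hms D hlm hlh hlb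
    (M := fun q => M (D.center q)) (fun q => hM.measurable_right _) (fun q => hM.norm_le _)
    (fun q θ hθ => hM.radial _ θ hθ)
  let φ : E → ℝ≥0∞ := fun w => ‖f w - loPart f B w‖ₑ +
    ENNReal.ofReal (((2 : ℝ) ^ s)⁻¹) * ‖f w‖ₑ
  have hφm : Measurable φ := (measurable_sub_loPart hf).enorm.add (hf.enorm.const_mul _)
  have hφh : ∀ r : ℝ, 0 < r → ∀ x : E, x ≠ 0 → φ (r • x) = φ x := fun r hr x hx => by
    simp only [φ, hom r hr x hx, hlh r hr x hx]
  let h : ℤ → E → ℝ≥0∞ := fun j => (shell E j).indicator fun w => φ w *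
    ENNReal.ofReal ((‖w‖ ^ Module.finrank ℝ E)⁻¹)
  have hhm : ∀ j, Measurable (h j) := fun j =>
    (hφm.mul (by fun_prop)).indicator (measurableSet_shell j)
  have hbm : ∀ q, Measurable fun y => ‖D.fn q y‖ₑ := fun q => (D.continuous q).measurable.enorm
  let P : E → ℝ≥0∞ := fun x => ∑ q, ∫⁻ y, h (D.scale q + s) (x - y) * ‖D.fn q y‖ₑ
  have hP : Measurable P := Finset.measurable_fun_sum _ fun q _ =>
    measurable_lintegral_sub_mul (hhm _) (hbm q)
  have hski : ∀ q, Integrable (skern (D.scale q + s) (loPart f B) (M (D.center q))) := fun q =>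
    integrable_skern _ hlm (hM.measurable_right _) hlh (hM.norm_le _) hli
  have hcvc : ∀ q, Continuous (cv (skern (D.scale q + s) (loPart f B) (M (D.center q)))
      (D.fn q)) := fun q => continuous_cv (hski q) (D.continuous q) (D.bounded q)
  let R : E → ℝ≥0∞ := fun x => ‖(∑ q, cv (skern (D.scale q + s) (loPart f B) (M (D.center q)))
    (D.fn q) x) - G x‖ₑ
  have hR : Measurable R :=
    ((continuous_finsetSum _ fun q _ => hcvc q).sub hG).measurable.enorm
  refine ⟨fun x => ‖G x‖ₑ, fun x => P x + R x, hG.measurable.enorm, hP.add hR, ?_, ?_, hG2⟩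
  · intro x
    have h1 : ∀ q, ‖(∫ y, skern (D.scale q + s) f (M y) (x - y) * D.fn q y) -
        cv (skern (D.scale q + s) (loPart f B) (M (D.center q))) (D.fn q) x‖ₑ ≤
        ∫⁻ y, h (D.scale q + s) (x - y) * ‖D.fn q y‖ₑ := by
      intro q
      have i2 : Integrable fun y =>
          skern (D.scale q + s) (loPart f B) (M (D.center q)) (x - y) * D.fn q y := by
        obtain ⟨C, hC⟩ := D.bounded q
        exact ((hski q).comp_sub_left x).mul_bdd (D.continuous q).aestronglyMeasurable
          (Eventually.of_forall hC)
      rw [cv_comm, cv_apply]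
      simp only [mul_comm (D.fn q _)]
      rw [← integral_sub (hM.integrable_skern_mul _ hf hom hfi (D.continuous q) (D.bounded q) x) i2]
      refine (enorm_integral_le_lintegral_enorm _).trans (lintegral_mono fun y => ?_)
      rw [← sub_mul, enorm_mul]
      rcases lt_or_ge ((2 : ℝ) ^ D.scale q) ‖y - D.center q‖ with hy | hy
      · simp [D.supp q y hy]
      · exact mul_le_mul_left (enorm_skern_sub_le hM hy (x - y)) _
    calc _ = ‖G x + ((∑ q, ((∫ y, skern (D.scale q + s) f (M y) (x - y) * D.fn q y) -
        cv (skern (D.scale q + s) (loPart f B) (M (D.center q))) (D.fn q) x)) +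
        ((∑ q, cv (skern (D.scale q + s) (loPart f B) (M (D.center q))) (D.fn q) x) - G x))‖ₑ := by
          rw [Finset.sum_sub_distrib]
          congr 1
          ring
      _ ≤ ‖G x‖ₑ + (‖∑ q, ((∫ y, skern (D.scale q + s) f (M y) (x - y) * D.fn q y) -
        cv (skern (D.scale q + s) (loPart f B) (M (D.center q))) (D.fn q) x)‖ₑ + R x) :=
          (enorm_add_le _ _).trans (add_le_add le_rfl (enorm_add_le _ _))
      _ ≤ _ := by
          refine add_le_add le_rfl (add_le_add ?_ le_rfl)
          exact (enorm_sum_le _ _).trans (Finset.sum_le_sum fun q _ => h1 q)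
  · rw [lintegral_add_left hP, lintegral_finsetSum _ fun q _ =>
      measurable_lintegral_sub_mul (hhm _) (hbm q)]
    have hsph : ∫⁻ θ : sphere (0 : E) 1, φ θ ∂(volume : Measure E).toSphere =
        (∫⁻ θ : sphere (0 : E) 1, ‖f θ - loPart f B θ‖ₑ ∂(volume : Measure E).toSphere) +
        ENNReal.ofReal (((2 : ℝ) ^ s)⁻¹) *
        ∫⁻ θ : sphere (0 : E) 1, ‖f θ‖ₑ ∂(volume : Measure E).toSphere := by
      have hm1 : Measurable fun θ : sphere (0 : E) 1 => ‖f θ - loPart f B θ‖ₑ :=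
        (measurable_sub_loPart hf).enorm.comp measurable_subtype_coe
      have hm2 : Measurable fun θ : sphere (0 : E) 1 => ‖f θ‖ₑ :=
        hf.enorm.comp measurable_subtype_coe
      simp only [φ]
      rw [lintegral_add_left hm1, lintegral_const_mul _ hm2]
    have h2 : ∑ q, ∫⁻ x, ∫⁻ y, h (D.scale q + s) (x - y) * ‖D.fn q y‖ₑ ≤
        (∫⁻ θ : sphere (0 : E) 1, φ θ ∂(volume : Measure E).toSphere) *
        ∑ q, ∫⁻ x, ‖D.fn q x‖ₑ := by
      rw [Finset.mul_sum]
      refine Finset.sum_le_sum fun q _ => ?_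
      rw [lintegral_lintegral_sub_mul (hhm _) (hbm q)]
      exact mul_le_mul_left (lintegral_shell_le hφm hφh _) _
    refine (add_le_add h2 hG1).trans ?_
    rw [hsph, add_mul (ENNReal.ofReal (((2 : ℝ) ^ s)⁻¹)), add_mul, add_mul, add_mul, ← add_assoc]
    refine add_le_add le_rfl (mul_le_mul_left (mul_le_mul_right ?_ _) _)
    exact lintegral_mono fun θ => enorm_loPart_le _

end FixedScale

section SumScales

variable {E : Type*} [NormedAddCommGroup E] [InnerProductSpace ℝ E] [FiniteDimensional ℝ E]
  [MeasurableSpace E] [BorelSpace E]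

theorem tsum_nat_div_fifteen (g : ℕ → ℝ≥0∞) : ∑' s : ℕ, g (s / 15) = 15 * ∑' p, g p := by
  rw [← (Nat.divModEquiv 15).symm.tsum_eq, ← ENNReal.tsum_mul_left]
  have h1 : ∀ p : ℕ × Fin 15, g ((Nat.divModEquiv 15).symm p / 15) = g p.1 := fun p => by
    congr 1
    exact congrArg Prod.fst ((Nat.divModEquiv 15).apply_symm_apply p)
  simp only [h1]
  rw [ENNReal.tsum_prod (f := fun a _ => g a)]
  simp

theorem tsum_two_pow_inv_ennreal : ∑' p : ℕ, ENNReal.ofReal (((2 : ℝ) ^ p)⁻¹) = 2 := by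
  have h1 : ∀ p : ℕ, ENNReal.ofReal (((2 : ℝ) ^ p)⁻¹) = (2⁻¹ : ℝ≥0∞) ^ p := fun p => by
    rw [← inv_pow, ENNReal.ofReal_pow (by norm_num), ENNReal.ofReal_inv_of_pos (by norm_num)]
    simp
  simp only [h1]
  rw [ENNReal.tsum_geometric, ENNReal.one_sub_inv_two, inv_inv]

/-- The truncation errors at the levels `2 ^ p * N` sum to an `L log L` quantity. -/
theorem tsum_enorm_sub_loPart_le (f : E → ℂ) {N : ℝ} (hN : 0 < N) (w : E) :
    ∑' p : ℕ, ‖f w - loPart f (2 ^ p * N) w‖ₑ ≤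
      2 * (‖f w‖ₑ * ENNReal.ofReal (1 + max (Real.log (‖f w‖ / N)) 0)) := by
  set t := ‖f w‖ / N with ht
  set k := ⌈Real.log t / Real.log 2⌉₊ with hk
  have hl2 : 1 / 2 < Real.log 2 := by linarith [Real.log_two_gt_d9]
  have h1 : ∀ p ∉ Finset.range k, ‖f w - loPart f (2 ^ p * N) w‖ₑ = 0 := by
    intro p hp
    have hp' : Real.log t / Real.log 2 ≤ p := Nat.ceil_le.1 (not_lt.1 fun h => hp (Finset.mem_range.2 h))
    have h2 : ‖f w‖ ≤ 2 ^ p * N := by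
      rw [← div_le_iff₀ hN]
      rcases le_or_gt t 0 with h | h
      · exact h.trans (by positivity)
      · rw [← Real.log_le_log_iff h (by positivity), Real.log_pow]
        rwa [div_le_iff₀ (by linarith)] at hp'
    have h3 : w ∈ {w | ‖f w‖ ≤ 2 ^ p * N} := h2
    rw [loPart, Set.indicator_of_mem h3, sub_self, enorm_zero]
  rw [tsum_eq_sum h1]
  have h4 : ∀ p ∈ Finset.range k, ‖f w - loPart f (2 ^ p * N) w‖ₑ ≤ ‖f w‖ₑ := by
    intro p _
    by_cases h : w ∈ {w | ‖f w‖ ≤ 2 ^ p * N}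
    · rw [loPart, Set.indicator_of_mem h, sub_self, enorm_zero]; exact zero_le
    · rw [loPart, Set.indicator_of_notMem h, sub_zero]
  refine (Finset.sum_le_card_nsmul _ _ _ h4).trans ?_
  rw [Finset.card_range, nsmul_eq_mul, mul_comm ‖f w‖ₑ, ← mul_assoc]
  refine mul_le_mul_left ?_ _
  have h5 : (k : ℝ) ≤ 2 * (1 + max (Real.log t) 0) := by
    rcases le_or_gt (Real.log t) 0 with h | h
    · have : k = 0 := by
        rw [hk, Nat.ceil_eq_zero]
        exact div_nonpos_of_nonpos_of_nonneg h (by linarith)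
      rw [this, max_eq_right h]; norm_num
    · have h6 := (Nat.ceil_lt_add_one (a := Real.log t / Real.log 2) (by positivity)).le
      rw [← hk] at h6
      have h7 : Real.log t / Real.log 2 ≤ 2 * Real.log t := by
        rw [div_le_iff₀ (by linarith)]; nlinarith
      rw [max_eq_left h.le]
      linarith
  calc (k : ℝ≥0∞) = ENNReal.ofReal k := (ENNReal.ofReal_natCast k).symm
    _ ≤ ENNReal.ofReal (2 * (1 + max (Real.log t) 0)) := ENNReal.ofReal_le_ofReal h5
    _ = _ := by rw [ENNReal.ofReal_mul (by norm_num)]; simp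

/-- The `s`-th relative scale of the operator with kernel `f w * M y w / ‖w‖ ^ d`, applied to the
sum of the atoms. -/
def scaleSum {ι : Type*} [Fintype ι] {α : ℝ≥0∞} (D : Atoms E ι α) (f : E → ℂ) (M : E → E → ℂ)
    (s : ℕ) (x : E) : ℂ :=
  ∑ q, ∫ y, skern (D.scale q + s) f (M y) (x - y) * D.fn q y

theorem measure_lt_le_sq {G : E → ℝ≥0∞} (hG : Measurable G) {c : ℝ≥0∞} (hc : c ≠ 0)
    (hc' : c ≠ ∞) : volume {x | c < G x} ≤ (∫⁻ x, G x ^ 2) / c ^ 2 := by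
  refine (measure_mono (t := {x | c ^ 2 ≤ G x ^ 2}) fun x hx => ?_).trans
    (meas_ge_le_lintegral_div (hG.pow_const 2).aemeasurable (by positivity) (by finiteness))
  exact pow_le_pow_left' (le_of_lt (show c < G x from hx)) 2

set_option maxHeartbeats 1000000 in
/-- The weak type estimate for the bad part away from the atoms. -/
theorem volume_scaleSum_le [Nontrivial E] {ι : Type*} [Fintype ι]
    {α : ℝ≥0∞} (D : Atoms E ι α) {f : E → ℂ} (hf : Measurable f)
    (hom : ∀ r : ℝ, 0 < r → ∀ x : E, x ≠ 0 → f (r • x) = f x)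
    {N : ℝ} (hN : 0 < N)
    (hfi : ∫⁻ θ : sphere (0 : E) 1, ‖f θ‖ₑ ∂(volume : Measure E).toSphere = ENNReal.ofReal N)
    {M : E → E → ℂ} (hM : IsModulator M) {l : ℝ} (hl : 0 < l) :
    volume {x | ∃ n, ENNReal.ofReal (l / 2) < ‖∑ s ∈ Finset.range n, scaleSum D f M s x‖ₑ} ≤
      ((30 * (∫⁻ θ : sphere (0 : E) 1, ‖f θ‖ₑ *
        ENNReal.ofReal (1 + max (Real.log (‖f θ‖ / N)) 0) ∂(volume : Measure E).toSphere) +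
        (30 + 30 * singC E) * ENNReal.ofReal N) * ∑ q, ∫⁻ x, ‖D.fn q x‖ₑ) /
          ENNReal.ofReal (l / 4) +
      30 * (ENNReal.ofReal ((120 / l) ^ 2) * (sqC E * ENNReal.ofReal N ^ 2 * α *
        ∑ q, ∫⁻ x, ‖D.fn q x‖ₑ)) := by
  set W := ∑ q, ∫⁻ x, ‖D.fn q x‖ₑ with hW
  have hex : ∀ s : ℕ, _ := fun s => exists_splitting_variable (s := s) (m := 5 * (s / 15))
    (by omega) D hf hom (by rw [hfi]; exact ENNReal.ofReal_lt_top)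
    (B := 2 ^ (s / 15) * N) (by positivity) hM
  choose G Z hGm hZm hGZ hZ hG using hex
  have hpow5 : ∀ p : ℕ, (2 : ℝ) ^ (-((5 * p : ℕ) : ℤ)) = ((2 : ℝ) ^ p)⁻¹ ^ 5 := fun p => by
    rw [zpow_neg, zpow_natCast, inv_pow, ← pow_mul, mul_comm]
  have hp1 : ∀ p : ℕ, ((2 : ℝ) ^ p)⁻¹ ≤ 1 := fun p =>
    inv_le_one_of_one_le₀ (one_le_pow₀ (by norm_num))
  have hZ' : ∀ s : ℕ, ∫⁻ x, Z s x ≤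
      (∫⁻ θ : sphere (0 : E) 1, ‖f θ - loPart f (2 ^ (s / 15) * N) θ‖ₑ
        ∂(volume : Measure E).toSphere) * W + ENNReal.ofReal (((2 : ℝ) ^ (s / 15))⁻¹) *
          ((1 + singC E) * ENNReal.ofReal N * W) := by
    intro s
    refine (hZ s).trans ?_
    rw [hfi, hpow5, add_mul]
    refine add_le_add le_rfl ?_
    have h1 : ENNReal.ofReal (((2 : ℝ) ^ s)⁻¹) ≤ ENNReal.ofReal (((2 : ℝ) ^ (s / 15))⁻¹) :=
      ENNReal.ofReal_le_ofReal (inv_anti₀ (by positivity)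
        (pow_le_pow_right₀ (by norm_num) (Nat.div_le_self _ _)))
    have h2 : ENNReal.ofReal (((2 : ℝ) ^ (s / 15))⁻¹ ^ 5) ≤
        ENNReal.ofReal (((2 : ℝ) ^ (s / 15))⁻¹) :=
      ENNReal.ofReal_le_ofReal (pow_le_of_le_one (by positivity) (hp1 _) (by norm_num))
    calc _ ≤ (ENNReal.ofReal (((2 : ℝ) ^ (s / 15))⁻¹) + singC E *
        ENNReal.ofReal (((2 : ℝ) ^ (s / 15))⁻¹)) * ENNReal.ofReal N * W := by gcongr
      _ = _ := by ring
  have hZs : ∑' s, ∫⁻ x, Z s x ≤ (30 * (∫⁻ θ : sphere (0 : E) 1, ‖f θ‖ₑ *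
        ENNReal.ofReal (1 + max (Real.log (‖f θ‖ / N)) 0) ∂(volume : Measure E).toSphere) +
        (30 + 30 * singC E) * ENNReal.ofReal N) * W := by
    refine (ENNReal.tsum_le_tsum hZ').trans ?_
    rw [ENNReal.tsum_add, ENNReal.tsum_mul_right, ENNReal.tsum_mul_right,
      tsum_nat_div_fifteen (fun p => ENNReal.ofReal (((2 : ℝ) ^ p)⁻¹)), tsum_two_pow_inv_ennreal,
      tsum_nat_div_fifteen (fun p => ∫⁻ θ : sphere (0 : E) 1, ‖f θ - loPart f (2 ^ p * N) θ‖ₑ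
        ∂(volume : Measure E).toSphere), add_mul _ _ W]
    refine add_le_add (mul_le_mul_left ?_ _) (le_of_eq (by ring))
    have hm1 : ∀ p : ℕ, Measurable fun θ : sphere (0 : E) 1 =>
        ‖f θ - loPart f (2 ^ p * N) θ‖ₑ := fun p =>
      (measurable_sub_loPart hf).enorm.comp measurable_subtype_coe
    have hm2 : Measurable fun θ : sphere (0 : E) 1 => ‖f θ‖ₑ *
        ENNReal.ofReal (1 + max (Real.log (‖f θ‖ / N)) 0) := by
      have : Measurable fun θ : sphere (0 : E) 1 => f θ := hf.comp measurable_subtype_coe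
      fun_prop
    rw [← lintegral_tsum fun p => (hm1 p).aemeasurable]
    calc _ ≤ 15 * ∫⁻ θ : sphere (0 : E) 1, 2 * (‖f θ‖ₑ *
        ENNReal.ofReal (1 + max (Real.log (‖f θ‖ / N)) 0)) ∂(volume : Measure E).toSphere := by
          gcongr with θ
          exact tsum_enorm_sub_loPart_le f hN θ
      _ = _ := by
          rw [lintegral_const_mul _ hm2, ← mul_assoc]
          norm_num
  have hGs : ∀ s : ℕ, volume {x | ENNReal.ofReal (((2 : ℝ) ^ (s / 15))⁻¹ * (l / 120)) < G s x} ≤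
      ENNReal.ofReal (((2 : ℝ) ^ (s / 15))⁻¹) * (ENNReal.ofReal ((120 / l) ^ 2) *
        (sqC E * ENNReal.ofReal N ^ 2 * α * W)) := by
    intro s
    refine (measure_lt_le_sq (hGm s) (by simp; positivity) ENNReal.ofReal_ne_top).trans ?_
    refine ENNReal.div_le_of_le_mul ?_
    refine (hG s).trans (le_of_eq ?_)
    rw [hpow5, ENNReal.ofReal_mul (p := 2 ^ (s / 15)) (by positivity), mul_pow (ENNReal.ofReal (2 ^ (s / 15))),
      ← hW, ← ENNReal.ofReal_pow (p := 2 ^ (s / 15)) (by positivity),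
      ← ENNReal.ofReal_pow (p := ((2 : ℝ) ^ (s / 15))⁻¹ * (l / 120)) (by positivity)]
    have h1 : ENNReal.ofReal (((2 : ℝ) ^ (s / 15))⁻¹ ^ 5) *
        ENNReal.ofReal (((2 : ℝ) ^ (s / 15)) ^ 2) = ENNReal.ofReal (((2 : ℝ) ^ (s / 15))⁻¹) *
        ENNReal.ofReal ((120 / l) ^ 2) *
        ENNReal.ofReal ((((2 : ℝ) ^ (s / 15))⁻¹ * (l / 120)) ^ 2) := by
      rw [← ENNReal.ofReal_mul (by positivity), ← ENNReal.ofReal_mul (by positivity),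
        ← ENNReal.ofReal_mul (by positivity)]
      congr 1
      field_simp
    calc _ = (ENNReal.ofReal (((2 : ℝ) ^ (s / 15))⁻¹ ^ 5) *
        ENNReal.ofReal (((2 : ℝ) ^ (s / 15)) ^ 2)) * (sqC E * ENNReal.ofReal N ^ 2 * α * W) := by
          ring
      _ = _ := by rw [h1]; ring
  have hsub : {x | ∃ n, ENNReal.ofReal (l / 2) <
      ‖∑ s ∈ Finset.range n, scaleSum D f M s x‖ₑ} ⊆
      {x | ENNReal.ofReal (l / 4) ≤ ∑' s, Z s x} ∪
      ⋃ s : ℕ, {x | ENNReal.ofReal (((2 : ℝ) ^ (s / 15))⁻¹ * (l / 120)) < G s x} := by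
    rintro x ⟨n, hn⟩
    by_contra hx
    simp only [Set.mem_union, Set.mem_iUnion, Set.mem_ofPred_eq, not_or, not_exists, not_le,
      not_lt] at hx
    obtain ⟨hx1, hx2⟩ := hx
    refine absurd hn (not_lt.2 ?_)
    calc _ ≤ ∑ s ∈ Finset.range n, (G s x + Z s x) :=
          (enorm_sum_le _ _).trans (Finset.sum_le_sum fun s _ => hGZ s x)
      _ ≤ ∑' s, (G s x + Z s x) := ENNReal.sum_le_tsum _
      _ = (∑' s, G s x) + ∑' s, Z s x := ENNReal.tsum_add
      _ ≤ ENNReal.ofReal (l / 4) + ENNReal.ofReal (l / 4) := by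
          refine add_le_add ?_ hx1.le
          refine (ENNReal.tsum_le_tsum hx2).trans (le_of_eq ?_)
          have h1 : ∀ s : ℕ, ENNReal.ofReal (((2 : ℝ) ^ (s / 15))⁻¹ * (l / 120)) =
              ENNReal.ofReal (((2 : ℝ) ^ (s / 15))⁻¹) * ENNReal.ofReal (l / 120) := fun s =>
            ENNReal.ofReal_mul (by positivity)
          simp only [h1]
          rw [ENNReal.tsum_mul_right,
            tsum_nat_div_fifteen (fun p => ENNReal.ofReal (((2 : ℝ) ^ p)⁻¹)),
            tsum_two_pow_inv_ennreal]
          have h2 : (15 * 2 : ℝ≥0∞) = ENNReal.ofReal 30 := by norm_num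
          rw [h2, ← ENNReal.ofReal_mul (by norm_num)]
          congr 1
          ring
      _ = ENNReal.ofReal (l / 2) := by
          rw [← ENNReal.ofReal_add (by positivity) (by positivity)]
          congr 1
          ring
  refine (measure_mono hsub).trans ((measure_union_le _ _).trans (add_le_add ?_ ?_))
  · refine (meas_ge_le_lintegral_div (Measurable.tsum hZm).aemeasurable
      (by simp; positivity) ENNReal.ofReal_ne_top).trans ?_
    rw [lintegral_tsum fun s => (hZm s).aemeasurable]
    exact ENNReal.div_le_div_right hZs _
  · refine (measure_iUnion_le _).trans ((ENNReal.tsum_le_tsum hGs).trans (le_of_eq ?_))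
    rw [ENNReal.tsum_mul_right, tsum_nat_div_fifteen (fun p => ENNReal.ofReal (((2 : ℝ) ^ p)⁻¹)),
      tsum_two_pow_inv_ennreal]
    norm_num

end SumScales

section Assembly

variable {E : Type*} [NormedAddCommGroup E] [InnerProductSpace ℝ E] [FiniteDimensional ℝ E]
  [MeasurableSpace E] [BorelSpace E]

/-- The variable kernel `f w * M y w / ‖w‖ ^ d` with `w = x - y`. -/
def vker (f : E → ℂ) (M : E → E → ℂ) (x y : E) : ℂ :=
  f (x - y) * M y (x - y) * (((‖x - y‖ ^ Module.finrank ℝ E)⁻¹ : ℝ) : ℂ)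

theorem sum_range_skern (f m : E → ℂ) {i : ℤ} {n : ℕ} {w : E} (h1 : (2 : ℝ) ^ i ≤ ‖w‖)
    (h2 : ‖w‖ < 2 ^ (i + n)) :
    ∑ s ∈ Finset.range n, skern (i + s) f m w =
      f w * m w * (((‖w‖ ^ Module.finrank ℝ E)⁻¹ : ℝ) : ℂ) := by
  have hw : 0 < ‖w‖ := lt_of_lt_of_le (two_zpow_pos i) h1
  obtain ⟨j, hj1, hj2⟩ := exists_mem_Ico_zpow hw (one_lt_two (α := ℝ))
  have hij : i < j + 1 := (zpow_lt_zpow_iff_right₀ (one_lt_two (α := ℝ))).1 (h1.trans_lt hj2)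
  have hjn : j < i + n := (zpow_lt_zpow_iff_right₀ (one_lt_two (α := ℝ))).1 (hj1.trans_lt h2)
  have hjs : i + ((j - i).toNat : ℤ) = j := by omega
  rw [Finset.sum_eq_single (j - i).toNat]
  · rw [hjs, skern, Set.indicator_of_mem (show w ∈ shell E j from ⟨hj1, hj2⟩)]
  · intro s _ hs
    refine Set.indicator_of_notMem (fun hm => hs ?_) _
    have a1 : i + s < j + 1 :=
      (zpow_lt_zpow_iff_right₀ (one_lt_two (α := ℝ))).1 (hm.1.trans_lt hj2)
    have a2 : j < i + s + 1 :=
      (zpow_lt_zpow_iff_right₀ (one_lt_two (α := ℝ))).1 (hj1.trans_lt hm.2)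
    omega
  · intro h
    exact absurd (Finset.mem_range.2 (by omega)) h

theorem exists_lt_two_zpow_add (i : ℤ) (R : ℝ) : ∃ n : ℕ, R < 2 ^ (i + n) := by
  obtain ⟨n, hn⟩ := pow_unbounded_of_one_lt (R / 2 ^ i) (one_lt_two (α := ℝ))
  refine ⟨n, ?_⟩
  rw [div_lt_iff₀ (two_zpow_pos i)] at hn
  rw [zpow_add₀ two_ne_zero, zpow_natCast, mul_comm]
  exact hn

theorem exists_norm_sub_le_of_hasCompactSupport {b : E → ℂ} (hbc : HasCompactSupport b) (x : E) :
    ∃ R : ℝ, ∀ y, b y ≠ 0 → ‖x - y‖ ≤ R := by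
  obtain ⟨R, hR⟩ := hbc.isBounded.subset_closedBall x
  refine ⟨R, fun y hy => ?_⟩
  have := hR (subset_tsupport _ hy)
  rwa [mem_closedBall, dist_comm, dist_eq_norm] at this

variable [Nontrivial E] {f : E → ℂ} (hf : Measurable f)
  (hom : ∀ r : ℝ, 0 < r → ∀ x : E, x ≠ 0 → f (r • x) = f x)
  (hfi : ∫⁻ θ : sphere (0 : E) 1, ‖f θ‖ₑ ∂(volume : Measure E).toSphere < ∞)
  {M : E → E → ℂ} (hM : IsModulator M)

include hf hom hfi hM

theorem integrableOn_vker_mul {b : E → ℂ} (hb : Continuous b) (hbc : HasCompactSupport b)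
    {ε : ℝ} (hε : 0 < ε) (x : E) :
    IntegrableOn (fun y => vker f M x y * b y) {y | ε < ‖x - y‖} := by
  obtain ⟨R, hR⟩ := exists_norm_sub_le_of_hasCompactSupport hbc x
  obtain ⟨i, hi, -⟩ := exists_mem_Ico_zpow hε (one_lt_two (α := ℝ))
  obtain ⟨n, hn⟩ := exists_lt_two_zpow_add i R
  have h1 : Integrable fun y => ∑ s ∈ Finset.range n, skern (i + s) f (M y) (x - y) * b y :=
    integrable_finsetSum _ fun s _ => hM.integrable_skern_mul _ hf hom hfi hb
      (hbc.exists_bound_of_continuous hb) x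
  refine h1.integrableOn.congr_fun (fun y hy => ?_)
    (measurableSet_lt measurable_const (by fun_prop))
  by_cases h : b y = 0
  · simp [h]
  · simp only
    rw [← Finset.sum_mul, sum_range_skern f (M y) (hi.trans (le_of_lt hy)) ((hR y h).trans_lt hn)]
    rfl

theorem eventually_integral_vker_eq {ι : Type*} [Fintype ι] {α : ℝ≥0∞} (D : Atoms E ι α) {x : E}
    (hx : ∀ q, 2 * 2 ^ D.scale q < ‖x - D.center q‖) :
    ∃ n : ℕ, ∀ᶠ ε in 𝓝[>] (0 : ℝ), ∫ y in {y | ε < ‖x - y‖}, vker f M x y * ∑ q, D.fn q y =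
      ∑ s ∈ Finset.range n, scaleSum D f M s x := by
  have h1 : ∀ q, ∃ n : ℕ, ∀ y, D.fn q y ≠ 0 → ‖x - y‖ < 2 ^ (D.scale q + n) := fun q => by
    obtain ⟨R, hR⟩ := exists_norm_sub_le_of_hasCompactSupport (D.hasCompactSupport q) x
    obtain ⟨n, hn⟩ := exists_lt_two_zpow_add (D.scale q) R
    exact ⟨n, fun y hy => (hR y hy).trans_lt hn⟩
  choose n hn using h1
  refine ⟨Finset.univ.sup n, ?_⟩
  have h2 : ∀ᶠ ε in 𝓝[>] (0 : ℝ), ∀ q, ε < 2 ^ D.scale q :=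
    eventually_all.2 fun q => nhdsWithin_le_nhds (eventually_lt_nhds (two_zpow_pos _))
  have hlow : ∀ q y, D.fn q y ≠ 0 → (2 : ℝ) ^ D.scale q < ‖x - y‖ := by
    intro q y hy
    have a1 : ‖y - D.center q‖ ≤ 2 ^ D.scale q := not_lt.1 fun h => hy (D.supp q y h)
    have a2 : x - D.center q = (x - y) + (y - D.center q) := by abel
    have a3 := hx q
    rw [a2] at a3
    linarith [norm_add_le (x - y) (y - D.center q)]
  filter_upwards [h2, self_mem_nhdsWithin] with ε hε hε0
  have h3 : ∀ q, ∫ y in {y | ε < ‖x - y‖}, vker f M x y * D.fn q y =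
      ∑ s ∈ Finset.range (Finset.univ.sup n), ∫ y, skern (D.scale q + s) f (M y) (x - y) *
        D.fn q y := by
    intro q
    rw [← integral_finsetSum _ fun s _ => hM.integrable_skern_mul _ hf hom hfi (D.continuous q)
      (D.bounded q) x, ← integral_indicator (measurableSet_lt measurable_const (by fun_prop))]
    refine integral_congr_ae (Eventually.of_forall fun y => ?_)
    by_cases h : D.fn q y = 0
    · simp [Set.indicator, h]
    · have hm : y ∈ {y | ε < ‖x - y‖} := (hε q).trans (hlow q y h)
      simp only [Set.indicator_of_mem hm]
      rw [← Finset.sum_mul, sum_range_skern f (M y) (hlow q y h).le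
        ((hn q y h).trans_le (zpow_le_zpow_right₀ one_le_two ?_))]
      · rfl
      · have := Finset.le_sup (f := n) (Finset.mem_univ q)
        omega
  simp only [Finset.mul_sum, scaleSum]
  rw [integral_finsetSum _ fun q _ => integrableOn_vker_mul hf hom hfi hM (D.continuous q)
    (D.hasCompactSupport q) hε0 x, Finset.sum_comm]
  exact Finset.sum_congr rfl fun q _ => h3 q

omit [Nontrivial E] hom hfi in
theorem aestronglyMeasurable_of_tendsto_vker {b : E → ℂ} (hb : Continuous b) {u : E → ℂ}
    (hu : ∀ᵐ x : E, Tendsto (fun ε : ℝ => ∫ y in {y | ε < ‖x - y‖}, vker f M x y * b y)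
      (𝓝[>] 0) (𝓝 (u x))) : AEStronglyMeasurable u (volume : Measure E) := by
  have hseq : Tendsto (fun n : ℕ => (1 : ℝ) / (n + 1)) atTop (𝓝[>] 0) :=
    tendsto_nhdsWithin_iff.2 ⟨tendsto_one_div_add_atTop_nhds_zero_nat,
      Eventually.of_forall fun n => Set.mem_Ioi.2 (by positivity)⟩
  refine aestronglyMeasurable_of_tendsto_ae atTop
    (f := fun (n : ℕ) x => ∫ y in {y | (1 : ℝ) / (n + 1) < ‖x - y‖}, vker f M x y * b y)
    (fun n => ?_) (hu.mono fun x hx => hx.comp hseq)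
  have h1 : ∀ x, ∫ y in {y | (1 : ℝ) / (n + 1) < ‖x - y‖}, vker f M x y * b y =
      ∫ y, {p : E × E | (1 : ℝ) / (n + 1) < ‖p.1 - p.2‖}.indicator
        (fun p => vker f M p.1 p.2 * b p.2) (x, y) := fun x => by
    rw [← integral_indicator (measurableSet_lt measurable_const (by fun_prop))]
    rfl
  simp only [h1]
  refine StronglyMeasurable.aestronglyMeasurable (StronglyMeasurable.integral_prod_right' ?_)
  have hsub : Measurable fun p : E × E => p.1 - p.2 := measurable_fst.sub measurable_snd
  have h2 : Measurable fun p : E × E => (‖p.1 - p.2‖ ^ Module.finrank ℝ E)⁻¹ :=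
    (hsub.norm.pow_const _).inv
  have h3 : Measurable fun p : E × E => vker f M p.1 p.2 :=
    ((hf.comp hsub).mul (hM.meas.comp (measurable_snd.prodMk hsub))).mul
      (Complex.measurable_ofReal.comp h2)
  exact ((h3.mul (hb.measurable.comp measurable_snd)).indicator
    (measurableSet_lt measurable_const hsub.norm)).stronglyMeasurable

omit [Nontrivial E] hf hom hfi hM in
theorem volume_lt_le_eLpNorm_two {u : E → ℂ} (hu : AEStronglyMeasurable u (volume : Measure E))
    {l : ℝ} (hl : 0 < l) :
    volume {x | l < ‖u x‖} ≤ eLpNorm u 2 volume ^ 2 / ENNReal.ofReal (l ^ 2) := by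
  have h1 : eLpNorm u 2 volume ^ 2 = ∫⁻ x, ‖u x‖ₑ ^ 2 := by
    rw [eLpNorm_eq_lintegral_rpow_enorm_toReal (by norm_num) (by norm_num)]
    simp only [ENNReal.toReal_ofNat, ENNReal.rpow_ofNat]
    rw [← ENNReal.rpow_natCast, ← ENNReal.rpow_mul]
    norm_num
  rw [h1]
  refine (measure_mono fun x hx => ?_).trans (meas_ge_le_lintegral_div (hu.enorm.pow_const 2)
    (by simp; positivity) ENNReal.ofReal_ne_top)
  have hx' : l < ‖u x‖ := hx
  change ENNReal.ofReal (l ^ 2) ≤ ‖u x‖ₑ ^ 2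
  rw [← ofReal_norm, ← ENNReal.ofReal_pow (norm_nonneg _)]
  exact ENNReal.ofReal_le_ofReal (by gcongr)

end Assembly

section WeakType

/-- The constant of the weak type estimate. -/
def weakC (d : ℕ) : ℝ≥0∞ :=
  12 * ENNReal.ofReal (2 ^ (d + 1) + 1) +
    (2 ^ d * ENNReal.ofReal ((2 ^ (d + 1)) ^ d)) *
      volume (ball (0 : EuclideanSpace ℝ (Fin d)) 1) +
    (8 * (60 + 30 * singC (EuclideanSpace ℝ (Fin d))) +
      864000 * sqC (EuclideanSpace ℝ (Fin d)) * ENNReal.ofReal (2 ^ (d + 1)))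

theorem weakC_lt_top (d : ℕ) : weakC d < ∞ := by
  have h1 := singC_lt_top (E := EuclideanSpace ℝ (Fin d))
  have h2 := sqC_lt_top (E := EuclideanSpace ℝ (Fin d))
  have h3 : volume (ball (0 : EuclideanSpace ℝ (Fin d)) 1) < ∞ := measure_ball_lt_top
  rw [weakC]
  finiteness

variable {d : ℕ}

theorem volume_good_le {g : EuclideanSpace ℝ (Fin d) → ℂ} (hg : Continuous g)
    {u : EuclideanSpace ℝ (Fin d) → ℂ} (hu : AEStronglyMeasurable u volume) {H l K : ℝ}
    (hH : 0 < H) (hl : 0 < l) (hK : 0 < K)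
    (hgb : ∀ x, ‖g x‖ ≤ K * (l / H))
    (hL2 : eLpNorm u 2 volume ≤ ENNReal.ofReal H * eLpNorm g 2 volume) :
    volume {x | l / 2 < ‖u x‖} ≤
      4 * ENNReal.ofReal K * (ENNReal.ofReal (H / l) * ∫⁻ x, ‖g x‖ₑ) := by
  have h1 : eLpNorm g 2 volume ^ 2 = ∫⁻ x, ‖g x‖ₑ ^ 2 := by
    rw [eLpNorm_eq_lintegral_rpow_enorm_toReal (by norm_num) (by norm_num)]
    simp only [ENNReal.toReal_ofNat, ENNReal.rpow_ofNat]
    rw [← ENNReal.rpow_natCast, ← ENNReal.rpow_mul]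
    norm_num
  have h2 : ∫⁻ x, ‖g x‖ₑ ^ 2 ≤ ENNReal.ofReal (K * (l / H)) * ∫⁻ x, ‖g x‖ₑ := by
    rw [← lintegral_const_mul _ hg.measurable.enorm]
    refine lintegral_mono fun x => ?_
    rw [pow_two]
    refine mul_le_mul_left ?_ _
    rw [← ofReal_norm]
    exact ENNReal.ofReal_le_ofReal (hgb x)
  refine (volume_lt_le_eLpNorm_two hu (half_pos hl)).trans ?_
  refine ENNReal.div_le_of_le_mul ?_
  calc eLpNorm u 2 volume ^ 2 ≤ (ENNReal.ofReal H * eLpNorm g 2 volume) ^ 2 := by gcongr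
    _ ≤ ENNReal.ofReal H ^ 2 * (ENNReal.ofReal (K * (l / H)) * ∫⁻ x, ‖g x‖ₑ) := by
        rw [mul_pow, h1]; gcongr
    _ = 4 * ENNReal.ofReal K * (ENNReal.ofReal (H / l) * ∫⁻ x, ‖g x‖ₑ) *
        ENNReal.ofReal ((l / 2) ^ 2) := by
        have h4 : (4 : ℝ≥0∞) = ENNReal.ofReal 4 := by norm_num
        have h5 : ENNReal.ofReal H ^ 2 * ENNReal.ofReal (K * (l / H)) =
            ENNReal.ofReal 4 * ENNReal.ofReal K * ENNReal.ofReal (H / l) *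
              ENNReal.ofReal ((l / 2) ^ 2) := by
          rw [← ENNReal.ofReal_pow hH.le, ← ENNReal.ofReal_mul (by positivity),
            ← ENNReal.ofReal_mul (by positivity), ← ENNReal.ofReal_mul (by positivity),
            ← ENNReal.ofReal_mul (by positivity)]
          congr 1
          field_simp
          ring
        rw [h4, ← mul_assoc, h5]
        ring

theorem volume_iUnion_closedBall_le {ι : Type*} [Fintype ι]
    (c : ι → EuclideanSpace ℝ (Fin d)) (i : ι → ℤ) {a : ℝ} (ha : 0 < a) {W : ℝ≥0∞}
    (h : ENNReal.ofReal a * ∑ q, ENNReal.ofReal (((2 : ℝ) ^ i q) ^ d) ≤ W) :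
    volume (⋃ q, closedBall (c q) (2 * 2 ^ i q)) ≤
      2 ^ d * volume (ball (0 : EuclideanSpace ℝ (Fin d)) 1) * (ENNReal.ofReal a⁻¹ * W) := by
  have h1 : ∑ q, ENNReal.ofReal (((2 : ℝ) ^ i q) ^ d) ≤ ENNReal.ofReal a⁻¹ * W := by
    refine le_trans (le_of_eq ?_) (mul_le_mul_right h _)
    rw [← mul_assoc, ← ENNReal.ofReal_mul (by positivity), inv_mul_cancel₀ ha.ne']
    simp
  calc _ ≤ ∑ q, volume (closedBall (c q) (2 * 2 ^ i q)) := measure_iUnion_fintype_le _ _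
    _ = 2 ^ d * volume (ball (0 : EuclideanSpace ℝ (Fin d)) 1) *
        ∑ q, ENNReal.ofReal (((2 : ℝ) ^ i q) ^ d) := by
        rw [Finset.mul_sum]
        refine Finset.sum_congr rfl fun q _ => ?_
        have := two_zpow_pos (i q)
        rw [Measure.addHaar_closedBall _ _ (by positivity), finrank_euclideanSpace_fin, mul_pow,
          ENNReal.ofReal_mul (by positivity), ENNReal.ofReal_pow (by norm_num)]
        simp only [ENNReal.ofReal_ofNat]
        ring
    _ ≤ _ := mul_le_mul_right h1 _

set_option maxHeartbeats 1000000 in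
/-- The weak type bound for a principal value operator with kernel `f w * M y w / ‖w‖ ^ d`. -/
theorem volume_lt_le_of_isModulator (hd : d ≠ 0) {f : EuclideanSpace ℝ (Fin d) → ℂ}
    (hf : Measurable f)
    (hom : ∀ r : ℝ, 0 < r → ∀ x : EuclideanSpace ℝ (Fin d), x ≠ 0 → f (r • x) = f x)
    {N H : ℝ} (hN : 0 < N) (hH : 0 < H)
    (hfi : ∫⁻ θ : sphere (0 : EuclideanSpace ℝ (Fin d)) 1, ‖f θ‖ₑ
      ∂(volume : Measure (EuclideanSpace ℝ (Fin d))).toSphere = ENNReal.ofReal N)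
    (hNH : N ≤ H)
    (hlog : ∫⁻ θ : sphere (0 : EuclideanSpace ℝ (Fin d)) 1, ‖f θ‖ₑ *
        ENNReal.ofReal (1 + max (Real.log (‖f θ‖ / N)) 0)
      ∂(volume : Measure (EuclideanSpace ℝ (Fin d))).toSphere ≤ ENNReal.ofReal H)
    {M : EuclideanSpace ℝ (Fin d) → EuclideanSpace ℝ (Fin d) → ℂ} (hM : IsModulator M)
    {T : (EuclideanSpace ℝ (Fin d) → ℂ) → EuclideanSpace ℝ (Fin d) → ℂ}
    (hT : ∀ b : EuclideanSpace ℝ (Fin d) → ℂ, ContDiff ℝ (⊤ : ℕ∞) b → HasCompactSupport b →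
      ∀ᵐ x, Tendsto (fun ε : ℝ => ∫ y in {y | ε < ‖x - y‖}, vker f M x y * b y)
        (𝓝[>] 0) (𝓝 (T b x)))
    (hL2 : ∀ b : EuclideanSpace ℝ (Fin d) → ℂ, ContDiff ℝ (⊤ : ℕ∞) b → HasCompactSupport b →
      eLpNorm (T b) 2 volume ≤ ENNReal.ofReal H * eLpNorm b 2 volume)
    {l : ℝ} (hl : 0 < l) {b : EuclideanSpace ℝ (Fin d) → ℂ} (hb : ContDiff ℝ (⊤ : ℕ∞) b)
    (hbc : HasCompactSupport b) :
    volume {x | l < ‖T b x‖} ≤ weakC d * (ENNReal.ofReal (H / l) * ∫⁻ x, ‖b x‖ₑ) := by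
  have : Nonempty (Fin d) := ⟨⟨0, Nat.pos_of_ne_zero hd⟩⟩
  have : Nontrivial (EuclideanSpace ℝ (Fin d)) := inferInstance
  obtain ⟨ι, _, D, g, hg, hgc, hdec, hgb, hW, hsc⟩ :=
    exists_cz_decomposition hd hb hbc (div_pos hl hH)
  have hfi' : ∫⁻ θ : sphere (0 : EuclideanSpace ℝ (Fin d)) 1, ‖f θ‖ₑ
      ∂(volume : Measure (EuclideanSpace ℝ (Fin d))).toSphere < ∞ := by
    rw [hfi]; exact ENNReal.ofReal_lt_top
  have hTg := hT g hg hgc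
  have hsum : ∀ᵐ x : EuclideanSpace ℝ (Fin d), (∀ q, 2 * 2 ^ D.scale q < ‖x - D.center q‖) →
      ∃ n, T b x = T g x + ∑ s ∈ Finset.range n, scaleSum D f M s x := by
    filter_upwards [hT b hb hbc, hTg] with x h1 h2 hx
    obtain ⟨n, hn⟩ := eventually_integral_vker_eq hf hom hfi' hM D hx
    refine ⟨n, tendsto_nhds_unique h1 ((h2.add (tendsto_const_nhds
      (x := ∑ s ∈ Finset.range n, scaleSum D f M s x))).congr' ?_)⟩
    filter_upwards [hn, self_mem_nhdsWithin] with ε hε hε0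
    have i2 : IntegrableOn (fun y => vker f M x y * ∑ q, D.fn q y) {y | ε < ‖x - y‖} := by
      simp only [Finset.mul_sum]
      exact integrable_finsetSum _ fun q _ => integrableOn_vker_mul hf hom hfi' hM
        (D.continuous q) (D.hasCompactSupport q) hε0 x
    rw [← hε, ← integral_add (integrableOn_vker_mul hf hom hfi' hM hg.continuous hgc hε0 x) i2]
    simp only [hdec, mul_add]
  set W := ∑ q, ∫⁻ x, ‖D.fn q x‖ₑ with hWdef
  set Q := ENNReal.ofReal (H / l) * ∫⁻ x, ‖b x‖ₑ with hQ
  have hgi : ∫⁻ x, ‖g x‖ₑ ≤ 3 * ∫⁻ x, ‖b x‖ₑ := by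
    have hbm : Measurable fun x => ‖b x‖ₑ := hb.continuous.measurable.enorm
    have hDm : ∀ q, Measurable fun x => ‖D.fn q x‖ₑ := fun q => (D.continuous q).measurable.enorm
    calc ∫⁻ x, ‖g x‖ₑ ≤ ∫⁻ x, (‖b x‖ₑ + ∑ q, ‖D.fn q x‖ₑ) := by
          refine lintegral_mono fun x => ?_
          have h1 : g x = b x - ∑ q, D.fn q x := by rw [hdec x]; ring
          rw [h1]
          exact (enorm_sub_le).trans (add_le_add le_rfl (enorm_sum_le _ _))
      _ = (∫⁻ x, ‖b x‖ₑ) + W := by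
          rw [lintegral_add_left hbm, lintegral_finsetSum _ fun q _ => hDm q]
      _ ≤ (∫⁻ x, ‖b x‖ₑ) + 2 * ∫⁻ x, ‖b x‖ₑ := by gcongr
      _ = _ := by ring
  have hgood : volume {x | l / 2 < ‖T g x‖} ≤ 12 * ENNReal.ofReal (2 ^ (d + 1) + 1) * Q := by
    refine (volume_good_le hg.continuous (aestronglyMeasurable_of_tendsto_vker hf hM hg.continuous
      hTg) hH hl (K := 2 ^ (d + 1) + 1) (by positivity) hgb (hL2 g hg hgc)).trans ?_
    calc _ ≤ 4 * ENNReal.ofReal (2 ^ (d + 1) + 1) *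
        (ENNReal.ofReal (H / l) * (3 * ∫⁻ x, ‖b x‖ₑ)) := by gcongr
      _ = _ := by rw [hQ]; ring
  have hexc : volume (⋃ q, closedBall (D.center q) (2 * 2 ^ D.scale q)) ≤
      (2 ^ d * ENNReal.ofReal ((2 ^ (d + 1)) ^ d)) *
      volume (ball (0 : EuclideanSpace ℝ (Fin d)) 1) * Q := by
    refine (volume_iUnion_closedBall_le D.center D.scale (div_pos hl hH) hsc).trans
      (le_of_eq ?_)
    rw [inv_div, hQ]
    ring
  have hbad : volume {x | ∃ n, ENNReal.ofReal (l / 2) <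
      ‖∑ s ∈ Finset.range n, scaleSum D f M s x‖ₑ} ≤
      (8 * (60 + 30 * singC (EuclideanSpace ℝ (Fin d))) +
      864000 * sqC (EuclideanSpace ℝ (Fin d)) * ENNReal.ofReal (2 ^ (d + 1))) * Q := by
    refine (volume_scaleSum_le D hf hom hN hfi hM hl).trans ?_
    rw [add_mul _ _ Q]
    have hNH' := ENNReal.ofReal_le_ofReal hNH
    refine add_le_add ?_ ?_
    · refine ENNReal.div_le_of_le_mul ?_
      have h8 : ENNReal.ofReal H * 2 =
          8 * (ENNReal.ofReal (H / l) * ENNReal.ofReal (l / 4)) := by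
        have a1 : (8 : ℝ≥0∞) = ENNReal.ofReal 8 := by norm_num
        have a2 : (2 : ℝ≥0∞) = ENNReal.ofReal 2 := by norm_num
        rw [a1, a2, ← ENNReal.ofReal_mul (by positivity), ← ENNReal.ofReal_mul (by positivity),
          ← ENNReal.ofReal_mul (by positivity)]
        congr 1
        field_simp
        norm_num
      calc _ ≤ (30 * ENNReal.ofReal H + (30 + 30 * singC (EuclideanSpace ℝ (Fin d))) *
          ENNReal.ofReal H) * (2 * ∫⁻ x, ‖b x‖ₑ) := by gcongr
        _ = (60 + 30 * singC (EuclideanSpace ℝ (Fin d))) * (ENNReal.ofReal H * 2) *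
            ∫⁻ x, ‖b x‖ₑ := by ring
        _ = _ := by rw [h8, hQ]; ring
    · have h9 : ENNReal.ofReal ((120 / l) ^ 2) * ENNReal.ofReal H ^ 2 *
          ENNReal.ofReal (2 ^ (d + 1) * (l / H)) =
          14400 * ENNReal.ofReal (2 ^ (d + 1)) * ENNReal.ofReal (H / l) := by
        have a1 : (14400 : ℝ≥0∞) = ENNReal.ofReal 14400 := by norm_num
        rw [a1, ← ENNReal.ofReal_pow hH.le, ← ENNReal.ofReal_mul (by positivity),
          ← ENNReal.ofReal_mul (by positivity), ← ENNReal.ofReal_mul (by positivity),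
          ← ENNReal.ofReal_mul (by positivity)]
        congr 1
        generalize (2 : ℝ) ^ (d + 1) = z
        field_simp
        ring
      calc _ ≤ 30 * (ENNReal.ofReal ((120 / l) ^ 2) * (sqC (EuclideanSpace ℝ (Fin d)) *
          ENNReal.ofReal H ^ 2 * ENNReal.ofReal (2 ^ (d + 1) * (l / H)) *
          (2 * ∫⁻ x, ‖b x‖ₑ))) := by gcongr
        _ = 60 * sqC (EuclideanSpace ℝ (Fin d)) * (ENNReal.ofReal ((120 / l) ^ 2) *
          ENNReal.ofReal H ^ 2 * ENNReal.ofReal (2 ^ (d + 1) * (l / H))) *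
          ∫⁻ x, ‖b x‖ₑ := by ring
        _ = _ := by rw [h9, hQ]; ring
  have hsub : ∀ᵐ x : EuclideanSpace ℝ (Fin d), x ∈ {x | l < ‖T b x‖} →
      x ∈ {x | l / 2 < ‖T g x‖} ∪ (⋃ q, closedBall (D.center q) (2 * 2 ^ D.scale q)) ∪
      {x | ∃ n, ENNReal.ofReal (l / 2) < ‖∑ s ∈ Finset.range n, scaleSum D f M s x‖ₑ} := by
    filter_upwards [hsum] with x hx hl1
    have hl1' : l < ‖T b x‖ := hl1
    by_contra hno
    simp only [Set.mem_union, Set.mem_iUnion, Set.mem_ofPred_eq, not_or, not_exists,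
      mem_closedBall, dist_eq_norm, not_le, not_lt] at hno
    obtain ⟨⟨h1, h2⟩, h3⟩ := hno
    obtain ⟨n, hn⟩ := hx h2
    have h4 := h3 n
    rw [← ofReal_norm, ENNReal.ofReal_le_ofReal_iff (by positivity)] at h4
    rw [hn] at hl1'
    linarith [norm_add_le (T g x) (∑ s ∈ Finset.range n, scaleSum D f M s x)]
  refine (measure_mono_ae hsub).trans ((measure_union_le _ _).trans ?_)
  rw [weakC, add_mul _ _ Q, add_mul _ _ Q]
  exact add_le_add ((measure_union_le _ _).trans (add_le_add hgood hexc)) hbad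

end WeakType

section Modulator

variable {E : Type*} [NormedAddCommGroup E] [InnerProductSpace ℝ E] [FiniteDimensional ℝ E]
  [MeasurableSpace E] [BorelSpace E]

theorem isModulator_of_lipschitz {A : E → ℝ} {L K : NNReal} (hA : LipschitzWith L A)
    {Φ : ℝ → ℝ} (hΦ : LipschitzWith K Φ) {C : ℝ} (hC : 0 < C) (hb : ∀ t, |Φ t| ≤ C)
    (hLK : 2 * (K * L) ≤ C) :
    IsModulator fun y w : E => ((Φ ((A (y + w) - A y) / ‖w‖) / C : ℝ) : ℂ) := by
  have hAd : ∀ u v : E, |A u - A v| ≤ L * ‖u - v‖ := fun u v => by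
    simpa [dist_eq_norm] using hA.dist_le_mul u v
  have hΦd : ∀ u v : ℝ, |Φ u - Φ v| ≤ K * |u - v| := fun u v => by
    simpa [Real.dist_eq] using hΦ.dist_le_mul u v
  have hkey : ∀ u v r : ℝ, 0 ≤ r → |u - v| ≤ 2 * L * r →
      ‖((Φ u / C : ℝ) : ℂ) - ((Φ v / C : ℝ) : ℂ)‖ ≤ r := by
    intro u v r hr h
    rw [← Complex.ofReal_sub, Complex.norm_real, Real.norm_eq_abs, ← sub_div, abs_div,
      abs_of_pos hC, div_le_iff₀ hC]
    calc |Φ u - Φ v| ≤ K * (2 * L * r) :=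
          (hΦd u v).trans (mul_le_mul_of_nonneg_left h K.coe_nonneg)
      _ = r * (2 * (K * L)) := by ring
      _ ≤ r * C := mul_le_mul_of_nonneg_left hLK hr
  refine ⟨?_, ?_, ?_, ?_⟩
  · have h1 := hA.continuous.measurable
    have h2 := hΦ.continuous.measurable
    have h3 : Measurable fun p : E × E => (A (p.1 + p.2) - A p.1) / ‖p.2‖ :=
      ((h1.comp (measurable_fst.add measurable_snd)).sub (h1.comp measurable_fst)).div
        measurable_snd.norm
    exact Complex.measurable_ofReal.comp ((h2.comp h3).div_const C)
  · intro y w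
    rw [Complex.norm_real, Real.norm_eq_abs, abs_div, abs_of_pos hC, div_le_one hC]
    exact hb _
  · intro y θ hθ r r' hr hr'
    refine hkey _ _ _ (by positivity) ?_
    rw [norm_smul, norm_smul, hθ, Real.norm_of_nonneg hr.le, Real.norm_of_nonneg hr'.le, mul_one,
      mul_one]
    have h1 := hAd (y + r • θ) (y + r' • θ)
    have h2 := hAd (y + r' • θ) y
    have e1 : y + r • θ - (y + r' • θ) = (r - r') • θ := by rw [sub_smul]; abel
    rw [e1, norm_smul, hθ, mul_one, Real.norm_eq_abs] at h1
    rw [add_sub_cancel_left, norm_smul, hθ, mul_one, Real.norm_of_nonneg hr'.le] at h2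
    have e2 : (A (y + r • θ) - A y) / r - (A (y + r' • θ) - A y) / r' =
        ((A (y + r • θ) - A (y + r' • θ)) - (A (y + r' • θ) - A y) * (r - r') / r') / r := by
      field_simp
      ring
    rw [e2, abs_div, abs_of_pos hr, ← mul_div_assoc]
    refine div_le_div_of_nonneg_right ?_ hr.le
    refine (abs_sub _ _).trans ?_
    have h3 : |(A (y + r' • θ) - A y) * (r - r') / r'| ≤ L * |r - r'| := by
      rw [abs_div, abs_mul, abs_of_pos hr', div_le_iff₀ hr']
      calc _ ≤ L * r' * |r - r'| := mul_le_mul_of_nonneg_right h2 (abs_nonneg _)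
        _ = _ := by ring
    linarith
  · intro y c w
    refine hkey _ _ _ (by positivity) ?_
    rw [← sub_div, abs_div, abs_norm, ← mul_div_assoc]
    refine div_le_div_of_nonneg_right ?_ (norm_nonneg _)
    have h1 := hAd (y + w) (c + w)
    have h2 := hAd y c
    rw [add_sub_add_right_eq_sub] at h1
    have e1 : A (y + w) - A y - (A (c + w) - A c) = (A (y + w) - A (c + w)) - (A y - A c) := by
      ring
    rw [e1]
    linarith [abs_sub (A (y + w) - A (c + w)) (A y - A c)]

/-- A function analytic near `[-L, L]` agrees there with a bounded Lipschitz function. -/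
theorem exists_lipschitz_bounded_of_analyticOnNhd {F : ℝ → ℝ} {L : NNReal}
    (hF : AnalyticOnNhd ℝ F {t : ℝ | |t| ≤ (L : ℝ)}) :
    ∃ (Φ : ℝ → ℝ) (K : NNReal) (C : ℝ), LipschitzWith K Φ ∧ (∀ t, |Φ t| ≤ C) ∧
      ∀ t : ℝ, |t| ≤ L → Φ t = F t := by
  have hs : {t : ℝ | |t| ≤ (L : ℝ)} = Set.Icc (-(L : ℝ)) L := by
    ext t; simp [abs_le]
  rw [hs] at hF
  have hle : -(L : ℝ) ≤ L := by linarith [L.coe_nonneg]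
  obtain ⟨K, hK⟩ := ContDiffOn.exists_lipschitzOnWith (n := 1) (fun t ht =>
    (hF t ht).contDiffAt.contDiffWithinAt) one_ne_zero (convex_Icc _ _) isCompact_Icc
  obtain ⟨C, hC⟩ := isCompact_Icc.exists_bound_of_continuousOn hF.continuousOn
  refine ⟨Set.IccExtend hle (Set.domRestrict _ F), K, C, ?_, fun t => hC _ (Subtype.coe_prop _),
    fun t ht => ?_⟩
  · have := (lipschitzOnWith_iff_restrict.1 hK).comp (LipschitzWith.projIcc hle)
    rwa [mul_one] at this
  · rw [Set.IccExtend_of_mem _ _ (abs_le.1 ht)]; rfl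

end Modulator

section SphereIntegrals

variable {d : ℕ} {Ω : EuclideanSpace ℝ (Fin d) → ℝ}

theorem abs_mul_one_add_log_le (a : ℝ) {N : ℝ} (hN : 0 < N) :
    |a| * (1 + max (Real.log (|a| / N)) 0) ≤
      (1 + |Real.log N|) * |a| + |a| * Real.log (2 + |a|) := by
  rcases eq_or_ne a 0 with rfl | ha
  · simp
  · have ha' := abs_pos.2 ha
    have h1 : max (Real.log (|a| / N)) 0 ≤ |Real.log N| + Real.log (2 + |a|) := by
      have h2 : 0 ≤ Real.log (2 + |a|) := Real.log_nonneg (by linarith)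
      refine max_le ?_ (by positivity)
      rw [Real.log_div ha'.ne' hN.ne']
      have := Real.log_le_log ha' (show |a| ≤ 2 + |a| by linarith)
      linarith [neg_abs_le (Real.log N)]
    nlinarith

theorem abs_le_two_mul_log (a : ℝ) : |a| ≤ 2 * (|a| * Real.log (2 + |a|)) := by
  have h1 : 1 / 2 ≤ Real.log (2 + |a|) := by
    have := Real.log_le_log two_pos (show 2 ≤ 2 + |a| by linarith [abs_nonneg a])
    linarith [Real.log_two_gt_d9]
  nlinarith [abs_nonneg a]

theorem integrable_abs_of_llogl (hΩ : Measurable Ω)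
    (h : Integrable (fun θ : sphere (0 : EuclideanSpace ℝ (Fin d)) 1 =>
      |Ω θ| * Real.log (2 + |Ω θ|)) (sphereMeasure d)) :
    Integrable (fun θ : sphere (0 : EuclideanSpace ℝ (Fin d)) 1 => |Ω θ|) (sphereMeasure d) := by
  have hm : Measurable fun θ : sphere (0 : EuclideanSpace ℝ (Fin d)) 1 => Ω θ :=
    hΩ.comp measurable_subtype_coe
  refine (h.const_mul 2).mono' hm.abs.aestronglyMeasurable (Eventually.of_forall fun θ => ?_)
  rw [Real.norm_of_nonneg (abs_nonneg _)]
  exact abs_le_two_mul_log _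

theorem integrable_one_add_log (hΩ : Measurable Ω)
    (h : Integrable (fun θ : sphere (0 : EuclideanSpace ℝ (Fin d)) 1 =>
      |Ω θ| * Real.log (2 + |Ω θ|)) (sphereMeasure d)) {N : ℝ} (hN : 0 < N) :
    Integrable (fun θ : sphere (0 : EuclideanSpace ℝ (Fin d)) 1 =>
      |Ω θ| * (1 + max (Real.log (|Ω θ| / N)) 0)) (sphereMeasure d) := by
  have hm : Measurable fun θ : sphere (0 : EuclideanSpace ℝ (Fin d)) 1 => Ω θ :=
    hΩ.comp measurable_subtype_coe
  refine (((integrable_abs_of_llogl hΩ h).const_mul (1 + |Real.log N|)).add h).mono'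
    (Measurable.aestronglyMeasurable (by fun_prop)) (Eventually.of_forall fun θ => ?_)
  rw [Real.norm_of_nonneg (by positivity)]
  exact abs_mul_one_add_log_le _ hN

theorem sphLlogL_nonneg (d : ℕ) (Ω : EuclideanSpace ℝ (Fin d) → ℝ) : 0 ≤ sphLlogL d Ω :=
  integral_nonneg fun θ => mul_nonneg (abs_nonneg _)
    (Real.log_nonneg (by linarith [abs_nonneg (Ω θ)]))

theorem sphL1_le_integral_one_add_log (hΩ : Measurable Ω)
    (h : Integrable (fun θ : sphere (0 : EuclideanSpace ℝ (Fin d)) 1 =>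
      |Ω θ| * Real.log (2 + |Ω θ|)) (sphereMeasure d)) {N : ℝ} (hN : 0 < N) :
    sphL1 d Ω ≤ ∫ θ : sphere (0 : EuclideanSpace ℝ (Fin d)) 1,
      |Ω θ| * (1 + max (Real.log (|Ω θ| / N)) 0) ∂(sphereMeasure d) :=
  integral_mono (integrable_abs_of_llogl hΩ h) (integrable_one_add_log hΩ h hN) fun θ =>
    le_mul_of_one_le_right (abs_nonneg _) (by simp)

theorem sphLlogL_eq_zero_of_sphL1_eq_zero (hΩ : Measurable Ω)
    (h : Integrable (fun θ : sphere (0 : EuclideanSpace ℝ (Fin d)) 1 =>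
      |Ω θ| * Real.log (2 + |Ω θ|)) (sphereMeasure d)) (h0 : sphL1 d Ω = 0) :
    sphLlogL d Ω = 0 := by
  have h1 := (integral_eq_zero_iff_of_nonneg (fun θ => abs_nonneg _)
    (integrable_abs_of_llogl hΩ h)).1 h0
  refine integral_eq_zero_of_ae (h1.mono fun θ hθ => ?_)
  have : |Ω θ| = 0 := hθ
  simp [this]

theorem lintegral_enorm_const_mul_eq (hΩ : Measurable Ω)
    (h : Integrable (fun θ : sphere (0 : EuclideanSpace ℝ (Fin d)) 1 =>
      |Ω θ| * Real.log (2 + |Ω θ|)) (sphereMeasure d)) {C : ℝ} (hC : 0 < C) :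
    ∫⁻ θ : sphere (0 : EuclideanSpace ℝ (Fin d)) 1, ‖((C * Ω θ : ℝ) : ℂ)‖ₑ ∂(sphereMeasure d) =
      ENNReal.ofReal (C * sphL1 d Ω) := by
  rw [sphL1, ← integral_const_mul, ofReal_integral_eq_lintegral_ofReal
    ((integrable_abs_of_llogl hΩ h).const_mul C)
    (Eventually.of_forall fun θ => by positivity)]
  refine lintegral_congr fun θ => ?_
  rw [← ofReal_norm, Complex.norm_real, Real.norm_eq_abs, abs_mul, abs_of_pos hC]

theorem lintegral_enorm_const_mul_log_eq (hΩ : Measurable Ω)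
    (h : Integrable (fun θ : sphere (0 : EuclideanSpace ℝ (Fin d)) 1 =>
      |Ω θ| * Real.log (2 + |Ω θ|)) (sphereMeasure d)) {C : ℝ} (hC : 0 < C) {N : ℝ} (hN : 0 < N) :
    ∫⁻ θ : sphere (0 : EuclideanSpace ℝ (Fin d)) 1, ‖((C * Ω θ : ℝ) : ℂ)‖ₑ *
      ENNReal.ofReal (1 + max (Real.log (‖((C * Ω θ : ℝ) : ℂ)‖ / (C * N))) 0)
        ∂(sphereMeasure d) =
      ENNReal.ofReal (C * ∫ θ : sphere (0 : EuclideanSpace ℝ (Fin d)) 1,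
        |Ω θ| * (1 + max (Real.log (|Ω θ| / N)) 0) ∂(sphereMeasure d)) := by
  rw [← integral_const_mul, ofReal_integral_eq_lintegral_ofReal
    ((integrable_one_add_log hΩ h hN).const_mul C)
    (Eventually.of_forall fun θ => by positivity)]
  refine lintegral_congr fun θ => ?_
  rw [← ofReal_norm, Complex.norm_real, Real.norm_eq_abs, abs_mul, abs_of_pos hC,
    mul_div_mul_left _ _ hC.ne', ← ENNReal.ofReal_mul (by positivity), mul_assoc]

end SphereIntegrals

theorem general_calderon_commutator_weak11
    (d : ℕ) (hd : 2 ≤ d) (A₀ : ℝ) (hA₀ : 0 < A₀)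
    (F : ℝ → ℝ) (A : EuclideanSpace ℝ (Fin d) → ℝ) (L : NNReal)
    -- A is Lipschitz with constant L = ‖∇A‖_∞
    (hLip : LipschitzWith L A)
    -- F is even and real analytic on {|t| ≤ ‖∇A‖_∞}
    (hFeven : ∀ t : ℝ, F (-t) = F t)
    (hFanalytic : AnalyticOnNhd ℝ F {t : ℝ | |t| ≤ (L : ℝ)}) :
    ∃ C : ℝ, 0 < C ∧
      ∀ (Ω : EuclideanSpace ℝ (Fin d) → ℝ)
        (T : (EuclideanSpace ℝ (Fin d) → ℂ) → EuclideanSpace ℝ (Fin d) → ℂ),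
        -- Ω is measurable, homogeneous of degree zero, odd, and in L log⁺ L(S^{d-1})
        Measurable Ω →
        (∀ r : ℝ, 0 < r → ∀ x : EuclideanSpace ℝ (Fin d), x ≠ 0 → Ω (r • x) = Ω x) →
        (∀ x : EuclideanSpace ℝ (Fin d), x ≠ 0 → Ω (-x) = -Ω x) →
        Integrable (fun θ : sphere (0 : EuclideanSpace ℝ (Fin d)) 1 =>
          |Ω θ| * Real.log (2 + |Ω θ|)) (sphereMeasure d) →
        -- T f is the a.e. principal value of the general Calderón commutator
        (∀ f : EuclideanSpace ℝ (Fin d) → ℂ, ContDiff ℝ (⊤ : ℕ∞) f → HasCompactSupport f →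
          ∀ᵐ x : EuclideanSpace ℝ (Fin d) ∂volume,
            Tendsto (fun ε : ℝ =>
                ∫ y in {y : EuclideanSpace ℝ (Fin d) | ε < ‖x - y‖},
                  ((Ω (x - y) / ‖x - y‖ ^ d * F ((A x - A y) / ‖x - y‖) : ℝ) : ℂ) * f y)
              (𝓝[>] 0) (𝓝 (T f x))) →
        -- the L² bound (Theorem E of Calderón–Calderón–Fabes–Jodeit–Rivière)
        (∀ f : EuclideanSpace ℝ (Fin d) → ℂ, ContDiff ℝ (⊤ : ℕ∞) f → HasCompactSupport f →
          eLpNorm (T f) 2 volume ≤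
            ENNReal.ofReal (A₀ * sphLlogL d Ω) * eLpNorm f 2 volume) →
        -- weak type (1,1) bound
        ∀ lam : ℝ, 0 < lam →
          ∀ f : EuclideanSpace ℝ (Fin d) → ℂ, ContDiff ℝ (⊤ : ℕ∞) f → HasCompactSupport f →
            volume {x : EuclideanSpace ℝ (Fin d) | lam < ‖T f x‖} ≤
              ENNReal.ofReal (C * lam⁻¹ * COmega d Ω) * eLpNorm f 1 volume := by

  obtain ⟨Φ, K, C₀, hΦ, hΦb, hΦF⟩ := exists_lipschitz_bounded_of_analyticOnNhd hFanalytic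
  obtain ⟨C₁, hC₁, hb₁, hK₁⟩ : ∃ C₁ : ℝ, 0 < C₁ ∧ (∀ t, |Φ t| ≤ C₁) ∧ 2 * ((K : ℝ) * L) ≤ C₁ :=
    ⟨|C₀| + 2 * (K * L) + 1, by positivity, fun t => (hΦb t).trans
      (by nlinarith [le_abs_self C₀, mul_nonneg K.coe_nonneg L.coe_nonneg]),
      by linarith [abs_nonneg C₀]⟩
  have hM := isModulator_of_lipschitz hLip hΦ hC₁ hb₁ hK₁
  refine ⟨((weakC d).toReal + 1) * (A₀ + C₁), by positivity, ?_⟩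
  intro Ω T hΩ hom _ hlog hT hL2 lam hlam f hf hfc
  have hd0 : d ≠ 0 := by omega
  set ω : EuclideanSpace ℝ (Fin d) → ℂ := fun x => ((C₁ * Ω x : ℝ) : ℂ) with hω
  have hωm : Measurable ω := Complex.measurable_ofReal.comp (hΩ.const_mul C₁)
  have hωh : ∀ r : ℝ, 0 < r → ∀ x, x ≠ 0 → ω (r • x) = ω x := fun r hr x hx => by
    simp only [hω, hom r hr x hx]
  set M : EuclideanSpace ℝ (Fin d) → EuclideanSpace ℝ (Fin d) → ℂ :=
    fun y w => ((Φ ((A (y + w) - A y) / ‖w‖) / C₁ : ℝ) : ℂ) with hMdef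
  have hker : ∀ x y, ((Ω (x - y) / ‖x - y‖ ^ d * F ((A x - A y) / ‖x - y‖) : ℝ) : ℂ) =
      vker ω M x y := by
    intro x y
    have hr : |(A x - A y) / ‖x - y‖| ≤ L := by
      rw [abs_div, abs_norm]
      refine div_le_of_le_mul₀ (norm_nonneg _) L.coe_nonneg ?_
      simpa [dist_eq_norm] using hLip.dist_le_mul x y
    simp only [vker, hω, hMdef, finrank_euclideanSpace_fin, add_sub_cancel]
    rw [← hΦF _ hr, ← Complex.ofReal_mul, ← Complex.ofReal_mul]
    congr 1
    field_simp
  simp only [hker] at hT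
  have hTm : AEStronglyMeasurable (T f) volume :=
    aestronglyMeasurable_of_tendsto_vker hωm hM hf.continuous (hT f hf hfc)
  have hnn : 0 ≤ sphL1 d Ω := integral_nonneg fun θ => abs_nonneg _
  rcases hnn.eq_or_lt with h0 | h0
  · have h1 := hL2 f hf hfc
    rw [sphLlogL_eq_zero_of_sphL1_eq_zero hΩ hlog h0.symm, mul_zero, ENNReal.ofReal_zero,
      zero_mul, nonpos_iff_eq_zero, eLpNorm_eq_zero_iff hTm two_ne_zero] at h1
    have h2 : volume {x | lam < ‖T f x‖} = 0 := by
      refine measure_mono_null (fun x hx => ?_) h1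
      intro h3
      have h4 : lam < ‖T f x‖ := hx
      rw [show T f x = 0 from h3, norm_zero] at h4
      exact absurd h4 (not_lt.2 hlam.le)
    rw [h2]
    exact zero_le
  · set J := ∫ θ : sphere (0 : EuclideanSpace ℝ (Fin d)) 1,
      |Ω θ| * (1 + max (Real.log (|Ω θ| / sphL1 d Ω)) 0) ∂(sphereMeasure d) with hJ
    have hS := sphLlogL_nonneg d Ω
    have hNJ : sphL1 d Ω ≤ J := sphL1_le_integral_one_add_log hΩ hlog h0
    have hCO : COmega d Ω = sphLlogL d Ω + J := rfl
    have hH : 0 < (A₀ + C₁) * COmega d Ω := mul_pos (by positivity) (by linarith)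
    have hJH : C₁ * J ≤ (A₀ + C₁) * COmega d Ω := by
      rw [hCO]; nlinarith [mul_nonneg hA₀.le hS, mul_nonneg hC₁.le hS,
        mul_nonneg hA₀.le (h0.le.trans hNJ)]
    have hSH : A₀ * sphLlogL d Ω ≤ (A₀ + C₁) * COmega d Ω := by
      rw [hCO]; nlinarith [mul_nonneg hC₁.le hS, mul_nonneg hA₀.le (h0.le.trans hNJ),
        mul_nonneg hC₁.le (h0.le.trans hNJ)]
    have hmain := volume_lt_le_of_isModulator hd0 hωm hωh (mul_pos hC₁ h0) hH
      (lintegral_enorm_const_mul_eq hΩ hlog hC₁)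
      ((mul_le_mul_of_nonneg_left hNJ hC₁.le).trans hJH)
      ((lintegral_enorm_const_mul_log_eq hΩ hlog hC₁ h0).le.trans
        (ENNReal.ofReal_le_ofReal hJH)) hM hT
      (fun b hb hbc => (hL2 b hb hbc).trans (mul_le_mul_left (ENNReal.ofReal_le_ofReal hSH) _))
      hlam hf hfc
    refine hmain.trans ?_
    rw [eLpNorm_one_eq_lintegral_enorm, ← mul_assoc]
    refine mul_le_mul_left ?_ _
    calc weakC d * ENNReal.ofReal ((A₀ + C₁) * COmega d Ω / lam)
        ≤ ENNReal.ofReal ((weakC d).toReal + 1) *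
          ENNReal.ofReal ((A₀ + C₁) * COmega d Ω / lam) := by
          refine mul_le_mul_left ?_ _
          rw [← ENNReal.ofReal_toReal (weakC_lt_top d).ne]
          refine ENNReal.ofReal_le_ofReal ?_
          rw [ENNReal.toReal_ofReal ENNReal.toReal_nonneg]
          linarith
      _ = _ := by
          rw [← ENNReal.ofReal_mul (by positivity)]
          congr 1
          ring

end
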